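/- arXiv:2306.13736 — 5 statements merged into one kernel-verified Lean document; each statement's English description precedes it below -/
import Mathlib

section
/- Let T be a finite nonempty set of tile types, M a nonempty set, H and V binary relations on M, and p : M → T a labeling. Assume: (i) H and V are serial, i.e., every x ∈ M has some y with H(x,y) and some y with V(x,y); (ii) H and V commute confluently: for all x, y ∈ M, (∃ z, H(x,z) ∧ V(z,y)) ↔ (∃ z, V(x,z) ∧ H(z,y)); (iii) for all x, y ∈ M, if H(x,y) then the right color of p(x) equals the left color of p(y); (iv) for all x, y ∈ M, if V(x,y) then the top color of p(x) equals the bottom color of p(y). Then there exists a T-tiling of ℕ × ℕ, i.e., a function f : ℕ × ℕ → T such that for all i, j ∈ ℕ the right color of f(i,j) equals the left color of f(i+1,j) and the top color of f(i,j) equals the bottom color of f(i,j+1). -/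
/-- A tile type: a quadruple of colors `(left, right, up, down)`, colors being naturals. -/
abbrev Tile : Type := ℕ × ℕ × ℕ × ℕ

/-- The color of the left edge of a tile type. -/
def Tile.left (t : Tile) : ℕ := t.1
/-- The color of the right edge of a tile type. -/
def Tile.right (t : Tile) : ℕ := t.2.1
/-- The color of the top edge of a tile type. -/
def Tile.up (t : Tile) : ℕ := t.2.2.1
/-- The color of the bottom edge of a tile type. -/
def Tile.down (t : Tile) : ℕ := t.2.2.2

/-- A `T`-tiling of the full grid `ℕ × ℕ`: horizontally adjacent tiles match
(right color = left color of the right neighbour) and vertically adjacent tiles match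
(top color = bottom color of the tile above). -/
def IsPlaneTiling (T : Finset Tile) (f : ℕ × ℕ → {t : Tile // t ∈ T}) : Prop :=
  ∀ i j : ℕ,
    Tile.right (f (i, j)).val = Tile.left (f (i + 1, j)).val ∧
    Tile.up (f (i, j)).val = Tile.down (f (i, j + 1)).val

/-- If `S` commutes past `R`, every finite `R`-path lifts along `S` to an `R`-path. -/
theorem exists_lift_path {M : Type*} {R S : M → M → Prop} (serial : ∀ x, ∃ y, S x y)
    (comm : ∀ x z y, R x z → S z y → ∃ w, S x w ∧ R w y) (n : ℕ) (a : ℕ → M)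
    (ha : ∀ i < n, R (a i) (a (i + 1))) :
    ∃ b : ℕ → M, (∀ i ≤ n, S (a i) (b i)) ∧ ∀ i < n, R (b i) (b (i + 1)) := by
  induction n generalizing a with
  | zero =>
    obtain ⟨y, hy⟩ := serial (a 0)
    refine ⟨fun _ => y, fun i hi => ?_, fun i hi => absurd hi (Nat.not_lt_zero i)⟩
    rwa [Nat.le_zero.mp hi]
  | succ n ih =>
    obtain ⟨b, hS, hR⟩ := ih (fun i => a (i + 1)) fun i hi => ha (i + 1) (by omega)
    obtain ⟨w, hw, hwb⟩ := comm _ _ _ (ha 0 (by omega)) (hS 0 (by omega))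
    refine ⟨fun i => Nat.casesOn i w b, fun i hi => ?_, fun i hi => ?_⟩
    · cases i with
      | zero => exact hw
      | succ i => exact hS i (by omega)
    · cases i with
      | zero => exact hwb
      | succ i => exact hR i (by omega)

/-- The restriction of `g` to `[0, m] × [0, n]` is a grid for the relations `H` and `V`. -/
def IsGrid {M : Type*} (H V : M → M → Prop) (m n : ℕ) (g : ℕ → ℕ → M) : Prop :=
  (∀ i < m, ∀ j ≤ n, H (g i j) (g (i + 1) j)) ∧ ∀ i ≤ m, ∀ j < n, V (g i j) (g i (j + 1))

theorem IsGrid.flip {M : Type*} {H V : M → M → Prop} {m n : ℕ} {g : ℕ → ℕ → M}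
    (hg : IsGrid H V m n g) : IsGrid V H n m (flip g) :=
  ⟨fun i hi j hj => hg.2 j hj i hi, fun i hi j hj => hg.1 j hj i hi⟩

/-- A finite grid can be extended by one column without changing its points. -/
theorem IsGrid.exists_extend_right {M : Type*} {H V : M → M → Prop} {m n : ℕ} {g : ℕ → ℕ → M}
    (hg : IsGrid H V m n g) (serial : ∀ x, ∃ y, H x y)
    (comm : ∀ x z y, V x z → H z y → ∃ w, H x w ∧ V w y) :
    ∃ g', IsGrid H V (m + 1) n g' ∧ ∀ i ≤ m, ∀ j, g' i j = g i j := by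
  obtain ⟨b, hH, hV⟩ := exists_lift_path serial comm n (g m) (hg.2 m le_rfl)
  have old : ∀ i ≤ m, ∀ j, (if i ≤ m then g i j else b j) = g i j := fun i hi j => if_pos hi
  have new : ∀ j, (if m + 1 ≤ m then g (m + 1) j else b j) = b j := fun j => if_neg (by omega)
  refine ⟨fun i j => if i ≤ m then g i j else b j, ⟨fun i hi j hj => ?_, fun i hi j hj => ?_⟩, old⟩
  · rcases Nat.lt_succ_iff_lt_or_eq.mp hi with hi | rfl
    · simpa only [old i hi.le, old (i + 1) hi] using hg.1 i hi j hj
    · simpa only [old i le_rfl, new] using hH j hj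
  · rcases Nat.le_succ_iff.mp hi with hi | rfl
    · simpa only [old i hi] using hg.2 i hi j hj
    · simpa only [new] using hV j hj

/-- A finite square grid can be extended to the next larger one without changing its points. -/
theorem IsGrid.exists_extend {M : Type*} {H V : M → M → Prop} {n : ℕ} {g : ℕ → ℕ → M}
    (hg : IsGrid H V n n g) (serialH : ∀ x, ∃ y, H x y) (serialV : ∀ x, ∃ y, V x y)
    (confl : ∀ x y, (∃ z, H x z ∧ V z y) ↔ ∃ z, V x z ∧ H z y) :
    ∃ g', IsGrid H V (n + 1) (n + 1) g' ∧ ∀ i ≤ n, ∀ j ≤ n, g' i j = g i j := by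
  obtain ⟨g₁, hg₁, h₁⟩ := hg.exists_extend_right serialH
    fun x z y hxz hzy => (confl x y).mpr ⟨z, hxz, hzy⟩
  obtain ⟨g₂, hg₂, h₂⟩ := hg₁.flip.exists_extend_right serialV
    fun x z y hxz hzy => (confl x y).mp ⟨z, hxz, hzy⟩
  exact ⟨_, hg₂.flip, fun i hi j hj => (h₂ j hj i).trans (h₁ i hi j)⟩

/-- Serial relations that commute confluently admit an infinite grid. -/
theorem exists_infinite_grid {M : Type*} [Nonempty M] {H V : M → M → Prop}
    (serialH : ∀ x, ∃ y, H x y) (serialV : ∀ x, ∃ y, V x y)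
    (confl : ∀ x y, (∃ z, H x z ∧ V z y) ↔ ∃ z, V x z ∧ H z y) :
    ∃ g : ℕ → ℕ → M, ∀ i j, H (g i j) (g (i + 1) j) ∧ V (g i j) (g i (j + 1)) := by
  have step : ∀ (n : ℕ) (g : ℕ → ℕ → M), ∃ g', IsGrid H V n n g →
      IsGrid H V (n + 1) (n + 1) g' ∧ ∀ i ≤ n, ∀ j ≤ n, g' i j = g i j := fun n g => by
    by_cases hg : IsGrid H V n n g
    · obtain ⟨g', hg'⟩ := hg.exists_extend serialH serialV confl
      exact ⟨g', fun _ => hg'⟩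
    · exact ⟨g, fun h => absurd h hg⟩
  choose ext hext using step
  obtain ⟨x⟩ := ‹Nonempty M›
  let G : ℕ → ℕ → ℕ → M := fun n => Nat.rec (fun _ _ => x) ext n
  have hG : ∀ n, IsGrid H V n n (G n) := fun n => by
    induction n with
    | zero => exact ⟨fun i hi => by omega, fun i _ j hj => by omega⟩
    | succ n ih => exact (hext n (G n) ih).1
  have stable : ∀ m n, m ≤ n → ∀ i ≤ m, ∀ j ≤ m, G n i j = G m i j := by
    intro m n hmn i hi j hj
    induction n, hmn using Nat.le_induction with
    | base => rfl
    | succ n hmn ih =>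
      exact ((hext n (G n) (hG n)).2 i (hi.trans hmn) j (hj.trans hmn)).trans ih
  have diag : ∀ n i j, i ≤ n → j ≤ n → G (max i j) i j = G n i j := fun n i j hi hj =>
    (stable _ n (max_le hi hj) i (le_max_left i j) j (le_max_right i j)).symm
  refine ⟨fun i j => G (max i j) i j, fun i j => ?_⟩
  dsimp only
  rw [diag (i + j + 1) i j (by omega) (by omega), diag (i + j + 1) (i + 1) j (by omega) (by omega),
    diag (i + j + 1) i (j + 1) (by omega) (by omega)]
  exact ⟨(hG (i + j + 1)).1 i (by omega) j (by omega),
    (hG (i + j + 1)).2 i (by omega) j (by omega)⟩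

/-- The semantic lemma behind the first-order simulation of the domino problem:
any model of the grid and tiling axioms yields a `T`-tiling of the plane. -/
theorem plane_tiling_of_model (T : Finset Tile) (hT : T.Nonempty)
    (M : Type) (hM : Nonempty M) (H V : M → M → Prop) (p : M → {t : Tile // t ∈ T})
    (serialH : ∀ x : M, ∃ y : M, H x y)
    (serialV : ∀ x : M, ∃ y : M, V x y)
    (confl : ∀ x y : M, (∃ z : M, H x z ∧ V z y) ↔ (∃ z : M, V x z ∧ H z y))
    (matchH : ∀ x y : M, H x y → Tile.right (p x).val = Tile.left (p y).val)
    (matchV : ∀ x y : M, V x y → Tile.up (p x).val = Tile.down (p y).val) :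
    ∃ f : ℕ × ℕ → {t : Tile // t ∈ T}, IsPlaneTiling T f := by
  obtain ⟨g, hg⟩ := exists_infinite_grid serialH serialV confl
  exact ⟨fun q => p (g q.1 q.2), fun i j => ⟨matchH _ _ (hg i j).1, matchV _ _ (hg i j).2⟩⟩
end

section
/- Let T = {t₀, …, tₙ} be a finite nonempty set of tile types, and let L be the first-order language with unary relation symbols P₀, …, Pₙ and two binary relation symbols H and V. Let Γ_T be the L-theory consisting of the sentences: ∀x ∃y H(x,y); ∀x ∃y V(x,y); ∀x ∀y ((∃z (H(x,z) ∧ V(z,y))) ↔ (∃z (V(x,z) ∧ H(z,y)))); ∀x ⋁ᵢ (Pᵢ(x) ∧ ⋀_{j≠i} ¬Pⱼ(x)); ∀x ⋀ᵢ (Pᵢ(x) → ∀y (H(x,y) → ⋁_{right tᵢ = left tⱼ} Pⱼ(y))); and ∀x ⋀ᵢ (Pᵢ(x) → ∀y (V(x,y) → ⋁_{up tᵢ = down tⱼ} Pⱼ(y))). Then Γ_T is satisfiable (has a model with nonempty domain) if and only if there exists a T-tiling of ℕ × ℕ, i.e., a function f : ℕ × ℕ → T such that for all i, j ∈ ℕ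 the right color of f(i,j) equals the left color of f(i+1,j) and the top color of f(i,j) equals the bottom color of f(i,j+1). -/
open FirstOrder FirstOrder.Language

/-- The first-order language with unary relation symbols `P₀, …, Pₙ` and two binary
relation symbols `H` and `V`. -/
def tileLang (n : ℕ) : Language :=
  ⟨fun _ => Empty, fun k =>
    match k with
    | 1 => Fin (n + 1)
    | 2 => Fin 2
    | _ => Empty⟩

/-- The binary relation symbol `H` (`y` is immediately to the right of `x`). -/
def Hrel (n : ℕ) : (tileLang n).Relations 2 := (0 : Fin 2)
/-- The binary relation symbol `V` (`y` is immediately above `x`). -/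
def Vrel (n : ℕ) : (tileLang n).Relations 2 := (1 : Fin 2)
/-- The unary relation symbol `Pᵢ` (`x` carries a tile of type `tᵢ`). -/
def Prel (n : ℕ) (i : Fin (n + 1)) : (tileLang n).Relations 1 := i

/-- Finite disjunction of a list of bounded formulas. -/
def disj {L : Language} {α : Type*} {k : ℕ} (l : List (L.BoundedFormula α k)) :
    L.BoundedFormula α k :=
  l.foldr (· ⊔ ·) ⊥

/-- Finite conjunction of a list of bounded formulas. -/
def conj {L : Language} {α : Type*} {k : ℕ} (l : List (L.BoundedFormula α k)) :
    L.BoundedFormula α k :=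
  l.foldr (· ⊓ ·) ⊤

/-- `∀x ∃y H(x,y)`. -/
def serialH (n : ℕ) : (tileLang n).Sentence :=
  ∀' ∃' (Hrel n).boundedFormula₂ &0 &1

/-- `∀x ∃y V(x,y)`. -/
def serialV (n : ℕ) : (tileLang n).Sentence :=
  ∀' ∃' (Vrel n).boundedFormula₂ &0 &1

/-- `∀x ∀y ((∃z (H(x,z) ∧ V(z,y))) ↔ (∃z (V(x,z) ∧ H(z,y))))`. -/
def gridConfluence (n : ℕ) : (tileLang n).Sentence :=
  ∀' ∀' ((∃' ((Hrel n).boundedFormula₂ &0 &2 ⊓ (Vrel n).boundedFormula₂ &2 &1)) ⇔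
    (∃' ((Vrel n).boundedFormula₂ &0 &2 ⊓ (Hrel n).boundedFormula₂ &2 &1)))

/-- `∀x ⋁ᵢ (Pᵢ(x) ∧ ⋀_{j ≠ i} ¬Pⱼ(x))`: each tile-holder holds a unique tile. -/
def uniqueTile (n : ℕ) : (tileLang n).Sentence :=
  ∀' disj ((List.finRange (n + 1)).map fun i =>
    (Prel n i).boundedFormula₁ &0 ⊓
      conj (((List.finRange (n + 1)).filter fun j => decide (j ≠ i)).map fun j =>
        ∼((Prel n j).boundedFormula₁ &0)))

/-- `∀x ⋀ᵢ (Pᵢ(x) → ∀y (H(x,y) → ⋁_{right tᵢ = left tⱼ} Pⱼ(y)))`. -/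
def matchHoriz (n : ℕ) (t : Fin (n + 1) → Tile) : (tileLang n).Sentence :=
  ∀' conj ((List.finRange (n + 1)).map fun i =>
    (Prel n i).boundedFormula₁ &0 ⟹
      ∀' ((Hrel n).boundedFormula₂ &0 &1 ⟹
        disj (((List.finRange (n + 1)).filter fun j =>
            decide (Tile.right (t i) = Tile.left (t j))).map fun j =>
          (Prel n j).boundedFormula₁ &1)))

/-- `∀x ⋀ᵢ (Pᵢ(x) → ∀y (V(x,y) → ⋁_{up tᵢ = down tⱼ} Pⱼ(y)))`. -/
def matchVert (n : ℕ) (t : Fin (n + 1) → Tile) : (tileLang n).Sentence :=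
  ∀' conj ((List.finRange (n + 1)).map fun i =>
    (Prel n i).boundedFormula₁ &0 ⟹
      ∀' ((Vrel n).boundedFormula₂ &0 &1 ⟹
        disj (((List.finRange (n + 1)).filter fun j =>
            decide (Tile.up (t i) = Tile.down (t j))).map fun j =>
          (Prel n j).boundedFormula₁ &1)))

/-- The theory `Γ_T` describing the grid `ℕ × ℕ` together with a `T`-tiling of it, for
`T = {t₀, …, tₙ}`. -/
def tilingTheory (n : ℕ) (t : Fin (n + 1) → Tile) : (tileLang n).Theory :=
  {serialH n, serialV n, gridConfluence n, uniqueTile n, matchHoriz n t, matchVert n t}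

section Semantics

variable {L : Language} {α : Type*} {k : ℕ} {M : Type*} [L.Structure M]

theorem realize_disj (l : List (L.BoundedFormula α k)) (v : α → M) (xs : Fin k → M) :
    (disj l).Realize v xs ↔ ∃ φ ∈ l, φ.Realize v xs :=
  BoundedFormula.realize_foldr_sup l v xs

theorem realize_conj (l : List (L.BoundedFormula α k)) (v : α → M) (xs : Fin k → M) :
    (conj l).Realize v xs ↔ ∀ φ ∈ l, φ.Realize v xs :=
  BoundedFormula.realize_foldr_inf l v xs

end Semantics

/-- `M` satisfies `Γ_T` iff its relations satisfy the six defining conditions. -/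
theorem model_tilingTheory_iff {n : ℕ} {t : Fin (n + 1) → Tile} {M : Type*}
    [(tileLang n).Structure M] :
    M ⊨ tilingTheory n t ↔
      (∀ x : M, ∃ y : M, Structure.RelMap (Hrel n) ![x, y]) ∧
      (∀ x : M, ∃ y : M, Structure.RelMap (Vrel n) ![x, y]) ∧
      (∀ x y : M,
        (∃ z : M, Structure.RelMap (Hrel n) ![x, z] ∧ Structure.RelMap (Vrel n) ![z, y]) ↔
          ∃ z : M, Structure.RelMap (Vrel n) ![x, z] ∧ Structure.RelMap (Hrel n) ![z, y]) ∧
      (∀ x : M, ∃ i, Structure.RelMap (Prel n i) ![x] ∧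
        ∀ j, j ≠ i → ¬ Structure.RelMap (Prel n j) ![x]) ∧
      (∀ (x : M) (i), Structure.RelMap (Prel n i) ![x] →
        ∀ y : M, Structure.RelMap (Hrel n) ![x, y] →
          ∃ j, Tile.right (t i) = Tile.left (t j) ∧ Structure.RelMap (Prel n j) ![y]) ∧
      (∀ (x : M) (i), Structure.RelMap (Prel n i) ![x] →
        ∀ y : M, Structure.RelMap (Vrel n) ![x, y] →
          ∃ j, Tile.up (t i) = Tile.down (t j) ∧ Structure.RelMap (Prel n j) ![y]) := by
  simp [tilingTheory, Theory.model_iff, serialH, serialV, gridConfluence, uniqueTile, matchHoriz,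
    matchVert, Sentence.Realize, Formula.Realize, realize_disj, realize_conj,
    BoundedFormula.realize_rel₁, BoundedFormula.realize_rel₂, Fin.snoc]

/-- The structure on a type given by a labelling by tile indices and two binary relations. -/
@[reducible]
def tileStructure {n : ℕ} {M : Type*} (c : M → Fin (n + 1)) (h v : M → M → Prop) :
    (tileLang n).Structure M where
  funMap f := f.elim
  RelMap {k} :=
    match k with
    | 1 => fun (i : Fin (n + 1)) x => c (x 0) = i
    | 2 => fun (r : Fin 2) x => if r = 0 then h (x 0) (x 1) else v (x 0) (x 1)
    | 0 => fun r _ => Empty.elim r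
    | _ + 3 => fun r _ => Empty.elim r

section Grid

variable {M : Type*} {H V : M → M → Prop}

/-- A serial relation has an infinite path. -/
theorem exists_path_of_serial [Nonempty M] (hH : ∀ x, ∃ y, H x y) :
    ∃ a : ℕ → M, ∀ i, H (a i) (a (i + 1)) := by
  choose s hs using hH
  exact ⟨fun i => s^[i] (Classical.arbitrary M), fun i => by
    simpa only [Function.iterate_succ_apply'] using hs _⟩

/-- A row of finite length can be copied one level up, working from right to left. -/
theorem exists_row_above (hV : ∀ x, ∃ y, V x y)
    (hHV : ∀ x y z, H x z → V z y → ∃ w, V x w ∧ H w y) (m : ℕ) (a : ℕ → M)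
    (ha : ∀ i < m, H (a i) (a (i + 1))) :
    ∃ b : ℕ → M, (∀ i < m, H (b i) (b (i + 1))) ∧ ∀ i ≤ m, V (a i) (b i) := by
  induction m generalizing a with
  | zero =>
    obtain ⟨y, hy⟩ := hV (a 0)
    exact ⟨fun _ => y, by simp, by simpa using hy⟩
  | succ m ih =>
    obtain ⟨b, hb, hab⟩ := ih (fun i => a (i + 1)) fun i hi => ha (i + 1) (by omega)
    obtain ⟨w, hw, hwb⟩ := hHV _ _ _ (ha 0 (by omega)) (hab 0 (by omega))
    refine ⟨fun i => Nat.casesOn i w b, fun i hi => ?_, fun i hi => ?_⟩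
    · cases i with
      | zero => exact hwb
      | succ i => exact hb i (by omega)
    · cases i with
      | zero => exact hw
      | succ i => exact hab i (by omega)

/-- Serial relations `H`, `V` with `H ∘ V ⊆ V ∘ H` admit grids of any finite width. -/
theorem exists_grid_of_width [Nonempty M] (hH : ∀ x, ∃ y, H x y) (hV : ∀ x, ∃ y, V x y)
    (hHV : ∀ x y z, H x z → V z y → ∃ w, V x w ∧ H w y) (m : ℕ) :
    ∃ g : ℕ → ℕ → M, ∀ i < m, ∀ j,
      H (g i j) (g (i + 1) j) ∧ V (g i j) (g i (j + 1)) := by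
  obtain ⟨a, ha⟩ := exists_path_of_serial hH
  let Row := {r : ℕ → M // ∀ i < m, H (r i) (r (i + 1))}
  have : Nonempty Row := ⟨⟨a, fun i _ => ha i⟩⟩
  obtain ⟨r, hr⟩ := exists_path_of_serial (M := Row)
    (H := fun r s => ∀ i ≤ m, V (r.1 i) (s.1 i)) fun r =>
      let ⟨b, hb, hab⟩ := exists_row_above hV hHV m r.1 r.2
      ⟨⟨b, hb⟩, hab⟩
  exact ⟨fun i j => (r j).1 i, fun i hi j => ⟨(r j).2 i hi, hr j i hi.le⟩⟩

end Grid

/-- Compactness: labellings by a finite type satisfying horizontal and vertical constraints on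
strips of every width yield such a labelling of the whole quadrant. -/
theorem exists_labelling_of_forall_width {ι : Type*} [Finite ι] {R U : ι → ι → Prop}
    (h : ∀ m : ℕ, ∃ c : ℕ → ℕ → ι, ∀ i < m, ∀ j,
      R (c i j) (c (i + 1) j) ∧ U (c i j) (c i (j + 1))) :
    ∃ c : ℕ → ℕ → ι, ∀ i j, R (c i j) (c (i + 1) j) ∧ U (c i j) (c i (j + 1)) := by
  choose c hc using h
  have hlim : ∀ i j, ∃ k, ∀ᶠ m in (Filter.hyperfilter ℕ : Filter ℕ), c m i j = k := fun i j =>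
    Ultrafilter.eventually_exists_iff.1 (.of_forall fun m => ⟨c m i j, rfl⟩)
  choose d hd using hlim
  refine ⟨d, fun i j => ?_⟩
  have hgt : ∀ᶠ m in (Filter.hyperfilter ℕ : Filter ℕ), i < m :=
    Nat.hyperfilter_le_atTop (Filter.eventually_gt_atTop i)
  obtain ⟨m, him, h₀, h₁, h₂⟩ :=
    (hgt.and ((hd i j).and ((hd (i + 1) j).and (hd i (j + 1))))).exists
  rw [← h₀, ← h₁, ← h₂]
  exact hc m i him j

/-- The theory `Γ_T` is satisfiable (in a nonempty domain) iff there is a `T`-tiling of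
`ℕ × ℕ`, i.e. a map assigning to each position a tile from `T = {t₀, …, tₙ}` so that
horizontally and vertically adjacent tiles match. -/
theorem tilingTheory_satisfiable_iff_plane_tiling (n : ℕ) (t : Fin (n + 1) → Tile) :
    (tilingTheory n t).IsSatisfiable ↔
      ∃ f : ℕ × ℕ → {x : Tile // x ∈ Set.range t}, ∀ i j : ℕ,
        Tile.right (f (i, j)).val = Tile.left (f (i + 1, j)).val ∧
        Tile.up (f (i, j)).val = Tile.down (f (i, j + 1)).val := by
  constructor
  · rintro ⟨M⟩
    obtain ⟨hH, hV, hHV, hP, hmH, hmV⟩ := model_tilingTheory_iff.1 M.is_model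
    choose p hp hpu using hP
    have huniq : ∀ (x : M) (j), Structure.RelMap (Prel n j) ![x] → j = p x := fun x j hj =>
      not_not.1 fun hne => hpu x j hne hj
    obtain ⟨c, hc⟩ := exists_labelling_of_forall_width
      (R := fun i j => Tile.right (t i) = Tile.left (t j))
      (U := fun i j => Tile.up (t i) = Tile.down (t j)) fun m => by
        obtain ⟨g, hg⟩ := exists_grid_of_width hH hV
          (fun x y z hxz hzy => (hHV x y).1 ⟨z, hxz, hzy⟩) m
        refine ⟨fun i j => p (g i j), fun i hi j => ⟨?_, ?_⟩⟩
        · obtain ⟨k, hk, hPk⟩ := hmH _ _ (hp _) _ (hg i hi j).1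
          rwa [huniq _ _ hPk] at hk
        · obtain ⟨k, hk, hPk⟩ := hmV _ _ (hp _) _ (hg i hi j).2
          rwa [huniq _ _ hPk] at hk
    exact ⟨fun q => ⟨t (c q.1 q.2), Set.mem_range_self _⟩, hc⟩
  · rintro ⟨f, hf⟩
    choose c hc using fun q => (f q).2
    simp only [← hc] at hf
    let _ : (tileLang n).Structure (ℕ × ℕ) :=
      tileStructure c (fun x y => y = (x.1 + 1, x.2)) (fun x y => y = (x.1, x.2 + 1))
    have hP : ∀ i x, Structure.RelMap (Prel n i) ![x] ↔ c x = i := fun _ _ => Iff.rfl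
    have hH : ∀ x y : ℕ × ℕ, Structure.RelMap (Hrel n) ![x, y] ↔ y = (x.1 + 1, x.2) :=
      fun _ _ => Iff.rfl
    have hV : ∀ x y : ℕ × ℕ, Structure.RelMap (Vrel n) ![x, y] ↔ y = (x.1, x.2 + 1) :=
      fun _ _ => Iff.rfl
    have : (ℕ × ℕ) ⊨ tilingTheory n t := by
      rw [model_tilingTheory_iff]
      simp only [hP, hH, hV]
      refine ⟨fun x => ⟨_, rfl⟩, fun x => ⟨_, rfl⟩, fun x y => by simp,
        fun x => ⟨c x, rfl, fun j hj h => hj h.symm⟩, ?_, ?_⟩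
      · rintro x _ rfl _ rfl
        exact ⟨_, (hf x.1 x.2).1, rfl⟩
      · rintro x _ rfl _ rfl
        exact ⟨_, (hf x.1 x.2).2, rfl⟩
    exact Theory.Model.isSatisfiable (ℕ × ℕ)
end

section
/- The domino problem is undecidable: the predicate on finite sets of tile types T (encoded as finite sets of quadruples of natural numbers) given by "there exists a T-tiling of ℕ × ℕ, i.e., a function f : ℕ × ℕ → T such that for all i, j ∈ ℕ the right color of f(i,j) equals the left color of f(i+1,j) and the top color of f(i,j) equals the bottom color of f(i,j+1)" is not a computable predicate. -/
/-- The wire label advances by one along its line and keeps its transversal coordinate. -/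
def StepWire (l r : ℕ × ℕ) : Prop := r.1 = (l.1 + 1) % 9 ∧ r.2 = l.2

/-- The cell at the crossing of two lines of the same level. -/
def CrossEqual (l r d u : ℕ × ℕ) : Prop :=
  StepWire l r ∧ StepWire d u ∧ u = (r.2, r.1) ∧ r.1 % 3 ≠ 0 ∧ r.2 % 3 ≠ 0

/-- The cell at the crossing of a line (labels `l`, `r`) with a line of higher level
(labels `d`, `u`). -/
def CrossHigher (l r d u : ℕ × ℕ) : Prop :=
  StepWire l r ∧ r.1 % 3 = 0 ∧ r.2 % 3 ≠ 0 ∧ d = u ∧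
    (r.1 / 3 ≠ 0 → u.1 % 3 = r.2 / 3 ∧ u.2 % 3 = r.1 / 3)

/-- The local constraint on the wire labels around a cell. -/
def WireRule (l r d u : ℕ × ℕ) : Prop :=
  CrossEqual l r d u ∨ CrossHigher l r d u ∨ CrossHigher d u l r

/-- The wire labels `R i j` (right edge of the cell `(i, j)`) and `U j i` (top edge of the cell
`(i, j)`) satisfy the local constraint at all cells with positive coordinates. -/
def Wired (R U : ℕ → ℕ → ℕ × ℕ) : Prop :=
  ∀ i j, WireRule (R i (j + 1)) (R (i + 1) (j + 1)) (U j (i + 1)) (U (j + 1) (i + 1))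

/-- The lines of level zero carry their coordinates modulo `3`. -/
def BaseAligned (R : ℕ → ℕ → ℕ × ℕ) : Prop :=
  ∀ i j, j % 3 ≠ 0 → (R i j).1 % 3 = i % 3 ∧ (R i j).2 % 3 = j % 3

/-- The lines of level zero carry their coordinates modulo `9`. -/
def BaseExact (R : ℕ → ℕ → ℕ × ℕ) : Prop :=
  ∀ i j, j % 3 ≠ 0 → R i j = (i % 9, j % 9)

theorem CrossEqual.symm {l r d u : ℕ × ℕ} (h : CrossEqual l r d u) : CrossEqual d u l r := by
  obtain ⟨h1, h2, h3, h4, h5⟩ := h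
  refine ⟨h2, h1, ?_, ?_, ?_⟩ <;> simp [h3, h4, h5]

theorem WireRule.symm {l r d u : ℕ × ℕ} (h : WireRule l r d u) : WireRule d u l r := by
  rcases h with h | h | h
  · exact Or.inl h.symm
  · exact Or.inr (Or.inr h)
  · exact Or.inr (Or.inl h)

theorem Wired.symm {R U : ℕ → ℕ → ℕ × ℕ} (h : Wired R U) : Wired U R :=
  fun i j => (h j i).symm

theorem Wired.shift {R U : ℕ → ℕ → ℕ × ℕ} (h : Wired R U) (s t : ℕ) :
    Wired (fun i j => R (i + s) (j + t)) (fun j i => U (j + t) (i + s)) := by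
  intro i j
  have := h (i + s) (j + t)
  simpa only [add_right_comm] using this

theorem Wired.step {R U : ℕ → ℕ → ℕ × ℕ} (h : Wired R U) (hR : BaseAligned R) (i j : ℕ)
    (hj : j % 3 ≠ 0) : StepWire (R i j) (R (i + 1) j) := by
  obtain ⟨j, rfl⟩ : ∃ k, j = k + 1 := ⟨j - 1, by omega⟩
  rcases h i j with h | h | h
  · exact h.1
  · exact h.1
  · have h1 := hR i _ hj
    have h2 := hR (i + 1) _ hj
    rw [h.2.2.2.1] at h1
    omega

theorem Wired.row {R U : ℕ → ℕ → ℕ × ℕ} (h : Wired R U) (hR : BaseAligned R) (i j : ℕ)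
    (hj : j % 3 ≠ 0) : R (i + 1) j = (((R 0 j).1 + (i + 1)) % 9, (R 0 j).2) := by
  induction i with
  | zero =>
    have := h.step hR 0 j hj
    exact Prod.ext this.1 this.2
  | succ i ih =>
    have := h.step hR (i + 1) j hj
    rw [ih] at this
    refine Prod.ext ?_ this.2
    rw [this.1]
    simp only
    omega

theorem Wired.swap {R U : ℕ → ℕ → ℕ × ℕ} (h : Wired R U) (hR : BaseAligned R)
    (hU : BaseAligned U) (i j : ℕ) (hi : (i + 1) % 3 ≠ 0) (hj : (j + 1) % 3 ≠ 0) :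
    U (j + 1) (i + 1) = ((R (i + 1) (j + 1)).2, (R (i + 1) (j + 1)).1) := by
  have h1 := hR (i + 1) _ hj
  have h2 := hU (j + 1) _ hi
  rcases h i j with h | h | h
  · exact h.2.2.1
  · have := h.2.1
    omega
  · have := h.2.1
    omega

theorem Wired.coords {R U : ℕ → ℕ → ℕ × ℕ} (h : Wired R U) (hR : BaseAligned R)
    (hU : BaseAligned U) (i j : ℕ) (hj : j % 3 ≠ 0) :
    R (i + 1) j = (((R 0 1).1 + (i + 1)) % 9, ((U 0 1).1 + j) % 9) := by
  obtain ⟨j, rfl⟩ : ∃ k, j = k + 1 := ⟨j - 1, by omega⟩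
  have e1 := h.row hR i _ hj
  have e2 := h.row hR 0 _ hj
  have e3 := h.symm.row hU j 1 (by omega)
  have e4 := h.swap hR hU 0 j (by omega) hj
  have e5 := h.swap hR hU 0 0 (by omega) (by omega)
  have e6 := h.row hR 0 1 (by omega)
  have e7 := h.symm.row hU 0 1 (by omega)
  have b1 := hR 0 _ hj
  have b2 := hR 0 1 (by omega)
  simp only [zero_add] at *
  rw [e6, e7] at e5
  rw [e3, e2] at e4
  rw [e1]
  simp only [Prod.mk.injEq] at e4 e5 ⊢
  omega

theorem Wired.exists_shift {R U : ℕ → ℕ → ℕ × ℕ} (h : Wired R U) (hR : BaseAligned R)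
    (hU : BaseAligned U) : ∃ s t, BaseExact (fun i j => R (i + s) (j + t)) ∧
      BaseExact (fun j i => U (j + t) (i + s)) := by
  have a1 := (hR 0 1 (by omega)).1
  have a2 := (hU 0 1 (by omega)).1
  refine ⟨9 - (R 0 1).1 % 9, 9 - (U 0 1).1 % 9, fun i j hj => ?_, fun j i hi => ?_⟩
  · obtain ⟨k, hk⟩ : ∃ k, i + (9 - (R 0 1).1 % 9) = k + 1 :=
      ⟨i + (9 - (R 0 1).1 % 9) - 1, by omega⟩
    beta_reduce
    rw [hk, h.coords hR hU _ _ (by omega), Prod.mk.injEq]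
    omega
  · obtain ⟨k, hk⟩ : ∃ k, j + (9 - (U 0 1).1 % 9) = k + 1 :=
      ⟨j + (9 - (U 0 1).1 % 9) - 1, by omega⟩
    beta_reduce
    rw [hk, h.symm.coords hU hR _ _ (by omega), Prod.mk.injEq]
    omega

theorem Wired.crossHigher {R U : ℕ → ℕ → ℕ × ℕ} (h : Wired R U) (hU : BaseExact U) (i j : ℕ)
    (hi : (i + 1) % 3 ≠ 0) (hj : (j + 1) % 3 = 0) :
    CrossHigher (U j (i + 1)) (U (j + 1) (i + 1)) (R i (j + 1)) (R (i + 1) (j + 1)) := by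
  have h1 := hU j _ hi
  have h2 := hU (j + 1) _ hi
  rcases h i j with h | h | h
  · have := h.2.2
    rw [h2] at this
    simp only [Prod.mk.injEq] at this
    omega
  · have := h.2.2.2.1
    rw [h1, h2, Prod.mk.injEq] at this
    omega
  · exact h

theorem Wired.pass {R U : ℕ → ℕ → ℕ × ℕ} (h : Wired R U) (hU : BaseExact U) (i j : ℕ)
    (hj : j ≠ 0) : R i (3 * j) = R (3 * (i / 3)) (3 * j) := by
  obtain ⟨j, rfl⟩ : ∃ k, j = k + 1 := ⟨j - 1, by omega⟩
  have key (i : ℕ) (hi : (i + 1) % 3 ≠ 0) : R i (3 * (j + 1)) = R (i + 1) (3 * (j + 1)) :=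
    (h.crossHigher hU i (3 * j + 2) hi (by omega)).2.2.2.1
  have h3 : i = 3 * (i / 3) ∨ i = 3 * (i / 3) + 1 ∨ i = 3 * (i / 3) + 2 := by omega
  have k1 := key (3 * (i / 3)) (by omega)
  have k2 := key (3 * (i / 3) + 1) (by omega)
  rcases h3 with h3 | h3 | h3
  · exact congrArg₂ R h3 rfl
  · exact (congrArg₂ R h3 rfl).trans k1.symm
  · exact (congrArg₂ R h3 rfl).trans (k1.trans k2).symm

theorem Wired.derived {R U : ℕ → ℕ → ℕ × ℕ} (h : Wired R U) (hR : BaseExact R)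
    (hU : BaseExact U) :
    Wired (fun i j => R (3 * i) (3 * j)) (fun j i => U (3 * j) (3 * i)) := by
  intro i j
  have := h (3 * i + 2) (3 * j + 2)
  have e1 := h.pass hU (3 * i + 2) (j + 1) (by omega)
  have e2 := h.symm.pass hR (3 * j + 2) (i + 1) (by omega)
  have e3 : (3 * i + 2) / 3 = i := by omega
  have e4 : (3 * j + 2) / 3 = j := by omega
  rw [e3] at e1
  rw [e4] at e2
  simp only [mul_add, mul_one] at e1 e2 ⊢
  rwa [← e1, ← e2]

theorem Wired.derived_aligned {R U : ℕ → ℕ → ℕ × ℕ} (h : Wired R U) (hU : BaseExact U) :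
    BaseAligned (fun i j => R (3 * i) (3 * j)) := by
  intro i j hj
  obtain ⟨j, rfl⟩ : ∃ k, j = k + 1 := ⟨j - 1, by omega⟩
  obtain ⟨-, -, -, h1, h2⟩ := h.crossHigher hU (3 * i) (3 * j + 2) (by omega) (by omega)
  rw [← h1, hU _ _ (by omega)] at h2
  have h3 := h2 (by simp only; omega)
  have e : 3 * j + 2 + 1 = 3 * (j + 1) := by ring
  rw [e] at h3
  simp only at h3 ⊢
  omega

/-- The lines of level `k < K` carry, modulo `3`, their coordinates at that level. -/
def AlignedBelow (K : ℕ) (R : ℕ → ℕ → ℕ × ℕ) : Prop :=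
  ∀ k < K, ∀ i j, 3 ^ k ∣ j → ¬ 3 ^ (k + 1) ∣ j →
    (R i j).1 % 3 = i / 3 ^ k % 3 ∧ (R i j).2 % 3 = j / 3 ^ k % 3

theorem alignedBelow_of_derived {K s t : ℕ} {R U : ℕ → ℕ → ℕ × ℕ} (h : Wired R U)
    (hR : BaseExact R) (hU : BaseExact U)
    (hK : AlignedBelow K (fun i j => R (3 * (i + s)) (3 * (j + t)))) :
    AlignedBelow (K + 1) (fun i j => R (i + 3 * s) (j + 3 * t)) := by
  intro k hk i j h1 h2
  rcases k with _ | k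
  · simp only [pow_zero, zero_add, pow_one, Nat.dvd_iff_mod_eq_zero, Nat.div_one] at h2 ⊢
    rw [hR _ _ (by omega)]
    simp only
    omega
  · obtain ⟨j, rfl⟩ : 3 ∣ j := dvd_trans (dvd_pow_self 3 (by omega)) h1
    have hj : j ≠ 0 := by rintro rfl; simp at h2
    rw [pow_succ', Nat.mul_dvd_mul_iff_left (by norm_num)] at h1 h2
    have := hK k (by omega) (i / 3) j h1 h2
    rw [pow_succ', ← Nat.div_div_eq_div_mul, ← Nat.div_div_eq_div_mul,
      Nat.mul_div_cancel_left _ (by norm_num)]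
    beta_reduce
    rw [← mul_add, h.pass hU _ _ (by omega), Nat.add_mul_div_left _ _ (by norm_num)]
    exact this

theorem Wired.exists_alignedBelow (K : ℕ) : ∀ {R U : ℕ → ℕ → ℕ × ℕ}, Wired R U →
    BaseAligned R → BaseAligned U → ∃ s t, AlignedBelow K (fun i j => R (i + s) (j + t)) ∧
      AlignedBelow K (fun j i => U (j + t) (i + s)) := by
  induction K with
  | zero => exact fun _ _ _ => ⟨0, 0, fun k hk => absurd hk k.not_lt_zero,
      fun k hk => absurd hk k.not_lt_zero⟩
  | succ K ih =>
    intro R U h hR hU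
    obtain ⟨s, t, hR1, hU1⟩ := h.exists_shift hR hU
    have h1 := h.shift s t
    obtain ⟨s', t', hR2, hU2⟩ := ih (h1.derived hR1 hU1) (h1.derived_aligned hU1)
      (h1.symm.derived_aligned hR1)
    refine ⟨3 * s' + s, 3 * t' + t, ?_, ?_⟩
    · simpa only [add_assoc] using alignedBelow_of_derived h1 hR1 hU1 hR2
    · simpa only [add_assoc] using alignedBelow_of_derived h1.symm hU1 hR1 hU2

/-- The `k`-th ternary digit. -/
def digit (k i : ℕ) : ℕ := i / 3 ^ k % 3

theorem pow_succ_dvd_iff_digit {k n : ℕ} (h : 3 ^ k ∣ n) : 3 ^ (k + 1) ∣ n ↔ digit k n = 0 := by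
  obtain ⟨m, rfl⟩ := h
  rw [digit, Nat.mul_div_cancel_left _ (by positivity), pow_succ,
    Nat.mul_dvd_mul_iff_left (by positivity), Nat.dvd_iff_mod_eq_zero]

theorem exists_level {n : ℕ} (hn : n ≠ 0) : ∃ k, 3 ^ k ∣ n ∧ ¬ 3 ^ (k + 1) ∣ n := by
  obtain ⟨k, m, hm, rfl⟩ := Nat.exists_eq_pow_mul_and_not_dvd hn 3 (by norm_num)
  refine ⟨k, dvd_mul_right _ _, ?_⟩
  rwa [pow_succ, Nat.mul_dvd_mul_iff_left (by positivity)]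

theorem succ_div_pow_of_dvd {κ i : ℕ} (h : 3 ^ κ ∣ i + 1) :
    (i + 1) / 3 ^ κ = i / 3 ^ κ + 1 := by
  rw [Nat.succ_div, if_pos h]

theorem succ_div_pow_of_not_dvd {κ i : ℕ} (h : ¬ 3 ^ κ ∣ i + 1) :
    (i + 1) / 3 ^ κ = i / 3 ^ κ := by
  rw [Nat.succ_div, if_neg h, add_zero]

theorem digit_succ_of_not_dvd {κ i : ℕ} (h : ¬ 3 ^ κ ∣ i + 1) : digit κ (i + 1) = digit κ i := by
  rw [digit, succ_div_pow_of_not_dvd h, digit]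

theorem digit_succ_of_dvd {κ i : ℕ} (h : 3 ^ κ ∣ i + 1) :
    digit κ (i + 1) = (digit κ i + 1) % 3 := by
  rw [digit, succ_div_pow_of_dvd h, digit]
  omega

/-- The local constraint on the states `l`, `r` of a line when it crosses a line whose wire label
is `u`: a square `[3 ^ k, 2 * 3 ^ k)` is entered (state `1`) at its opening wall and left
(state `2`) at its closing wall. -/
def StateRule (l r : ℕ) (u : ℕ × ℕ) : Prop :=
  (u.1 % 3 = 1 ∧ u.2 % 3 = 1 → l = 0 ∧ r = 1 ∨ l = 2 ∧ r = 0) ∧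
  (u.1 % 3 = 1 ∧ u.2 % 3 = 2 → l = 1 ∧ r = 2 ∨ l = 2 ∧ r = 0) ∧
  (¬ (u.1 % 3 = 1 ∧ u.2 % 3 ≠ 0) → r = l ∨ l = 2 ∧ r = 0)

/-- `κ` is the position of the lowest ternary digit `1` of `j`. -/
def IsRank (κ j : ℕ) : Prop := digit κ j = 1 ∧ ∀ k < κ, digit k j ≠ 1

theorem IsRank.unique {κ κ' j : ℕ} (h : IsRank κ j) (h' : IsRank κ' j) : κ = κ' := by
  rcases lt_trichotomy κ κ' with hl | hl | hl
  · exact absurd h.1 (h'.2 κ hl)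
  · exact hl
  · exact absurd h'.1 (h.2 κ' hl)

theorem state_eq_one_iff {K κ j : ℕ} {U : ℕ → ℕ → ℕ × ℕ} {S : ℕ → ℕ} (hU : AlignedBelow K U)
    (hκ : κ < K) (hj : IsRank κ j) (hS : ∀ i, StateRule (S i) (S (i + 1)) (U j (i + 1))) (i : ℕ) :
    S i = 1 ↔ digit κ i = 1 := by
  have inner (i : ℕ) (hi : ¬ 3 ^ κ ∣ i + 1) : S (i + 1) = S i ∨ S i = 2 ∧ S (i + 1) = 0 := by
    obtain ⟨k, h1, h2⟩ := exists_level i.succ_ne_zero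
    have hk : k < κ := by
      by_contra hk
      exact hi ((pow_dvd_pow 3 (not_lt.1 hk)).trans h1)
    refine (hS i).2.2 fun h => hj.2 k hk ?_
    rw [digit, ← (hU k (hk.trans hκ) j (i + 1) h1 h2).1]
    exact h.1
  have wall (i : ℕ) (hi : 3 ^ κ ∣ i + 1) (h0 : digit κ (i + 1) ≠ 0) :
      (U j (i + 1)).1 % 3 = 1 ∧ (U j (i + 1)).2 % 3 = digit κ (i + 1) := by
    rw [Ne, ← pow_succ_dvd_iff_digit hi] at h0
    have := hU κ hκ j (i + 1) hi h0
    exact ⟨this.1.trans hj.1, this.2⟩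
  have block (q e : ℕ) (he : e < 3 ^ κ) : (S (3 ^ κ * q + e) = 1 ↔ S (3 ^ κ * q) = 1) ∧
      (S (3 ^ κ * q) = 0 → S (3 ^ κ * q + e) = 0) := by
    induction e with
    | zero => simp
    | succ e ih =>
      have ih := ih (by omega)
      have := inner (3 ^ κ * q + e) fun h => by
        rw [add_assoc, Nat.dvd_add_right (dvd_mul_right _ _)] at h
        exact absurd (Nat.le_of_dvd (by omega) h) (by omega)
      rw [← add_assoc]
      omega
  have border (q : ℕ) : ∃ n, n + 1 = 3 ^ κ * (q + 1) ∧ n = 3 ^ κ * q + (3 ^ κ - 1) ∧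
      digit κ (n + 1) = (q + 1) % 3 := by
    have h0 : 0 < 3 ^ κ := by positivity
    have h1 : 3 ^ κ * q + (3 ^ κ - 1) + 1 = 3 ^ κ * (q + 1) := by
      rw [mul_add]
      omega
    exact ⟨_, h1, rfl, by rw [h1, digit, Nat.mul_div_cancel_left _ h0]⟩
  have h0 : 0 < 3 ^ κ := by positivity
  obtain ⟨q, e, he, rfl⟩ : ∃ q e, e < 3 ^ κ ∧ i = 3 ^ κ * q + e :=
    ⟨i / 3 ^ κ, i % 3 ^ κ, Nat.mod_lt _ h0, (Nat.div_add_mod _ _).symm⟩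
  rw [(block q e he).1, digit, Nat.mul_add_div h0, Nat.div_eq_of_lt he, add_zero]
  have hq : q % 3 = 0 ∨ q % 3 = 1 ∨ q % 3 = 2 := by omega
  obtain ⟨n, h1, h2, h3⟩ := border q
  have hb := block q (3 ^ κ - 1) (by omega)
  rw [← h2] at hb
  have hw := wall n (h1 ▸ dvd_mul_right _ _)
  have hs := hS n
  rcases hq with hq | hq | hq
  · have := hs.1 (by have := hw (by omega); omega)
    omega
  · have hs := hs.2.1 (by have := hw (by omega); omega)
    obtain ⟨q, rfl⟩ : ∃ p, q = p + 1 := ⟨q - 1, by omega⟩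
    obtain ⟨n', h1', h2', h3'⟩ := border q
    have hw' := wall n' (h1' ▸ dvd_mul_right _ _)
    have := (hS n').1 (by have := hw' (by omega); omega)
    rw [h1'] at this
    omega
  · obtain ⟨q, rfl⟩ : ∃ p, q = p + 1 := ⟨q - 1, by omega⟩
    obtain ⟨n', h1', h2', h3'⟩ := border q
    have hw' := wall n' (h1' ▸ dvd_mul_right _ _)
    have := (hS n').2.1 (by have := hw' (by omega); omega)
    rw [h1'] at this
    omega

/-- A line at coordinate `i` crosses the square of level `κ` without meeting smaller squares. -/
def Free (κ i : ℕ) : Prop := ¬ 3 ^ κ ∣ i ∧ ∀ k < κ, digit k i ≠ 1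

theorem exists_isRank {k j : ℕ} (h : digit k j = 1) : ∃ κ ≤ k, IsRank κ j := by
  classical
  have h' : ∃ k, digit k j = 1 := ⟨k, h⟩
  exact ⟨Nat.find h', Nat.find_min' h' h, Nat.find_spec h', fun _ hk => Nat.find_min h' hk⟩

theorem digit_eq_one_of_mem {N i : ℕ} (h1 : 3 ^ N ≤ i) (h2 : i < 2 * 3 ^ N) : digit N i = 1 := by
  have : i / 3 ^ N = 1 := Nat.div_eq_of_lt_le (by omega) (by omega)
  rw [digit, this]

theorem not_dvd_of_mem {N i : ℕ} (h1 : 3 ^ N < i) (h2 : i < 2 * 3 ^ N) : ¬ 3 ^ N ∣ i := by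
  rintro ⟨c, rfl⟩
  have h0 : 0 < 3 ^ N := by positivity
  have h3 : 1 < c := by
    by_contra h
    have : c = 0 ∨ c = 1 := by omega
    rcases this with rfl | rfl <;> omega
  nlinarith

theorem free_pow_add {N k : ℕ} (hk : k < N) : Free N (3 ^ N + 2 * 3 ^ k) := by
  obtain ⟨n, rfl⟩ := Nat.exists_eq_add_of_lt hk
  constructor
  · have h1 : 3 ^ (k + n + 1) = 3 * 3 ^ k * 3 ^ n := by ring
    have h2 : 0 < 3 ^ k := by positivity
    have h3 : 0 < 3 ^ n := by positivity
    have h4 : 3 ^ k ≤ 3 ^ k * 3 ^ n := Nat.le_mul_of_pos_right _ h3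
    exact not_dvd_of_mem (by omega) (by nlinarith)
  · intro k' hk'
    rcases le_or_gt k' k with h | h
    · obtain ⟨d, rfl⟩ := Nat.exists_eq_add_of_le h
      have h1 : 3 ^ (k' + d + n + 1) + 2 * 3 ^ (k' + d) =
          3 ^ k' * (3 * 3 ^ (d + n) + 2 * 3 ^ d) := by ring
      rw [digit, h1, Nat.mul_div_cancel_left _ (by positivity)]
      rcases d with _ | d
      · simp only [pow_zero]
        omega
      · rw [pow_succ]
        omega
    · obtain ⟨d, rfl⟩ := Nat.exists_eq_add_of_lt h
      obtain ⟨d', rfl⟩ : ∃ d', n = d + d' + 1 := ⟨n - d - 1, by omega⟩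
      have h1 : 3 ^ (k + (d + d' + 1) + 1) + 2 * 3 ^ k =
          3 ^ (k + d + 1) * (3 * 3 ^ d') + 2 * 3 ^ k := by ring
      have h2 : 2 * 3 ^ k < 3 ^ (k + d + 1) := by
        have h1 : 3 ^ (k + d + 1) = 3 * 3 ^ k * 3 ^ d := by ring
        have h2 : 0 < 3 ^ k := by positivity
        have h3 : 0 < 3 ^ d := by positivity
        have h4 : 3 ^ k ≤ 3 ^ k * 3 ^ d := Nat.le_mul_of_pos_right _ h3
        nlinarith
      rw [digit, h1, Nat.mul_add_div (by positivity), Nat.div_eq_of_lt h2]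
      omega

/-- Enumeration of the first `n` elements of a set of naturals in an open interval. -/
theorem exists_enumeration {F : ℕ → Prop} [DecidablePred F] {b : ℕ} (n : ℕ) :
    ∀ a, n ≤ ((Finset.Ioo a b).filter F).card → ∃ e : ℕ → ℕ, e 0 = a ∧ ∀ x < n,
      e x < e (x + 1) ∧ e (x + 1) < b ∧ F (e (x + 1)) ∧
        ∀ i, e x < i → i < e (x + 1) → ¬ F i := by
  induction n with
  | zero => exact fun a _ => ⟨fun _ => a, rfl, fun x hx => absurd hx x.not_lt_zero⟩
  | succ n ih =>
    intro a hn
    obtain ⟨c', hc'⟩ := Finset.card_pos.1 (lt_of_lt_of_le n.succ_pos hn)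
    rw [Finset.mem_filter, Finset.mem_Ioo] at hc'
    have hex : ∃ c, a < c ∧ F c := ⟨c', hc'.1.1, hc'.2⟩
    obtain ⟨hc1, hc2⟩ := Nat.find_spec hex
    have hmin := fun i => Nat.find_min (H := hex) (m := i)
    have hle : Nat.find hex ≤ c' := Nat.find_min' hex ⟨hc'.1.1, hc'.2⟩
    set c := Nat.find hex
    have hsub : (Finset.Ioo a b).filter F ⊆ insert c ((Finset.Ioo c b).filter F) := by
      intro i hi
      simp only [Finset.mem_filter, Finset.mem_Ioo, Finset.mem_insert] at hi ⊢
      rcases lt_trichotomy i c with h | h | h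
      · exact absurd ⟨hi.1.1, hi.2⟩ (hmin i h)
      · exact Or.inl h
      · exact Or.inr ⟨⟨h, hi.1.2⟩, hi.2⟩
    have hcard := (Finset.card_le_card hsub).trans (Finset.card_insert_le _ _)
    obtain ⟨e, he0, he⟩ := ih c (by omega)
    refine ⟨fun x => x.casesOn a e, rfl, fun x hx => ?_⟩
    rcases x with _ | x
    · simp only [he0]
      exact ⟨hc1, by omega, hc2, fun i h1 h2 h3 => hmin i h2 ⟨h1, h3⟩⟩
    · exact he x (by omega)

theorem exists_free_enumeration (N : ℕ) : ∃ e : ℕ → ℕ, e 0 = 3 ^ N ∧ ∀ x < N,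
    e x < e (x + 1) ∧ e (x + 1) < 2 * 3 ^ N ∧ Free N (e (x + 1)) ∧
      ∀ i, e x < i → i < e (x + 1) → ¬ Free N i := by
  classical
  refine exists_enumeration N (3 ^ N) ?_
  have hinj : Function.Injective (fun k : ℕ => 3 ^ N + 2 * 3 ^ k) := fun a b h => by
    have : 3 ^ a = 3 ^ b := by simp only at h; omega
    exact Nat.pow_right_injective (le_refl _ |>.trans (by norm_num)) this
  have hsub : (Finset.range N).image (fun k => 3 ^ N + 2 * 3 ^ k) ⊆
      (Finset.Ioo (3 ^ N) (2 * 3 ^ N)).filter (Free N) := by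
    intro i hi
    simp only [Finset.mem_image, Finset.mem_range] at hi
    obtain ⟨k, hk, rfl⟩ := hi
    have h1 : 0 < 3 ^ k := by positivity
    have h2 : 3 ^ (k + 1) ≤ 3 ^ N := Nat.pow_le_pow_right (by norm_num) hk
    rw [pow_succ] at h2
    simp only [Finset.mem_filter, Finset.mem_Ioo]
    exact ⟨⟨by omega, by omega⟩, free_pow_add hk⟩
  have := Finset.card_le_card hsub
  rwa [Finset.card_image_of_injective _ hinj, Finset.card_range] at this

/-- The local constraint on payloads: tiles of `P` where two active lines cross; elsewhere the
payload of an active line is transmitted, and that of an inactive one is erased. -/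
def PayloadRule (P : List Tile) (ha va : Prop) (l r u d : ℕ) : Prop :=
  (ha ∧ va → (l, r, u, d) ∈ P) ∧
  (¬ (ha ∧ va) → ((ha → r = l) ∧ (¬ ha → r = 0)) ∧ (va → u = d) ∧ (¬ va → u = 0))

/-- `P` tiles a square of side `N` with color `0` on the left and bottom sides. -/
def TilesSquare (P : List Tile) (N : ℕ) : Prop :=
  ∃ L D : ℕ → ℕ → ℕ, (∀ y < N, L 0 y = 0) ∧ (∀ x < N, D x 0 = 0) ∧
    ∀ x < N, ∀ y < N, (L x y, L (x + 1) y, D x (y + 1), D x y) ∈ P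

/-- The states `H i j` of the horizontal lines are `1` precisely within squares. -/
def StatesForced (N : ℕ) (H : ℕ → ℕ → ℕ) : Prop :=
  ∀ κ ≤ N, ∀ j, IsRank κ j → ∀ i, H i j = 1 ↔ digit κ i = 1

theorem StatesForced.active {N i j : ℕ} {H : ℕ → ℕ → ℕ} (h : StatesForced N H)
    (hi : 3 ^ N < i + 1) (hi' : i + 1 < 2 * 3 ^ N) (hj : 3 ^ N < j) (hj' : j < 2 * 3 ^ N)
    (hf : Free N j) : H i j = 1 ∧ H (i + 1) j = 1 := by
  have hr : IsRank N j := ⟨digit_eq_one_of_mem hj.le hj', hf.2⟩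
  rw [h N le_rfl j hr, h N le_rfl j hr]
  exact ⟨digit_eq_one_of_mem (by omega) (by omega), digit_eq_one_of_mem (by omega) (by omega)⟩

theorem StatesForced.inactive {N i j : ℕ} {H : ℕ → ℕ → ℕ} (h : StatesForced N H)
    (hj : 3 ^ N < j) (hj' : j < 2 * 3 ^ N) (hf : ¬ Free N j) (hi : Free N i) : H i j ≠ 1 := by
  rw [Free, not_and_or, not_not] at hf
  rcases hf with hf | hf
  · exact absurd hf (not_dvd_of_mem hj hj')
  · push Not at hf
    obtain ⟨k, hk, hd⟩ := hf
    obtain ⟨κ, hκ, hr⟩ := exists_isRank hd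
    rw [Ne, h κ (by omega) j hr]
    exact hi.2 κ (by omega)

/-- Away from the tiles of `P`, the payload of an active line is transmitted, and that of an
inactive one is erased. -/
def Transmits (H V X : ℕ → ℕ → ℕ) : Prop :=
  ∀ i j, ¬ ((H i (j + 1) = 1 ∧ H (i + 1) (j + 1) = 1) ∧
      (V j (i + 1) = 1 ∧ V (j + 1) (i + 1) = 1)) →
    ((H i (j + 1) = 1 ∧ H (i + 1) (j + 1) = 1) → X (i + 1) (j + 1) = X i (j + 1)) ∧
    (¬ (H i (j + 1) = 1 ∧ H (i + 1) (j + 1) = 1) → X (i + 1) (j + 1) = 0)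

theorem Transmits.start {N j : ℕ} {H V X : ℕ → ℕ → ℕ} (hX : Transmits H V X)
    (hH : StatesForced N H) (hj : IsRank N (j + 1)) : X (3 ^ N) (j + 1) = 0 := by
  obtain ⟨i, hi⟩ : ∃ i, 3 ^ N = i + 1 := Nat.exists_eq_add_one.2 (by positivity)
  have h : H i (j + 1) ≠ 1 := by
    rw [Ne, hH N le_rfl _ hj, digit, Nat.div_eq_of_lt (by omega)]
    omega
  rw [hi]
  exact (hX i j fun h' => h h'.1.1).2 fun h' => h h'.1

theorem Transmits.between {N a b j : ℕ} {H V X : ℕ → ℕ → ℕ} (hX : Transmits H V X)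
    (hH : StatesForced N H) (hV : StatesForced N V) (hj : 3 ^ N < j + 1)
    (hj' : j + 1 < 2 * 3 ^ N) (hf : Free N (j + 1)) (ha : 3 ^ N ≤ a) (hb : b < 2 * 3 ^ N)
    (hab : ∀ i, a < i → i < b → ¬ Free N i) (i : ℕ) (hai : a ≤ i) (hib : i < b) :
    X i (j + 1) = X a (j + 1) := by
  induction i, hai using Nat.le_induction with
  | base => rfl
  | succ i hai ih =>
    rw [← ih (by omega)]
    exact (hX i j fun h => hV.inactive (by omega) (by omega) (hab _ (by omega) hib) hf h.2.2).1
      (hH.active (by omega) (by omega) hj hj' hf)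

theorem tilesSquare_of_payload {N : ℕ} {P : List Tile} {H V X Y : ℕ → ℕ → ℕ}
    (hH : StatesForced N H) (hV : StatesForced N V)
    (hP : ∀ i j, PayloadRule P (H i (j + 1) = 1 ∧ H (i + 1) (j + 1) = 1)
      (V j (i + 1) = 1 ∧ V (j + 1) (i + 1) = 1)
      (X i (j + 1)) (X (i + 1) (j + 1)) (Y (j + 1) (i + 1)) (Y j (i + 1))) :
    TilesSquare P N := by
  have hX : Transmits H V X := fun i j h => ((hP i j).2 h).1
  have hY : Transmits V H Y := fun j i h => ((hP i j).2 fun h' => h h'.symm).2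
  obtain ⟨e, h0, he⟩ := exists_free_enumeration N
  have hle (x : ℕ) (hx : x ≤ N) : 3 ^ N ≤ e x := by
    induction x with
    | zero => exact h0.ge
    | succ x ih => exact (ih (by omega)).trans (he x (by omega)).1.le
  have hpred (x : ℕ) (hx : x < N) : ∃ i, e (x + 1) = i + 1 ∧ 3 ^ N < i + 1 ∧ i + 1 < 2 * 3 ^ N ∧
      Free N (i + 1) ∧ IsRank N (i + 1) ∧ e x ≤ i := by
    obtain ⟨h1, h2, h3, -⟩ := he x hx
    have h4 := hle x hx.le
    have h5 : e (x + 1) - 1 + 1 = e (x + 1) := by omega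
    refine ⟨e (x + 1) - 1, h5.symm, ?_⟩
    rw [h5]
    exact ⟨by omega, h2, h3, ⟨digit_eq_one_of_mem (by omega) h2, h3.2⟩, by omega⟩
  refine ⟨fun x y => X (e x) (e (y + 1)), fun x y => Y (e y) (e (x + 1)), ?_, ?_, ?_⟩
  · intro y hy
    obtain ⟨j, hj, -, -, -, hr, -⟩ := hpred y hy
    beta_reduce
    rw [h0, hj]
    exact hX.start hH hr
  · intro x hx
    obtain ⟨i, hi, -, -, -, hr, -⟩ := hpred x hx
    beta_reduce
    rw [h0, hi]
    exact hY.start hV hr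
  · intro x hx y hy
    obtain ⟨i, hi, i1, i2, i3, -, i4⟩ := hpred x hx
    obtain ⟨j, hj, j1, j2, j3, -, j4⟩ := hpred y hy
    have hfx := (he x hx).2.2.2
    have hfy := (he y hy).2.2.2
    rw [hi] at hfx
    rw [hj] at hfy
    beta_reduce
    rw [hi, hj, ← hX.between hH hV j1 j2 j3 (hle x hx.le) i2 hfx i i4 (by omega),
      ← hY.between hV hH i1 i2 i3 (hle y hy.le) j2 hfy j j4 (by omega)]
    exact (hP i j).1 ⟨hH.active i1 i2 j1 j2 j3, hV.active j1 j2 i1 i2 i3⟩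

/-- The skeleton part of an edge color: coordinates modulo `3`, wire label and state. -/
abbrev Skel : Type := (ℕ × ℕ) × (ℕ × ℕ) × ℕ

/-- The local constraint on coordinates modulo `3`. -/
def ClassRule (l r d u : ℕ × ℕ) : Prop :=
  r.1 = (l.1 + 1) % 3 ∧ r.2 = l.2 ∧ u.1 = (d.1 + 1) % 3 ∧ u.2 = d.2 ∧ u = (r.2, r.1)

/-- Lines of level zero have wire labels compatible with their coordinates. -/
def BaseRule (e : Skel) : Prop := e.1.2 ≠ 0 → e.2.1.1 % 3 = e.1.1 ∧ e.2.1.2 % 3 = e.1.2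

/-- The local constraint on the skeleton colors around a cell. -/
def SkelRule (l r d u : Skel) : Prop :=
  ClassRule l.1 r.1 d.1 u.1 ∧ (BaseRule r ∧ BaseRule u) ∧ WireRule l.2.1 r.2.1 d.2.1 u.2.1 ∧
    StateRule l.2.2 r.2.2 u.2.1 ∧ StateRule d.2.2 u.2.2 r.2.1

/-- A line is active at a cell when it has state `1` on both sides. -/
def Active (l r : Skel) : Prop := l.2.2 = 1 ∧ r.2.2 = 1

theorem class_eq {C E : ℕ → ℕ → ℕ × ℕ}
    (h : ∀ i j, ClassRule (C i (j + 1)) (C (i + 1) (j + 1)) (E j (i + 1)) (E (j + 1) (i + 1)))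
    (i j : ℕ) : C (i + 1) (j + 1) = (((C 1 1).1 + i) % 3, ((C 1 1).2 + j) % 3) := by
  have hlt : (C 1 1).1 < 3 ∧ (C 1 1).2 < 3 := by
    obtain ⟨h1, -, h3, -, h5⟩ := h 0 0
    rw [zero_add] at h1 h3 h5
    rw [h5] at h3
    simp only at h3
    omega
  induction j with
  | zero =>
    induction i with
    | zero => exact Prod.ext (by simp only [zero_add]; omega) (by simp only [zero_add]; omega)
    | succ i ih =>
      obtain ⟨h1, h2, -⟩ := h (i + 1) 0
      rw [ih] at h1 h2
      refine Prod.ext ?_ h2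
      rw [h1]
      simp only
      omega
  | succ j ih =>
    obtain ⟨-, -, h3, h4, h5⟩ := h i (j + 1)
    obtain ⟨-, -, -, -, h5'⟩ := h i j
    rw [h5, h5', ih] at h3 h4
    refine Prod.ext h4 ?_
    rw [← add_assoc]
    simp only at h3 ⊢
    omega

/-- Colorings of the grid obeying the local rules contain arbitrarily large squares tiled
by `P`. -/
theorem tilesSquare_of_grid {P : List Tile} {R U : ℕ → ℕ → Skel} {X Y : ℕ → ℕ → ℕ}
    (hS : ∀ i j, SkelRule (R i (j + 1)) (R (i + 1) (j + 1)) (U j (i + 1)) (U (j + 1) (i + 1)))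
    (hP : ∀ i j, PayloadRule P (Active (R i (j + 1)) (R (i + 1) (j + 1)))
      (Active (U j (i + 1)) (U (j + 1) (i + 1)))
      (X i (j + 1)) (X (i + 1) (j + 1)) (Y (j + 1) (i + 1)) (Y j (i + 1))) (N : ℕ) :
    TilesSquare P N := by
  have hC := class_eq (C := fun i j => (R i j).1) (E := fun j i => (U j i).1)
    fun i j => (hS i j).1
  have hE (i j : ℕ) : (U (j + 1) (i + 1)).1 = _ := (hS i j).1.2.2.2.2
  set a := (R 1 1).1.1
  set b := (R 1 1).1.2
  have hlt (a : ℕ) : ∃ s, (a + s) % 3 = 0 := ⟨2 * a, by omega⟩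
  obtain ⟨s, hs⟩ := hlt a
  obtain ⟨t, ht⟩ := hlt b
  have hW : Wired (fun i j => (R (i + (s + 1)) (j + (t + 1))).2.1)
      (fun j i => (U (j + (t + 1)) (i + (s + 1))).2.1) :=
    Wired.shift (R := fun i j => (R i j).2.1) (U := fun j i => (U j i).2.1)
      (fun i j => (hS i j).2.2.1) _ _
  have hR : BaseAligned (fun i j => (R (i + (s + 1)) (j + (t + 1))).2.1) := by
    intro i j hj
    have h1 := (hS (i + s) (j + t)).2.1.1
    have h2 := hC (i + s) (j + t)
    simp only [BaseRule, add_assoc] at h1 h2 ⊢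
    rw [h2] at h1
    have := h1 (by simp only; omega)
    simp only at this
    omega
  have hU : BaseAligned (fun j i => (U (j + (t + 1)) (i + (s + 1))).2.1) := by
    intro j i hi
    have h1 := (hS (i + s) (j + t)).2.1.2
    have h2 := hC (i + s) (j + t)
    have h3 := hE (i + s) (j + t)
    simp only [BaseRule, add_assoc] at h1 h2 h3 ⊢
    rw [h3, h2] at h1
    have := h1 (by simp only; omega)
    simp only at this
    omega
  obtain ⟨s', t', hA, hB⟩ := hW.exists_alignedBelow (N + 1) hR hU
  simp only [add_assoc] at hA hB
  set p := s' + (s + 1)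
  set q := t' + (t + 1)
  have hH : StatesForced N (fun i j => (R (i + p) (j + q)).2.2) := by
    intro κ hκ j hj i
    obtain ⟨j, rfl⟩ : ∃ k, j = k + 1 := ⟨j - 1, by
      have : j ≠ 0 := by rintro rfl; simpa [digit] using hj.1
      omega⟩
    refine state_eq_one_iff (S := fun i => (R (i + p) (j + 1 + q)).2.2) hB (by omega) hj
      (fun i => ?_) i
    have := (hS (i + p) (j + q)).2.2.2.1
    simpa only [add_right_comm] using this
  have hV : StatesForced N (fun j i => (U (j + q) (i + p)).2.2) := by
    intro κ hκ i hi j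
    obtain ⟨i, rfl⟩ : ∃ k, i = k + 1 := ⟨i - 1, by
      have : i ≠ 0 := by rintro rfl; simpa [digit] using hi.1
      omega⟩
    refine state_eq_one_iff (S := fun j => (U (j + q) (i + 1 + p)).2.2) hA (by omega) hi
      (fun j => ?_) j
    have := (hS (i + p) (j + q)).2.2.2.2
    simpa only [add_right_comm] using this
  refine tilesSquare_of_payload (X := fun i j => X (i + p) (j + q))
    (Y := fun j i => Y (j + q) (i + p)) hH hV fun i j => ?_
  have := hP (i + p) (j + q)
  simpa only [add_right_comm, Active] using this

/-- The wire labels of the hierarchical coloring. -/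
def stdWire (i j : ℕ) : ℕ × ℕ :=
  (i / 3 ^ padicValNat 3 j % 9, j / 3 ^ padicValNat 3 j % 9)

theorem stdWire_mod (i j : ℕ) : (stdWire i j).1 % 3 = digit (padicValNat 3 j) i ∧
    (stdWire i j).2 % 3 = digit (padicValNat 3 j) j := by
  simp only [stdWire, digit]
  omega

theorem digit_level_ne_zero (n : ℕ) : digit (padicValNat 3 (n + 1)) (n + 1) ≠ 0 := by
  rw [Ne, ← pow_succ_dvd_iff_digit pow_padicValNat_dvd]
  exact pow_succ_padicValNat_not_dvd n.succ_ne_zero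

theorem not_dvd_of_level_lt {n a : ℕ} (h : padicValNat 3 (n + 1) < a) : ¬ 3 ^ a ∣ n + 1 :=
  fun h' => pow_succ_padicValNat_not_dvd n.succ_ne_zero ((pow_dvd_pow 3 h).trans h')

theorem dvd_of_le_level {n a : ℕ} (h : a ≤ padicValNat 3 (n + 1)) : 3 ^ a ∣ n + 1 :=
  (pow_dvd_pow 3 h).trans pow_padicValNat_dvd

theorem digit_of_lt_level {n a : ℕ} (h : a < padicValNat 3 (n + 1)) : digit a (n + 1) = 0 :=
  (pow_succ_dvd_iff_digit (dvd_of_le_level h.le)).1 (dvd_of_le_level h)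

theorem stepWire_stdWire {i j : ℕ} (h : padicValNat 3 (j + 1) ≤ padicValNat 3 (i + 1)) :
    StepWire (stdWire i (j + 1)) (stdWire (i + 1) (j + 1)) := by
  have := succ_div_pow_of_dvd (dvd_of_le_level h)
  refine ⟨?_, rfl⟩
  simp only [stdWire, this]
  omega

theorem crossHigher_stdWire {i j : ℕ} (h : padicValNat 3 (j + 1) < padicValNat 3 (i + 1)) :
    CrossHigher (stdWire i (j + 1)) (stdWire (i + 1) (j + 1)) (stdWire j (i + 1))
      (stdWire (j + 1) (i + 1)) := by
  refine ⟨stepWire_stdWire h.le, ?_, ?_, ?_, fun h0 => ?_⟩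
  · rw [(stdWire_mod _ _).1, digit_of_lt_level h]
  · rw [(stdWire_mod _ _).2]
    exact digit_level_ne_zero j
  · simp only [stdWire, succ_div_pow_of_not_dvd (not_dvd_of_level_lt h)]
  · have key (n : ℕ) (k : ℕ) : n / 3 ^ k % 9 / 3 = digit (k + 1) n := by
      rw [digit, pow_succ, ← Nat.div_div_eq_div_mul]
      omega
    have hlev : padicValNat 3 (i + 1) = padicValNat 3 (j + 1) + 1 := by
      by_contra hne
      refine h0 ?_
      simp only [stdWire, key]
      exact digit_of_lt_level (by omega)
    rw [(stdWire_mod _ _).1, (stdWire_mod _ _).2]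
    simp only [stdWire, key, hlev, and_self]

theorem wireRule_stdWire (i j : ℕ) : WireRule (stdWire i (j + 1)) (stdWire (i + 1) (j + 1))
    (stdWire j (i + 1)) (stdWire (j + 1) (i + 1)) := by
  rcases lt_trichotomy (padicValNat 3 (j + 1)) (padicValNat 3 (i + 1)) with h | h | h
  · exact Or.inr (Or.inl (crossHigher_stdWire h))
  · refine Or.inl ⟨stepWire_stdWire h.le, stepWire_stdWire h.ge, ?_, ?_, ?_⟩
    · simp only [stdWire, h]
    · rw [(stdWire_mod _ _).1, h]
      exact digit_level_ne_zero i
    · rw [(stdWire_mod _ _).2]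
      exact digit_level_ne_zero j
  · exact Or.inr (Or.inr (crossHigher_stdWire h))

open Classical in
/-- The states of the hierarchical coloring. -/
noncomputable def stdState (i j : ℕ) : ℕ :=
  if h : ∃ κ, IsRank κ j then digit h.choose i else 0

theorem IsRank.stdState_eq {κ j : ℕ} (h : IsRank κ j) (i : ℕ) : stdState i j = digit κ i := by
  have h' : ∃ κ, IsRank κ j := ⟨κ, h⟩
  rw [stdState, dif_pos h', h'.choose_spec.unique h]

theorem exists_isRank_of_stdState {i j : ℕ} (h : stdState i j = 1) :
    ∃ κ, IsRank κ j ∧ digit κ i = 1 := by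
  by_cases h' : ∃ κ, IsRank κ j
  · obtain ⟨κ, h'⟩ := h'
    exact ⟨κ, h', by rw [← h'.stdState_eq, h]⟩
  · rw [stdState, dif_neg h'] at h
    exact absurd h (by norm_num)

theorem stdState_lt (i j : ℕ) : stdState i j < 3 := by
  rw [stdState]
  split_ifs
  · exact Nat.mod_lt _ (by norm_num)
  · norm_num

theorem stateRule_stdState (i j : ℕ) :
    StateRule (stdState i (j + 1)) (stdState (i + 1) (j + 1)) (stdWire (j + 1) (i + 1)) := by
  obtain ⟨h1, h2⟩ := stdWire_mod (j + 1) (i + 1)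
  rw [StateRule, h1, h2]
  by_cases h : ∃ κ, IsRank κ (j + 1)
  · obtain ⟨κ, h⟩ := h
    rw [h.stdState_eq, h.stdState_eq]
    rcases lt_trichotomy (padicValNat 3 (i + 1)) κ with hk | hk | hk
    · have := h.2 _ hk
      have := digit_succ_of_not_dvd (not_dvd_of_level_lt hk)
      omega
    · have := digit_level_ne_zero i
      rw [hk] at this ⊢
      have := digit_succ_of_dvd (dvd_of_le_level hk.ge)
      have := h.1
      have : digit κ i < 3 := Nat.mod_lt _ (by norm_num)
      omega
    · have h3 := digit_of_lt_level hk
      have h4 := digit_succ_of_dvd (dvd_of_le_level hk.le)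
      have h5 : digit κ i < 3 := Nat.mod_lt _ (by norm_num)
      have h6 : digit κ i = 2 := by
        rw [h3] at h4
        omega
      exact ⟨fun _ => Or.inr ⟨h6, h3⟩, fun _ => Or.inr ⟨h6, h3⟩, fun _ => Or.inr ⟨h6, h3⟩⟩
  · have h' : digit (padicValNat 3 (i + 1)) (j + 1) ≠ 1 := fun h' =>
      h ((exists_isRank h').imp fun _ => And.right)
    rw [stdState, dif_neg h, stdState, dif_neg h]
    omega

open Classical in
/-- The number of `κ`-free coordinates up to `i` in the block of length `3 ^ κ` containing `i`. -/
noncomputable def freeCount (κ : ℕ) : ℕ → ℕ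
  | 0 => 0
  | i + 1 => if 3 ^ κ ∣ i + 1 then 0 else freeCount κ i + if Free κ (i + 1) then 1 else 0

theorem freeCount_of_dvd {κ i : ℕ} (h : 3 ^ κ ∣ i) : freeCount κ i = 0 := by
  rcases i with _ | i
  · rfl
  · rw [freeCount, if_pos h]

theorem Free.freeCount_succ {κ i : ℕ} (h : Free κ (i + 1)) :
    freeCount κ (i + 1) = freeCount κ i + 1 := by
  rw [freeCount, if_neg h.1, if_pos h]

theorem freeCount_succ_of_not_free {κ i : ℕ} (h : ¬ Free κ (i + 1)) (h' : ¬ 3 ^ κ ∣ i + 1) :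
    freeCount κ (i + 1) = freeCount κ i := by
  rw [freeCount, if_neg h', if_neg h, add_zero]

open Classical in
/-- The array `A` written along the lines of the hierarchical coloring. -/
noncomputable def stdPayload (A : ℕ → ℕ → ℕ) (i j : ℕ) : ℕ :=
  if h : ∃ κ, IsRank κ j ∧ digit κ i = 1 ∧ ¬ 3 ^ κ ∣ j then
    A (freeCount h.choose i) (freeCount h.choose j - 1) else 0

theorem stdPayload_eq {A : ℕ → ℕ → ℕ} {κ i j : ℕ} (h : IsRank κ j) (hi : digit κ i = 1)
    (hj : ¬ 3 ^ κ ∣ j) : stdPayload A i j = A (freeCount κ i) (freeCount κ j - 1) := by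
  have h' : ∃ κ, IsRank κ j ∧ digit κ i = 1 ∧ ¬ 3 ^ κ ∣ j := ⟨κ, h, hi, hj⟩
  rw [stdPayload, dif_pos h', h'.choose_spec.1.unique h]

theorem stdPayload_eq_zero {A : ℕ → ℕ → ℕ} {i j : ℕ}
    (h : ∀ κ, IsRank κ j → digit κ i = 1 → 3 ^ κ ∣ j) : stdPayload A i j = 0 := by
  rw [stdPayload, dif_neg]
  rintro ⟨κ, h1, h2, h3⟩
  exact h3 (h κ h1 h2)

theorem stdPayload_mem {A : ℕ → ℕ → ℕ} (hA : ∀ y, A 0 y = 0) (i j : ℕ) :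
    stdPayload A i j = 0 ∨ ∃ x y, stdPayload A i j = A (x + 1) y := by
  rw [stdPayload]
  split_ifs with h
  · rcases hx : freeCount h.choose i with _ | x
    · exact Or.inl (hA _)
    · exact Or.inr ⟨x, _, rfl⟩
  · exact Or.inl rfl

/-- Both lines are active at a cell exactly at crossings of free lines of a common square. -/
theorem free_of_active {i j : ℕ}
    (h1 : stdState i (j + 1) = 1 ∧ stdState (i + 1) (j + 1) = 1)
    (h2 : stdState j (i + 1) = 1 ∧ stdState (j + 1) (i + 1) = 1) :
    ∃ κ, IsRank κ (i + 1) ∧ IsRank κ (j + 1) ∧ Free κ (i + 1) ∧ Free κ (j + 1) := by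
  obtain ⟨κ, hj, hi⟩ := exists_isRank_of_stdState h1.2
  obtain ⟨κ', hi', hj'⟩ := exists_isRank_of_stdState h2.2
  obtain rfl : κ = κ' := le_antisymm
    (not_lt.1 fun h => hj.2 _ h hj') (not_lt.1 fun h => hi'.2 _ h hi)
  rw [hj.stdState_eq, hj.stdState_eq] at h1
  rw [hi'.stdState_eq, hi'.stdState_eq] at h2
  refine ⟨κ, hi', hj, ⟨fun h => ?_, hi'.2⟩, ⟨fun h => ?_, hj.2⟩⟩
  · have := digit_succ_of_dvd h
    omega
  · have := digit_succ_of_dvd h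
    omega

theorem transmits_stdPayload {A : ℕ → ℕ → ℕ} (hA : ∀ y, A 0 y = 0) :
    Transmits stdState stdState (stdPayload A) := by
  intro i j hn
  constructor
  · intro h
    obtain ⟨κ, hj, hi⟩ := exists_isRank_of_stdState h.2
    have hi' := h.1
    rw [hj.stdState_eq] at hi'
    have hdi : ¬ 3 ^ κ ∣ i + 1 := fun h => by
      have := digit_succ_of_dvd h
      omega
    by_cases hdj : 3 ^ κ ∣ j + 1
    · rw [stdPayload_eq_zero, stdPayload_eq_zero]
      · exact fun κ' h' _ => h'.unique hj ▸ hdj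
      · exact fun κ' h' _ => h'.unique hj ▸ hdj
    · rw [stdPayload_eq hj hi hdj, stdPayload_eq hj hi' hdj, freeCount_succ_of_not_free _ hdi]
      intro hf
      have hr : IsRank κ (i + 1) := ⟨hi, hf.2⟩
      refine hn ⟨h, ?_⟩
      rw [hr.stdState_eq, hr.stdState_eq, ← digit_succ_of_not_dvd hdj]
      exact ⟨hj.1, hj.1⟩
  · intro h
    by_contra h0
    have : ∃ κ, IsRank κ (j + 1) ∧ digit κ (i + 1) = 1 ∧ ¬ 3 ^ κ ∣ j + 1 := by
      by_contra h'
      push Not at h'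
      exact h0 (stdPayload_eq_zero h')
    obtain ⟨κ, hj, hi, hdj⟩ := this
    by_cases hdi : 3 ^ κ ∣ i + 1
    · rw [stdPayload_eq hj hi hdj, freeCount_of_dvd hdi, hA] at h0
      exact h0 rfl
    · refine h ?_
      rw [hj.stdState_eq, hj.stdState_eq, ← digit_succ_of_not_dvd hdi]
      exact ⟨hi, hi⟩

/-- The skeleton colors of the hierarchical coloring. -/
noncomputable def stdSkel (i j : ℕ) : Skel := ((i % 3, j % 3), stdWire i j, stdState i j)

theorem skelRule_stdSkel (i j : ℕ) : SkelRule (stdSkel i (j + 1)) (stdSkel (i + 1) (j + 1))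
    (stdSkel j (i + 1)) (stdSkel (j + 1) (i + 1)) := by
  have base (i j : ℕ) : BaseRule (stdSkel i j) := by
    intro h
    have h0 : padicValNat 3 j = 0 :=
      padicValNat.eq_zero_of_not_dvd fun h' => h (Nat.mod_eq_zero_of_dvd h')
    simp only [stdSkel, (stdWire_mod _ _).1, (stdWire_mod _ _).2, h0, digit, pow_zero,
      Nat.div_one, and_self]
  refine ⟨?_, ⟨base _ _, base _ _⟩, wireRule_stdWire i j, stateRule_stdState i j,
    stateRule_stdState j i⟩
  refine ⟨?_, rfl, ?_, rfl, rfl⟩ <;> simp only [stdSkel] <;> omega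

theorem payloadRule_stdPayload {P : List Tile} {L D : ℕ → ℕ → ℕ} (hL : ∀ y, L 0 y = 0)
    (hD : ∀ x, D x 0 = 0) (hP : ∀ x y, (L x y, L (x + 1) y, D x (y + 1), D x y) ∈ P) (i j : ℕ) :
    PayloadRule P (Active (stdSkel i (j + 1)) (stdSkel (i + 1) (j + 1)))
      (Active (stdSkel j (i + 1)) (stdSkel (j + 1) (i + 1)))
      (stdPayload L i (j + 1)) (stdPayload L (i + 1) (j + 1))
      (stdPayload (fun y x => D x y) (j + 1) (i + 1))
      (stdPayload (fun y x => D x y) j (i + 1)) := by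
  refine ⟨fun ⟨h1, h2⟩ => ?_, fun h => ⟨transmits_stdPayload hL i j h,
    transmits_stdPayload (A := fun y x => D x y) hD j i fun h' => h h'.symm⟩⟩
  obtain ⟨κ, hi, hj, fi, fj⟩ := free_of_active h1 h2
  have hi' := hi.1
  have hj' := hj.1
  rw [digit_succ_of_not_dvd fi.1] at hi'
  rw [digit_succ_of_not_dvd fj.1] at hj'
  rw [stdPayload_eq hj hi.1 fj.1, stdPayload_eq hj hi' fj.1, stdPayload_eq hi hj.1 fi.1,
    stdPayload_eq hi hj' fi.1, fi.freeCount_succ, fj.freeCount_succ]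
  exact hP _ _

/-- The finite set of skeleton colors in use. -/
@[irreducible] def skelBox : Finset Skel :=
  (Finset.range 9 ×ˢ Finset.range 9) ×ˢ (Finset.range 9 ×ˢ Finset.range 9) ×ˢ Finset.range 9

open Classical in
/-- The list of skeleton tiles `(left, right, up, down)`, together with flags recording whether
their horizontal and vertical lines are active. -/
noncomputable def skelList : List ((Skel × Skel × Skel × Skel) × Bool × Bool) :=
  ((skelBox ×ˢ skelBox ×ˢ skelBox ×ˢ skelBox).filter
    fun s => SkelRule s.1 s.2.1 s.2.2.2 s.2.2.1).toList.map
    fun s => (s, decide (Active s.1 s.2.1), decide (Active s.2.2.2 s.2.2.1))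

/-- The colors which may be transmitted between the tiles of `P`. -/
def payloadColors (P : List Tile) : List ℕ := 0 :: (P.map (·.2.1) ++ P.map (·.2.2.1))

/-- The payloads of the tiles with the given activity flags. -/
def payloadTiles (P : List Tile) (ha va : Bool) : List Tile :=
  bif ha && va then P else (payloadColors P).flatMap fun l => (payloadColors P).map fun d =>
    (l, bif ha then l else 0, bif va then d else 0, d)

/-- The color with given skeleton part and payload. -/
def mkColor (s : Skel) (p : ℕ) : ℕ := Nat.pair (Encodable.encode s) p

/-- The skeleton part of a color. -/
def colorSkel (c : ℕ) : Skel := (Encodable.decode c.unpair.1).getD ((0, 0), (0, 0), 0)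

/-- The payload of a color. -/
def colorPayload (c : ℕ) : ℕ := c.unpair.2

/-- The tile with given skeleton part and payload. -/
def mkTile (s : Skel × Skel × Skel × Skel) (p : Tile) : Tile :=
  (mkColor s.1 p.1, mkColor s.2.1 p.2.1, mkColor s.2.2.1 p.2.2.1, mkColor s.2.2.2 p.2.2.2)

/-- The tile set forcing large squares tiled by `P`. -/
noncomputable def dominoList (P : List Tile) : List Tile :=
  skelList.flatMap fun s => (payloadTiles P s.2.1 s.2.2).map (mkTile s.1)

@[simp] theorem colorSkel_mkColor (s : Skel) (p : ℕ) : colorSkel (mkColor s p) = s := by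
  rw [colorSkel, mkColor, Nat.unpair_pair, Encodable.encodek, Option.getD_some]

@[simp] theorem colorPayload_mkColor (s : Skel) (p : ℕ) : colorPayload (mkColor s p) = p := by
  simp [colorPayload, mkColor]

theorem payloadRule_of_mem {P : List Tile} {ha va : Bool} {t : Tile}
    (h : t ∈ payloadTiles P ha va) :
    PayloadRule P (ha = true) (va = true) t.1 t.2.1 t.2.2.1 t.2.2.2 := by
  rw [payloadTiles] at h
  rcases hb : ha && va
  · simp only [hb, cond_false, List.mem_flatMap, List.mem_map] at h
    obtain ⟨l, -, d, -, rfl⟩ := h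
    cases ha <;> cases va <;> simp_all [PayloadRule]
  · rw [hb, cond_true] at h
    rw [Bool.and_eq_true] at hb
    exact ⟨fun _ => h, fun hn => absurd hb hn⟩

theorem mem_payloadTiles {P : List Tile} {ha va : Prop} [Decidable ha] [Decidable va]
    {l r u d : ℕ} (h : PayloadRule P ha va l r u d) (hl : l ∈ payloadColors P)
    (hd : d ∈ payloadColors P) : (l, r, u, d) ∈ payloadTiles P (decide ha) (decide va) := by
  rw [payloadTiles]
  by_cases h1 : ha <;> by_cases h2 : va <;>
    simp_all [PayloadRule]

theorem rules_of_mem {P : List Tile} {t : Tile} (h : t ∈ dominoList P) :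
    SkelRule (colorSkel t.left) (colorSkel t.right) (colorSkel t.down) (colorSkel t.up) ∧
    PayloadRule P (Active (colorSkel t.left) (colorSkel t.right))
      (Active (colorSkel t.down) (colorSkel t.up)) (colorPayload t.left) (colorPayload t.right)
      (colorPayload t.up) (colorPayload t.down) := by
  classical
  simp only [dominoList, skelList, List.mem_flatMap, List.mem_map, Finset.mem_toList,
    Finset.mem_filter] at h
  obtain ⟨_, ⟨s, ⟨-, hs⟩, rfl⟩, p, hp, rfl⟩ := h
  have := payloadRule_of_mem hp
  simp only [decide_eq_true_eq] at this
  simpa [Tile.left, Tile.right, Tile.up, Tile.down, mkTile] using ⟨hs, this⟩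

theorem mem_dominoList {P : List Tile} {sl sr su sd : Skel} {l r u d : ℕ}
    (hs : SkelRule sl sr sd su) (hp : PayloadRule P (Active sl sr) (Active sd su) l r u d)
    (h1 : sl ∈ skelBox) (h2 : sr ∈ skelBox) (h3 : su ∈ skelBox) (h4 : sd ∈ skelBox)
    (hl : l ∈ payloadColors P) (hd : d ∈ payloadColors P) :
    (mkColor sl l, mkColor sr r, mkColor su u, mkColor sd d) ∈ dominoList P := by
  classical
  simp only [dominoList, skelList, List.mem_flatMap, List.mem_map, Finset.mem_toList,
    Finset.mem_filter, Finset.mem_product]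
  exact ⟨_, ⟨(sl, sr, su, sd), ⟨⟨h1, h2, h3, h4⟩, hs⟩, rfl⟩, (l, r, u, d),
    mem_payloadTiles hp hl hd, rfl⟩

theorem tilesSquare_of_tiling {P : List Tile}
    {f : ℕ × ℕ → {t : Tile // t ∈ (dominoList P).toFinset}} (hf : IsPlaneTiling _ f) (N : ℕ) :
    TilesSquare P N := by
  let h : ℕ → ℕ → ℕ := fun i j => i.casesOn (Tile.left (f (0, j - 1)).1)
    fun i => Tile.right (f (i, j - 1)).1
  let v : ℕ → ℕ → ℕ := fun j i => j.casesOn (Tile.down (f (i - 1, 0)).1)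
    fun j => Tile.up (f (i - 1, j)).1
  have hl (i j : ℕ) : h i (j + 1) = Tile.left (f (i, j)).1 := by
    rcases i with _ | i
    · rfl
    · exact (hf i j).1
  have hd (i j : ℕ) : v j (i + 1) = Tile.down (f (i, j)).1 := by
    rcases j with _ | j
    · rfl
    · exact (hf i j).2
  have key (i j : ℕ) := rules_of_mem (List.mem_toFinset.1 (f (i, j)).2)
  refine tilesSquare_of_grid (R := fun i j => colorSkel (h i j)) (U := fun j i => colorSkel (v j i))
    (X := fun i j => colorPayload (h i j)) (Y := fun j i => colorPayload (v j i))
    (fun i j => ?_) (fun i j => ?_) N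
  · have := (key i j).1
    rw [← hl, ← hd] at this
    exact this
  · have := (key i j).2
    rw [← hl, ← hd] at this
    exact this

theorem stdSkel_mem (i j : ℕ) : stdSkel i j ∈ skelBox := by
  have h (n : ℕ) {m : ℕ} (h0 : 0 < m) (hm : m ≤ 9) : n % m < 9 := (Nat.mod_lt n h0).trans_le hm
  have h3 : stdState i j < 9 := (stdState_lt i j).trans (by norm_num)
  unfold skelBox
  simp only [Finset.mem_product, Finset.mem_range]
  exact ⟨⟨h i three_pos (by norm_num), h j three_pos (by norm_num)⟩,
    ⟨h _ (by norm_num) le_rfl, h _ (by norm_num) le_rfl⟩, h3⟩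

/-- `P` tiles the quadrant with color `0` on the left and bottom sides. -/
def TilesQuadrant (P : List Tile) : Prop :=
  ∃ L D : ℕ → ℕ → ℕ, (∀ y, L 0 y = 0) ∧ (∀ x, D x 0 = 0) ∧
    ∀ x y, (L x y, L (x + 1) y, D x (y + 1), D x y) ∈ P

theorem TilesQuadrant.exists_tiling {P : List Tile} (h : TilesQuadrant P) :
    ∃ f : ℕ × ℕ → {t : Tile // t ∈ (dominoList P).toFinset}, IsPlaneTiling _ f := by
  obtain ⟨L, D, hL, hD, hP⟩ := h
  have hX (i j : ℕ) : stdPayload L i j ∈ payloadColors P := by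
    simp only [payloadColors, List.mem_cons, List.mem_append, List.mem_map]
    refine (stdPayload_mem hL i j).imp_right fun ⟨x, y, h⟩ => Or.inl ⟨_, hP x y, h.symm⟩
  have hY (j i : ℕ) : stdPayload (fun y x => D x y) j i ∈ payloadColors P := by
    simp only [payloadColors, List.mem_cons, List.mem_append, List.mem_map]
    refine (stdPayload_mem (A := fun y x => D x y) hD j i).imp_right
      fun ⟨y, x, h⟩ => Or.inr ⟨_, hP x y, h.symm⟩
  refine ⟨fun c => ⟨_, List.mem_toFinset.2 (mem_dominoList (skelRule_stdSkel c.1 c.2)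
    (payloadRule_stdPayload hL hD hP c.1 c.2) (stdSkel_mem _ _) (stdSkel_mem _ _)
    (stdSkel_mem _ _) (stdSkel_mem _ _) (hX _ _) (hY _ _))⟩, fun i j => ⟨rfl, rfl⟩⟩

theorem primrec_payloadColors : Primrec payloadColors :=
  Primrec.list_cons.comp (Primrec.const 0) (Primrec.list_append.comp
    (Primrec.list_map Primrec.id ((Primrec.fst.comp Primrec.snd).comp Primrec.snd).to₂)
    (Primrec.list_map Primrec.id
      ((Primrec.fst.comp (Primrec.snd.comp Primrec.snd)).comp Primrec.snd).to₂))

theorem primrec_payloadTiles :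
    Primrec fun x : List Tile × Bool × Bool => payloadTiles x.1 x.2.1 x.2.2 := by
  have hc : Primrec fun x : List Tile × Bool × Bool => payloadColors x.1 :=
    primrec_payloadColors.comp Primrec.fst
  have ha : Primrec fun x : List Tile × Bool × Bool => x.2.1 := Primrec.fst.comp Primrec.snd
  have hv : Primrec fun x : List Tile × Bool × Bool => x.2.2 := Primrec.snd.comp Primrec.snd
  refine Primrec.cond (Primrec.and.comp ha hv) Primrec.fst
    (Primrec.list_flatMap hc (Primrec.list_map (hc.comp Primrec.fst) ?_))
  have hx : Primrec fun y : ((List Tile × Bool × Bool) × ℕ) × ℕ => y.1.1 :=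
    Primrec.fst.comp Primrec.fst
  have hl : Primrec fun y : ((List Tile × Bool × Bool) × ℕ) × ℕ => y.1.2 :=
    Primrec.snd.comp Primrec.fst
  exact hl.pair ((Primrec.cond (ha.comp hx) hl (Primrec.const 0)).pair
    ((Primrec.cond (hv.comp hx) Primrec.snd (Primrec.const 0)).pair Primrec.snd))

theorem primrec_mkColor : Primrec₂ mkColor :=
  Primrec₂.natPair.comp (Primrec.encode.comp Primrec.fst) Primrec.snd

theorem primrec_mkTile : Primrec₂ mkTile := by
  have hs : Primrec fun x : (Skel × Skel × Skel × Skel) × Tile => x.1 := Primrec.fst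
  have hp : Primrec fun x : (Skel × Skel × Skel × Skel) × Tile => x.2 := Primrec.snd
  have hs2 := Primrec.snd.comp hs
  have hp2 := Primrec.snd.comp hp
  have hs3 := Primrec.snd.comp hs2
  have hp3 := Primrec.snd.comp hp2
  exact (primrec_mkColor.comp (Primrec.fst.comp hs) (Primrec.fst.comp hp)).pair
    ((primrec_mkColor.comp (Primrec.fst.comp hs2) (Primrec.fst.comp hp2)).pair
      ((primrec_mkColor.comp (Primrec.fst.comp hs3) (Primrec.fst.comp hp3)).pair
        (primrec_mkColor.comp (Primrec.snd.comp hs3) (Primrec.snd.comp hp3))))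

theorem primrec_dominoList : Primrec dominoList :=
  Primrec.list_flatMap (Primrec.const skelList) (Primrec.list_map
    (primrec_payloadTiles.comp (Primrec.fst.pair (Primrec.snd.comp Primrec.snd)))
    (primrec_mkTile.comp (Primrec.fst.comp (Primrec.snd.comp Primrec.fst)) Primrec.snd))

/-- The list of elements of the finite set of tiles with code `n`. -/
def decodeTiles (n : ℕ) : List Tile :=
  (Denumerable.raise' (Denumerable.ofNat (List ℕ) n) 0).map (Denumerable.ofNat Tile)

theorem mem_ofNat_finset {n : ℕ} {t : Tile} :
    t ∈ Denumerable.ofNat (Finset Tile) n ↔ t ∈ decodeTiles n := by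
  change t ∈ Finset.map (Denumerable.eqv Tile).symm.toEmbedding
    (Denumerable.raise'Finset (Denumerable.ofNat (List ℕ) n) 0) ↔ _
  rw [Finset.mem_map, decodeTiles, List.mem_map]
  rfl

theorem primrec_raise' : Primrec fun l : List ℕ => Denumerable.raise' l 0 := by
  have key (l : List ℕ) : ∀ (acc : List ℕ) (n : ℕ),
      (l.foldl (fun s m => (s.1 ++ [m + s.2], m + s.2 + 1)) (acc, n)).1 =
        acc ++ Denumerable.raise' l n := by
    induction l with
    | nil => simp [Denumerable.raise']
    | cons m l ih => simp [Denumerable.raise', ih]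
  refine (Primrec.fst.comp (Primrec.list_foldl (g := fun _ : List ℕ => (([] : List ℕ), 0))
    (h := fun _ x => (x.1.1 ++ [x.2 + x.1.2], x.2 + x.1.2 + 1)) Primrec.id (Primrec.const _)
    ?_)).of_eq fun l => key l [] 0
  have hm : Primrec fun y : List ℕ × (List ℕ × ℕ) × ℕ => y.2.2 + y.2.1.2 :=
    Primrec.nat_add.comp (Primrec.snd.comp Primrec.snd)
      (Primrec.snd.comp (Primrec.fst.comp Primrec.snd))
  exact (Primrec.list_append.comp (Primrec.fst.comp (Primrec.fst.comp Primrec.snd))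
    (Primrec.list_cons.comp hm (Primrec.const []))).pair (Primrec.succ.comp hm)

theorem primrec_decodeTiles : Primrec decodeTiles :=
  Primrec.list_map (primrec_raise'.comp (Primrec.ofNat (List ℕ)))
    ((Primrec.ofNat Tile).comp Primrec.snd).to₂

theorem computable_toFinset : Computable fun l : List Tile => l.toFinset := by
  have hsub : PrimrecRel fun (l l' : List Tile) => ∀ t ∈ l, t ∈ l' := by
    have h1 : PrimrecRel fun (t : Tile) (l : List Tile) => ∃ a ∈ l, a = t :=
      (PrimrecRel.exists_mem_list (Primrec.eq (α := Tile))).comp Primrec.snd Primrec.fst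
    exact (PrimrecRel.forall_mem_list h1).of_eq fun l l' => by simp
  have hrel : PrimrecRel fun (l : List Tile) (n : ℕ) =>
      (∀ t ∈ l, t ∈ decodeTiles n) ∧ ∀ t ∈ decodeTiles n, t ∈ l :=
    (hsub.comp Primrec.fst (primrec_decodeTiles.comp Primrec.snd)).and
      (hsub.comp (primrec_decodeTiles.comp Primrec.snd) Primrec.fst)
  have hcode (l : List Tile) (n : ℕ) : ((∀ t ∈ l, t ∈ decodeTiles n) ∧
      ∀ t ∈ decodeTiles n, t ∈ l) ↔
      n = (Primcodable.ofDenumerable (Finset Tile)).toEncodable.encode l.toFinset := by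
    change _ ↔ n = Denumerable.finset.toEncodable.encode l.toFinset
    have h : n = Denumerable.finset.toEncodable.encode l.toFinset ↔
        Denumerable.ofNat (Finset Tile) n = l.toFinset := by
      constructor
      · rintro rfl
        exact Denumerable.ofNat_encode _
      · intro h
        rw [← h]
        exact (Denumerable.encode_ofNat n).symm
    rw [h, Finset.ext_iff]
    simp only [mem_ofNat_finset, List.mem_toFinset]
    exact ⟨fun h t => ⟨h.2 t, h.1 t⟩, fun h => ⟨fun t => (h t).2, fun t => (h t).1⟩⟩
  have hp : Computable₂ fun (l : List Tile) (n : ℕ) =>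
      decide (n = (Primcodable.ofDenumerable (Finset Tile)).toEncodable.encode l.toFinset) :=
    ((hrel.of_eq hcode).decide).to_comp
  refine Computable.encode_iff.1 ((Partrec.rfind hp.partrec₂).of_eq fun l => ?_)
  refine Part.eq_some_iff.2 (Nat.mem_rfind.2 ⟨?_, fun hm => ?_⟩)
  · simp
  · simpa using hm.ne
/-- The tiles of the bottom row: they force the input word `u 0, …, u (k - 1)` followed by
blanks `e` on the top edges. -/
def inputTiles (u : ℕ → ℕ) (e k : ℕ) : List Tile :=
  (2 * k, 2 * k, e, 0) :: (List.range k).map fun i => (2 * i, 2 * i + 2, u i, 0)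

theorem primrec_inputTiles {u : ℕ → ℕ} (hu : Primrec u) (e : ℕ) : Primrec (inputTiles u e) := by
  have h2 : Primrec fun k : ℕ => 2 * k := Primrec.nat_mul.comp (Primrec.const 2) Primrec.id
  have ht : Primrec fun i : ℕ => (2 * i, 2 * i + 2, u i, 0) :=
    h2.pair ((Primrec.nat_add.comp h2 (Primrec.const 2)).pair (hu.pair (Primrec.const 0)))
  exact Primrec.list_cons.comp (h2.pair (h2.pair (Primrec.const _)))
    (Primrec.list_map Primrec.list_range (ht.comp Primrec.snd).to₂)

/-- The color of a vertical edge carrying the states `a` and `b`. -/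
def edgeColor {Q : Type*} (code : Q → ℕ) (a b : Q) : ℕ :=
  2 * Nat.pair (code a) (code b) + 1

/-- The tiles simulating one step of a one-dimensional cellular automaton with states in `K`,
blank state `e` and partial local rule `F`. -/
def stepTiles {Q : Type*} (K : Set Q) (F : Q → Q → Q → Option Q) (e : Q) (code : Q → ℕ) :
    Set Tile :=
  {t | ∃ a ∈ K, ∃ b ∈ K, ∃ z ∈ K, ∃ y ∈ K, F a b z = some y ∧
    (t.1 = edgeColor code a b ∨ t.1 = 0 ∧ a = e ∧ b = e) ∧
    t.2 = (edgeColor code b z, code y + 1, code z + 1)}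

theorem finite_stepTiles {Q : Type*} {K : Set Q} (hK : K.Finite) (F : Q → Q → Q → Option Q)
    (e : Q) (code : Q → ℕ) : (stepTiles K F e code).Finite := by
  refine (((hK.prod (hK.prod (hK.prod hK))).prod (Set.finite_univ (α := Bool))).image
    fun p : (Q × Q × Q × Q) × Bool =>
      ((if p.2 then edgeColor code p.1.1 p.1.2.1 else 0, edgeColor code p.1.2.1 p.1.2.2.1,
        code p.1.2.2.2 + 1, code p.1.2.2.1 + 1) : Tile)).subset ?_
  rintro ⟨l, t⟩ ⟨a, ha, b, hb, z, hz, y, hy, -, hl, rfl⟩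
  rcases hl with rfl | ⟨rfl, -⟩
  · exact ⟨((a, b, z, y), true), by simp [*], by simp⟩
  · exact ⟨((a, b, z, y), false), by simp [*], by simp⟩

/-- Tile sets simulating a partial cellular automaton on the input words `w 0, …, w (k - 1)`.
The row `G t` of a space-time diagram starts with two blank states. -/
theorem exists_tiles_of_automaton {Q : Type*} {K : Set Q} (hK : K.Finite)
    (F : Q → Q → Q → Option Q) (e : Q) {w : ℕ → Q} (hw : ∀ i, w (i + 2) = w 2) :
    ∃ P : ℕ → List Tile, Primrec P ∧ ∀ (k : ℕ) (G : ℕ → ℕ → Q), (∀ t x, G t x ∈ K) →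
      (∀ t, G t 0 = e) → (∀ t, G t 1 = e) →
      (∀ x, G 0 (x + 2) = if x < k then w x else e) →
      ((∀ t x, F (G t x) (G t (x + 1)) (G t (x + 2)) = some (G (t + 1) (x + 2))) →
        TilesQuadrant (P k)) ∧
      ∀ T, (∀ t < T, ∀ x, F (G t x) (G t (x + 1)) (G t (x + 2)) = some (G (t + 1) (x + 2))) →
        (∃ x, F (G T x) (G T (x + 1)) (G T (x + 2)) = none) → ∃ N, ¬ TilesSquare (P k) N := by
  obtain ⟨code, hcode⟩ := Set.countable_iff_exists_injOn.1 hK.countable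
  have hu : Primrec fun i => code (w i) + 1 := by
    have : Primrec fun i : ℕ => if i = 0 then code (w 0) + 1 else
        if i = 1 then code (w 1) + 1 else code (w 2) + 1 :=
      Primrec.ite (Primrec.eq.comp Primrec.id (Primrec.const 0)) (Primrec.const _)
        (Primrec.ite (Primrec.eq.comp Primrec.id (Primrec.const 1)) (Primrec.const _)
          (Primrec.const _))
    refine this.of_eq fun i => ?_
    rcases i with _ | _ | i
    · simp
    · simp
    · simp [hw i]
  have hR := finite_stepTiles hK F e code
  refine ⟨fun k => hR.toFinset.toList ++ inputTiles (fun i => code (w i) + 1) (code e + 1) k,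
    Primrec.list_append.comp (Primrec.const _) (primrec_inputTiles hu _), ?_⟩
  intro k G hG hG0 hG1 hinit
  have hmem (t : Tile) : t ∈ hR.toFinset.toList ++
      inputTiles (fun i => code (w i) + 1) (code e + 1) k ↔ t ∈ stepTiles K F e code ∨
      t = (2 * k, 2 * k, code e + 1, 0) ∨
      ∃ i < k, t = (2 * i, 2 * i + 2, code (w i) + 1, 0) := by
    simp [inputTiles, eq_comm]
  constructor
  · intro hstep
    refine ⟨fun x y => y.casesOn (2 * min x k) fun t => x.casesOn 0 fun x =>
        edgeColor code (G t (x + 1)) (G t (x + 2)),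
      fun x y => y.casesOn 0 fun t => code (G t (x + 2)) + 1, ?_, fun _ => rfl, fun x y => ?_⟩
    · rintro (_ | y) <;> simp
    · rw [hmem]
      rcases y with _ | t
      · right
        simp only [hinit]
        rcases lt_or_ge x k with hx | hx
        · right
          refine ⟨x, hx, ?_⟩
          rw [min_eq_left hx.le, min_eq_left (Nat.succ_le_of_lt hx)]
          simp [hx]
          omega
        · left
          rw [min_eq_right hx, min_eq_right (hx.trans (Nat.le_succ x))]
          simp [hx.not_gt]
      · left
        refine ⟨G t x, hG _ _, G t (x + 1), hG _ _, G t (x + 2), hG _ _, G (t + 1) (x + 2),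
          hG _ _, hstep t x, ?_, rfl⟩
        rcases x with _ | x
        · exact .inr ⟨rfl, hG0 t, hG1 t⟩
        · exact .inl rfl
  · rintro T hstep ⟨X, hX⟩
    refine ⟨X + T + 2, ?_⟩
    rintro ⟨L, D, hL, hD, hP⟩
    simp only [hmem] at hP
    set N := X + T + 2 with hN
    have hbottom (x : ℕ) : x < N → L x 0 = 2 * min x k ∧ D x 1 = code (G 0 (x + 2)) + 1 := by
      have key (x : ℕ) (hx : x < N) (hl : L x 0 = 2 * min x k) :
          L (x + 1) 0 = 2 * min (x + 1) k ∧ D x 1 = code (G 0 (x + 2)) + 1 := by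
        rw [hinit]
        rcases hP x hx 0 (by omega) with ⟨a, -, b, -, z, -, y, -, -, -, h⟩ | h | ⟨i, hi, h⟩
        · simp [hD x hx] at h
        · simp only [Prod.mk.injEq] at h
          obtain ⟨h1, h2, h3, -⟩ := h
          rw [if_neg (by omega)]
          exact ⟨by omega, h3⟩
        · simp only [Prod.mk.injEq] at h
          obtain ⟨h1, h2, h3, -⟩ := h
          obtain rfl : i = x := by omega
          rw [if_pos hi]
          exact ⟨by omega, h3⟩
      induction x with
      | zero =>
        intro hx
        have h0 : L 0 0 = 2 * min 0 k := by simp [hL 0 hx]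
        exact ⟨h0, (key 0 hx h0).2⟩
      | succ x ih =>
        intro hx
        have h0 := (key x (by omega) (ih (by omega)).1).1
        exact ⟨h0, (key (x + 1) hx h0).2⟩
    have hrow (t : ℕ) (ht : t + 1 < N) (hrow : ∀ x < N, D x (t + 1) = code (G t (x + 2)) + 1) :
        ∀ x < N, ∃ y ∈ K, F (G t x) (G t (x + 1)) (G t (x + 2)) = some y ∧
          D x (t + 2) = code y + 1 := by
      have key (x : ℕ) (hx : x < N) (hl : L x (t + 1) = edgeColor code (G t x) (G t (x + 1)) ∨
          L x (t + 1) = 0 ∧ G t x = e ∧ G t (x + 1) = e) :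
          L (x + 1) (t + 1) = edgeColor code (G t (x + 1)) (G t (x + 2)) ∧
          ∃ y ∈ K, F (G t x) (G t (x + 1)) (G t (x + 2)) = some y ∧ D x (t + 2) = code y + 1 := by
        rcases hP x hx (t + 1) ht with ⟨a, ha, b, hb, z, hz, y, hy, hF, hl', h⟩ | h | ⟨i, hi, h⟩
        · simp only [Prod.mk.injEq] at h
          obtain ⟨h1, h2, h3⟩ := h
          rw [hrow x hx] at h3
          obtain rfl : G t (x + 2) = z := hcode (hG _ _) hz (Nat.succ_injective h3)
          have hab : a = G t x ∧ b = G t (x + 1) := by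
            rcases hl with hl | ⟨hl, hl0, hl1⟩ <;> rcases hl' with hl' | ⟨hl', ha0, hb0⟩
            · rw [hl] at hl'
              simp only [edgeColor, add_left_inj, mul_eq_mul_left_iff, OfNat.ofNat_ne_zero,
                or_false, Nat.pair_eq_pair] at hl'
              exact ⟨hcode ha (hG _ _) hl'.1.symm, hcode hb (hG _ _) hl'.2.symm⟩
            · simp [hl, edgeColor] at hl'
            · simp [hl, edgeColor] at hl'
            · exact ⟨ha0.trans hl0.symm, hb0.trans hl1.symm⟩
          obtain ⟨rfl, rfl⟩ := hab
          exact ⟨h1, y, hy, hF, h2⟩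
        · simp [hrow x hx] at h
        · simp [hrow x hx] at h
      have hleft (x : ℕ) : x < N → (L x (t + 1) = edgeColor code (G t x) (G t (x + 1)) ∨
          L x (t + 1) = 0 ∧ G t x = e ∧ G t (x + 1) = e) := by
        induction x with
        | zero => exact fun _ => .inr ⟨hL _ ht, hG0 t, hG1 t⟩
        | succ x ih => exact fun hx => .inl (key x (by omega) (ih (by omega))).1
      exact fun x hx => (key x hx (hleft x hx)).2
    have hall (t : ℕ) : t ≤ T → ∀ x < N, D x (t + 1) = code (G t (x + 2)) + 1 := by
      induction t with
      | zero => exact fun _ x hx => (hbottom x hx).2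
      | succ t ih =>
        intro ht x hx
        obtain ⟨y, -, hy, hD'⟩ := hrow t (by omega) (ih (by omega)) x hx
        rw [hstep t (by omega) x, Option.some_inj] at hy
        rw [hD', hy]
    obtain ⟨y, -, hy, -⟩ := hrow T (by omega) (hall T le_rfl) X (by omega)
    simp [hX] at hy
section TuringMachine

open Turing

variable {Γ Λ : Type*} [Inhabited Γ] [Inhabited Λ]

/-- The state in which a head enters the neighbouring cell in direction `d` of a cell `c`. -/
def headFrom (M : TM0.Machine Γ Λ) (d : Dir) (c : Γ × Option Λ) : Option Λ :=
  c.2.bind fun q => match M q c.1 with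
    | some (q', .move d') => if d' = d then some q' else none
    | _ => none

/-- The local rule of the cellular automaton simulating `M`. A cell holds a tape symbol and the
machine state if the head is there. -/
def localRule (M : TM0.Machine Γ Λ) (a b z : Γ × Option Λ) : Option (Γ × Option Λ) :=
  match b.2 with
  | some q => (M q b.1).map fun r => match r with
    | (_, .move _) => (b.1, none)
    | (q', .write g) => (g, some q')
  | none => some (b.1, (headFrom M .right a).orElse fun _ => headFrom M .left z)

/-- A step of `M`, keeping track of the position of the head; halting configurations stay. -/
def posStep (M : TM0.Machine Γ Λ) (c : TM0.Cfg Γ Λ × ℤ) : TM0.Cfg Γ Λ × ℤ :=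
  match M c.1.q c.1.Tape.head with
  | none => c
  | some (q', .move .left) => (⟨q', c.1.Tape.move .left⟩, c.2 - 1)
  | some (q', .move .right) => (⟨q', c.1.Tape.move .right⟩, c.2 + 1)
  | some (q', .write g) => (⟨q', c.1.Tape.write g⟩, c.2)

/-- The content of the cell at position `i`. -/
def cellAt (c : TM0.Cfg Γ Λ × ℤ) (i : ℤ) : Γ × Option Λ :=
  (c.1.Tape.nth (i - c.2), if i = c.2 then some c.1.q else none)

theorem step_eq_some_posStep {M : TM0.Machine Γ Λ} {c : TM0.Cfg Γ Λ × ℤ}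
    (h : TM0.step M c.1 ≠ none) : TM0.step M c.1 = some (posStep M c).1 := by
  obtain ⟨⟨q, T⟩, p⟩ := c
  simp only [TM0.step, posStep] at h ⊢
  rcases hM : M q T.head with _ | ⟨q', ⟨_ | _⟩ | g⟩ <;> simp_all

theorem posStep_of_step_eq_none {M : TM0.Machine Γ Λ} {c : TM0.Cfg Γ Λ × ℤ}
    (h : TM0.step M c.1 = none) : posStep M c = c := by
  obtain ⟨⟨q, T⟩, p⟩ := c
  simp only [TM0.step, posStep] at h ⊢
  rcases hM : M q T.head with _ | ⟨q', ⟨_ | _⟩ | g⟩ <;> simp_all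

theorem localRule_of_step_ne_none {M : TM0.Machine Γ Λ} {c : TM0.Cfg Γ Λ × ℤ}
    (h : TM0.step M c.1 ≠ none) (i : ℤ) :
    localRule M (cellAt c (i - 1)) (cellAt c i) (cellAt c (i + 1)) =
      some (cellAt (posStep M c) i) := by
  obtain ⟨⟨q, T⟩, p⟩ := c
  obtain ⟨j, rfl⟩ : ∃ j, i = p + j := ⟨i - p, by ring⟩
  simp only [TM0.step, posStep] at h ⊢
  have e1 : p + j - 1 - p = j - 1 := by ring
  have e2 : p + j + 1 - p = j + 1 := by ring
  have e3 : p + j - 1 = p ↔ j = 1 := by omega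
  have e4 : p + j + 1 = p ↔ j = -1 := by omega
  have e5 : p + j - (p - 1) = j + 1 := by ring
  have e6 : p + j - (p + 1) = j - 1 := by ring
  have e7 : p + j = p - 1 ↔ j = -1 := by omega
  have e8 : p + j = p + 1 ↔ j = 1 := by omega
  rcases hM : M q T.head with _ | ⟨q', ⟨_ | _⟩ | g⟩
  · simp [hM] at h
  all_goals
    simp only [cellAt, localRule, headFrom, Tape.move_left_nth, Tape.move_right_nth,
      Tape.write_nth, e1, e2, e3, e4, e5, e6, e7, e8, add_sub_cancel_left, add_eq_left,
      sub_add_cancel, add_sub_cancel_right]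
    by_cases h0 : j = 0
    · subst h0; simp [hM]
    by_cases h1 : j = 1
    · subst h1; simp [hM]
    by_cases h2 : j = -1
    · subst h2; simp [hM]
    simp [h0, h1, h2]

theorem localRule_of_step_eq_none {M : TM0.Machine Γ Λ} {c : TM0.Cfg Γ Λ × ℤ}
    (h : TM0.step M c.1 = none) (a z : Γ × Option Λ) :
    localRule M a (cellAt c c.2) z = none := by
  obtain ⟨⟨q, T⟩, p⟩ := c
  simp only [TM0.step, Option.map_eq_none_iff] at h
  simp [localRule, cellAt, h]

/-- The run of `M` on the input `l`, with the position of the head. -/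
def run (M : TM0.Machine Γ Λ) (l : List Γ) (t : ℕ) : TM0.Cfg Γ Λ × ℤ :=
  (posStep M)^[t] (TM0.init l, 0)

theorem run_succ (M : TM0.Machine Γ Λ) (l : List Γ) (t : ℕ) :
    run M l (t + 1) = posStep M (run M l t) :=
  Function.iterate_succ_apply' _ _ _

theorem eval_dom_iff_run (M : TM0.Machine Γ Λ) (l : List Γ) :
    (TM0.eval M l).Dom ↔ ∃ t, TM0.step M (run M l t).1 = none := by
  change (StateTransition.eval (TM0.step M) (TM0.init l)).Dom ↔ _
  rw [Part.dom_iff_mem]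
  simp only [StateTransition.mem_eval]
  constructor
  · rintro ⟨c, hr, hc⟩
    suffices ∃ t, (run M l t).1 = c by
      obtain ⟨t, rfl⟩ := this
      exact ⟨t, hc⟩
    clear hc
    induction hr with
    | refl => exact ⟨0, rfl⟩
    | tail _ hs ih =>
      obtain ⟨t, rfl⟩ := ih
      rw [Option.mem_def] at hs
      refine ⟨t + 1, ?_⟩
      rw [step_eq_some_posStep (by simp [hs]), Option.some_inj] at hs
      rw [run_succ, hs]
  · rintro ⟨t, ht⟩
    refine ⟨_, ?_, ht⟩
    clear ht
    induction t with
    | zero => exact .refl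
    | succ t ih =>
      rw [run_succ]
      by_cases h : TM0.step M (run M l t).1 = none
      · rwa [posStep_of_step_eq_none h]
      · exact ih.tail (step_eq_some_posStep h)

theorem run_mem_supports {M : TM0.Machine Γ Λ} {S : Set Λ} (hS : TM0.Supports M S) (l : List Γ)
    (t : ℕ) : (run M l t).1.q ∈ S := by
  induction t with
  | zero => exact hS.1
  | succ t ih =>
    rw [run_succ]
    by_cases h : TM0.step M (run M l t).1 = none
    · rwa [posStep_of_step_eq_none h]
    · exact TM0.step_supports M hS (step_eq_some_posStep h) ih

theorem neg_le_run_pos (M : TM0.Machine Γ Λ) (l : List Γ) (t : ℕ) :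
    -(t : ℤ) ≤ (run M l t).2 := by
  induction t with
  | zero => rfl
  | succ t ih =>
    rw [run_succ, posStep]
    split <;> push_cast <;> omega

theorem run_nth_eq_default (M : TM0.Machine Γ Λ) (l : List Γ) (t : ℕ) :
    ∀ i < -(t : ℤ), (run M l t).1.Tape.nth (i - (run M l t).2) = default := by
  induction t with
  | zero =>
    intro i hi
    obtain ⟨n, rfl⟩ : ∃ n : ℕ, i = Int.negSucc n := ⟨(-i - 1).toNat, by omega⟩
    change (Tape.mk₁ l).nth (Int.negSucc n - 0) = _
    rw [sub_zero]
    change (ListBlank.mk []).nth n = _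
    simp
  | succ t ih =>
    intro i hi
    have hp := neg_le_run_pos M l t
    have hi' : i < -(t : ℤ) := by push_cast at hi; omega
    have := ih i hi'
    rw [run_succ, posStep]
    split
    · exact this
    · simp only [Tape.move_left_nth]
      rwa [sub_sub, sub_add_cancel]
    · simp only [Tape.move_right_nth]
      rwa [sub_add_eq_sub_sub, sub_add_cancel]
    · simp only [Tape.write_nth]
      rwa [if_neg (by omega)]

theorem exists_tiles_of_machine [Finite Γ] {M : TM0.Machine Γ Λ} {S : Set Λ} (hfin : S.Finite)
    (hS : TM0.Supports M S) (a₀ a₁ a₂ : Γ) :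
    ∃ P : ℕ → List Tile, Primrec P ∧ ∀ m,
      ((TM0.eval M (a₀ :: a₁ :: List.replicate m a₂)).Dom → ∃ N, ¬ TilesSquare (P m) N) ∧
      (¬ (TM0.eval M (a₀ :: a₁ :: List.replicate m a₂)).Dom → TilesQuadrant (P m)) := by
  have hK : ((Set.univ : Set Γ) ×ˢ (insert none (some '' S))).Finite :=
    Set.finite_univ.prod ((hfin.image some).insert none)
  obtain ⟨P, hP, key⟩ := exists_tiles_of_automaton hK (localRule M) (default, none)
    (w := fun i => if i = 0 then (a₀, some default) else if i = 1 then (a₁, none) else (a₂, none))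
    (fun i => by simp)
  refine ⟨fun m => P (m + 2), hP.comp (Primrec.nat_add.comp Primrec.id (Primrec.const 2)),
    fun m => ?_⟩
  set l := a₀ :: a₁ :: List.replicate m a₂ with hl
  have hout (t : ℕ) (i : ℤ) (hi : i < -(t : ℤ)) : cellAt (run M l t) i = (default, none) := by
    have := neg_le_run_pos M l t
    rw [cellAt, run_nth_eq_default M l t i hi, if_neg (by omega)]
  obtain ⟨hpos, hneg⟩ := key (m + 2) (fun t x => cellAt (run M l t) ((x : ℤ) - 2 - t))
    (fun t x => by
      refine ⟨trivial, ?_⟩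
      simp only [cellAt]
      split
      · exact .inr ⟨_, run_mem_supports hS l t, rfl⟩
      · exact .inl rfl)
    (fun t => hout t _ (by push_cast; omega)) (fun t => hout t _ (by push_cast; omega))
    (fun x => by
      have hx : ((x + 2 : ℕ) : ℤ) - 2 - (0 : ℕ) = x := by push_cast; ring
      have hn : (run M l 0).1.Tape.nth ((x : ℤ) - 0) = l.getI x := by
        rw [sub_zero]
        exact Tape.mk'_nth_nat _ _ _
      simp only [hx]
      change ((run M l 0).1.Tape.nth ((x : ℤ) - 0), if (x : ℤ) = 0 then some default else none) = _
      rw [hn, hl]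
      rcases x with _ | _ | x
      · simp
      · simp
      · rw [if_neg (by push_cast; omega)]
        by_cases hxm : x < m <;> simp [List.getI, hxm])
  have hrule (t : ℕ) (h : TM0.step M (run M l t).1 ≠ none) (x : ℕ) :
      localRule M (cellAt (run M l t) ((x : ℤ) - 2 - t))
        (cellAt (run M l t) (((x + 1 : ℕ) : ℤ) - 2 - t))
        (cellAt (run M l t) (((x + 2 : ℕ) : ℤ) - 2 - t)) =
      some (cellAt (run M l (t + 1)) (((x + 2 : ℕ) : ℤ) - 2 - (t + 1 : ℕ))) := by
    rw [run_succ]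
    convert localRule_of_step_ne_none h ((x : ℤ) - 1 - t) using 3 <;> push_cast <;> ring
  rw [eval_dom_iff_run]
  constructor
  · intro h
    classical
    obtain ⟨T, hT, hmin⟩ : ∃ T, TM0.step M (run M l T).1 = none ∧
        ∀ t < T, TM0.step M (run M l t).1 ≠ none :=
      ⟨Nat.find h, Nat.find_spec h, fun t ht => Nat.find_min h ht⟩
    refine hneg T (fun t ht x => hrule t (hmin t ht) x) ?_
    have hp := neg_le_run_pos M l T
    refine ⟨((run M l T).2 + T + 1).toNat, ?_⟩
    convert localRule_of_step_eq_none hT _ _ using 2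
    congr 1
    push_cast
    omega
  · intro h
    push Not at h
    exact hpos fun t x => hrule t (h t) x

end TuringMachine

section Undecidability

open Turing

theorem exists_tiles_of_stackMachine {K : Type*} [DecidableEq K] [Finite K] {Γ : K → Type*}
    [∀ k, Finite (Γ k)] {Λ σ : Type*} [Inhabited Λ] [Inhabited σ] [Finite σ]
    {M : Λ → TM2.Stmt Γ Λ σ} {S : Finset Λ} (hS : TM2.Supports M S) (k : K) (a b c : Γ k) :
    ∃ P : ℕ → List Tile, Primrec P ∧ ∀ m,
      ((TM2.eval M k (List.replicate m c ++ [b, a])).Dom → ∃ N, ¬ TilesSquare (P m) N) ∧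
      (¬ (TM2.eval M k (List.replicate m c ++ [b, a])).Dom → TilesQuadrant (P m)) := by
  classical
  have := Fintype.ofFinite σ
  have : Finite (TM2to1.Γ' K Γ) := inferInstanceAs (Finite (Bool × ∀ k, Option (Γ k)))
  have hsupp := TM1to0.tr_supports (TM2to1.tr M) (TM2to1.tr_supports M hS)
  let letter (s : Bool) (a : Γ k) : TM2to1.Γ' K Γ :=
    (s, Function.update (fun _ => none) k (some a))
  obtain ⟨P, hP, key⟩ := exists_tiles_of_machine (Finset.finite_toSet _) hsupp
    (letter true a) (letter false b) (letter false c)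
  refine ⟨P, hP, fun m => ?_⟩
  have hinit : TM2to1.trInit k (List.replicate m c ++ [b, a]) =
      letter true a :: letter false b :: List.replicate m (letter false c) := by
    have hrev : (List.replicate m c ++ [b, a]).reverse = a :: b :: List.replicate m c := by simp
    rw [TM2to1.trInit, hrev, ← List.map_replicate]
    rfl
  rw [← TM2to1.tr_eval_dom, hinit, ← TM1to0.tr_eval]
  exact key m

theorem trList_two_pow (m : ℕ) : PartrecToTM2.trList [2 ^ m] =
    List.replicate m .bit0 ++ [.bit1, .cons] := by
  have h (m : ℕ) : ((PosNum.bit0^[m] 1 : PosNum) : ℕ) = 2 ^ m ∧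
      PartrecToTM2.trPosNum (PosNum.bit0^[m] 1) = List.replicate m .bit0 ++ [.bit1] := by
    induction m with
    | zero => exact ⟨rfl, rfl⟩
    | succ m ih =>
      rw [Function.iterate_succ_apply']
      refine ⟨?_, ?_⟩
      · rw [PosNum.cast_bit0, ih.1, pow_succ]; ring
      · rw [PartrecToTM2.trPosNum, ih.2, List.replicate_succ, List.cons_append]
  have h' : PartrecToTM2.trNat (2 ^ m) = List.replicate m .bit0 ++ [.bit1] := by
    rw [PartrecToTM2.trNat, ← (h m).1, PosNum.of_to_nat]
    exact (h m).2
  simp [PartrecToTM2.trList, h']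

theorem primrec_two_pow : Primrec fun k : ℕ => 2 ^ k :=
  (Primrec.nat_rec₁ 1 (f := fun _ p => 2 * p)
    (Primrec.nat_mul.comp (Primrec.const 2) Primrec.snd).to₂).of_eq fun k => by
    induction k with
    | zero => rfl
    | succ k ih =>
      rw [pow_succ, mul_comm, ← ih]

theorem partrec_eval_log : Partrec fun x : ℕ =>
    (Nat.rfind fun k => Part.some (decide (2 ^ k = x))).bind fun k =>
      (Denumerable.ofNat Nat.Partrec.Code k).eval 0 := by
  have hpow : PrimrecPred fun q : ℕ × ℕ => 2 ^ q.2 = q.1 :=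
    Primrec.eq.comp (primrec_two_pow.comp Primrec.snd) Primrec.fst
  have hdec : Computable₂ fun (x k : ℕ) => decide (2 ^ k = x) := hpow.decide.to_comp
  have hdec' := Partrec.rfind hdec.partrec₂
  have h := Nat.Partrec.Code.eval_part.comp
      ((Computable.ofNat Nat.Partrec.Code).comp (Computable.snd (α := ℕ) (β := ℕ)))
        (Computable.const 0)
  exact hdec'.bind h.to₂

theorem exists_code_eval_two_pow : ∃ c : ToPartrec.Code, ∀ p : Nat.Partrec.Code,
    (c.eval [2 ^ Encodable.encode p]).Dom ↔ (p.eval 0).Dom := by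
  obtain ⟨c, hc⟩ := ToPartrec.Code.exists_code (Nat.Partrec'.part_iff₁.2 partrec_eval_log)
  refine ⟨c, fun p => ?_⟩
  have hfind : (Nat.rfind fun k => Part.some (decide (2 ^ k = 2 ^ Encodable.encode p))) =
      Part.some (Encodable.encode p) := by
    refine Part.eq_some_iff.2 (Nat.mem_rfind.2 ⟨by simp, fun {k} hk => ?_⟩)
    simpa using hk.ne
  have hv := hc (List.Vector.cons (2 ^ Encodable.encode p) List.Vector.nil)
  rw [List.Vector.head_cons, hfind, Part.bind_some, Denumerable.ofNat_encode] at hv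
  change c.eval [2 ^ Encodable.encode p] = _ at hv
  rw [hv]
  rfl

theorem exists_tiles_of_code : ∃ P : ℕ → List Tile, Primrec P ∧ ∀ p : Nat.Partrec.Code,
    ((p.eval 0).Dom → ∃ N, ¬ TilesSquare (P (Encodable.encode p)) N) ∧
    (¬ (p.eval 0).Dom → TilesQuadrant (P (Encodable.encode p))) := by
  obtain ⟨c, hc⟩ := exists_code_eval_two_pow
  let _ : Inhabited PartrecToTM2.Λ' := ⟨PartrecToTM2.trNormal c .halt⟩
  have : Finite PartrecToTM2.K' :=
    Finite.of_injective (β := Bool × Bool) (PartrecToTM2.K'.rec (true, true) (true, false)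
      (false, true) (false, false)) fun a b => by cases a <;> cases b <;> simp
  obtain ⟨P, hP, key⟩ := exists_tiles_of_stackMachine
    (PartrecToTM2.tr_supports c .halt) PartrecToTM2.K'.main .cons .bit1 .bit0
  refine ⟨P, hP, fun p => ?_⟩
  have hinit : TM2.init PartrecToTM2.K'.main (PartrecToTM2.trList [2 ^ Encodable.encode p]) =
      PartrecToTM2.init c [2 ^ Encodable.encode p] := by
    rw [TM2.init, PartrecToTM2.init]
    congr 1
    funext k
    cases k <;> rfl
  have heval : (TM2.eval PartrecToTM2.tr PartrecToTM2.K'.main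
      (PartrecToTM2.trList [2 ^ Encodable.encode p])).Dom ↔ (p.eval 0).Dom := by
    rw [← hc]
    change (StateTransition.eval _ _).Dom ↔ _
    rw [hinit, PartrecToTM2.tr_eval]
    rfl
  rw [← heval, trList_two_pow]
  exact key _

end Undecidability

/-- Berger's theorem: the domino problem — given a finite set `T` of tile types, decide
whether the plane `ℕ × ℕ` admits a `T`-tiling — is undecidable. -/
theorem domino_problem_undecidable :
    ¬ ComputablePred (fun T : Finset Tile =>
        ∃ f : ℕ × ℕ → {t : Tile // t ∈ T}, IsPlaneTiling T f) := by
  intro h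
  obtain ⟨P, hP, key⟩ := exists_tiles_of_code
  have hcomp : Computable fun p : Nat.Partrec.Code =>
      (dominoList (P (Encodable.encode p))).toFinset :=
    computable_toFinset.comp (primrec_dominoList.comp (hP.comp Primrec.encode)).to_comp
  have hpred : ComputablePred fun p : Nat.Partrec.Code =>
      ∃ f, IsPlaneTiling (dominoList (P (Encodable.encode p))).toFinset f := by
    obtain ⟨_, h⟩ := h
    exact ⟨_, h.comp hcomp⟩
  refine ComputablePred.halting_problem 0 (hpred.not.of_eq fun p => ?_)
  constructor
  · intro hn
    by_contra hp
    exact hn ((key p).2 hp).exists_tiling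
  · rintro hp ⟨f, hf⟩
    obtain ⟨N, hN⟩ := (key p).1 hp
    exact hN (tilesSquare_of_tiling hf N)
end

section
/- Church's theorem (satisfiability form): let L be the first-order language with countably many unary relation symbols P₀, P₁, P₂, … and two binary relation symbols H and V. The set of L-sentences that are satisfiable (have a model with nonempty domain) is not computable: there is no algorithm that, given an L-sentence, decides whether it has a model. -/
open FirstOrder FirstOrder.Language

/-- The first-order language with countably many unary relation symbols `P₀, P₁, P₂, …`
and two binary relation symbols `H` and `V`. -/
def churchLang : Language :=
  ⟨fun _ => Empty, fun k =>
    match k with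
    | 1 => ℕ
    | 2 => Fin 2
    | _ => Empty⟩

instance (k : ℕ) : Encodable (churchLang.Functions k) :=
  inferInstanceAs (Encodable Empty)

instance : ∀ k : ℕ, Encodable (churchLang.Relations k)
  | 0 => inferInstanceAs (Encodable Empty)
  | 1 => inferInstanceAs (Encodable ℕ)
  | 2 => inferInstanceAs (Encodable (Fin 2))
  | (_ + 3) => inferInstanceAs (Encodable Empty)

instance churchGammaEncodable :
    Encodable (BoundedFormula.encoding (L := churchLang) (α := Empty)).Γ :=
  inferInstanceAs
    (Encodable ((Σ k, churchLang.Term (Empty ⊕ Fin k)) ⊕ ((Σ m, churchLang.Relations m) ⊕ ℕ)))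

/-- Sentences of the language are effectively encodable. -/
instance churchSigmaEncodable : Encodable (Σ m, churchLang.BoundedFormula Empty m) :=
  Encodable.ofLeftInjection BoundedFormula.encoding.encode BoundedFormula.encoding.decode
    BoundedFormula.encoding.decode_encode

instance churchSentenceEncodable : Encodable churchLang.Sentence :=
  Encodable.ofLeftInjection
    (fun φ => (⟨0, φ⟩ : Σ m, churchLang.BoundedFormula Empty m))
    (fun p =>
      match p with
      | ⟨0, φ⟩ => some φ
      | _ => none)
    (fun _ => rfl)

/-- A sentence is satisfiable iff it is true in some structure with nonempty domain. -/
def SatSentence (φ : churchLang.Sentence) : Prop :=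
  ∃ (M : Type) (S : churchLang.Structure M), Nonempty M ∧
    @FirstOrder.Language.Sentence.Realize churchLang M S φ

open Turing.ToPartrec

namespace ChurchUndecidable

/-! ### Formulas -/

/-- The unary relation symbol `P k`. -/
def predSymb (k : ℕ) : churchLang.Relations 1 := k

/-- The relation symbol `H`, stating that `y` is the left component of `x`. -/
def leftSymb : churchLang.Relations 2 := (0 : Fin 2)

/-- The relation symbol `V`, stating that `y` is the right component of `x`. -/
def rightSymb : churchLang.Relations 2 := (1 : Fin 2)

/-- An injective numbering of the codes of partial recursive functions on lists. -/
def codeIndex : Code → ℕ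
  | .zero' => 0
  | .succ => 1
  | .tail => 2
  | .cons f g => 4 * Nat.pair (codeIndex f) (codeIndex g) + 3
  | .comp f g => 4 * Nat.pair (codeIndex f) (codeIndex g) + 4
  | .case f g => 4 * Nat.pair (codeIndex f) (codeIndex g) + 5
  | .fix f => 4 * codeIndex f + 6

theorem codeIndex_injective : Function.Injective codeIndex := by
  intro c
  induction c with
  | zero' | succ | tail => intro d h; cases d <;> simp only [codeIndex] at h <;> first | rfl | omega
  | cons f g hf hg | comp f g hf hg | case f g hf hg =>
    intro d h
    cases d <;> simp only [codeIndex] at h <;> try omega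
    rename_i f' g'
    obtain ⟨h₁, h₂⟩ := Nat.pair_eq_pair.1
      (show Nat.pair (codeIndex f) (codeIndex g) = Nat.pair (codeIndex f') (codeIndex g') by omega)
    rw [hf h₁, hg h₂]
  | fix f hf =>
    intro d h
    cases d <;> simp only [codeIndex] at h <;> try omega
    rename_i f'
    rw [hf (show codeIndex f = codeIndex f' by omega)]

section Formulas

variable {n : ℕ}

/-- The atomic formula `P k (x i)`. -/
def predF (k : ℕ) (i : Fin n) : churchLang.BoundedFormula Empty n :=
  (predSymb k).boundedFormula₁ &i

/-- `x i` represents the empty tree. -/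
def nilF (i : Fin n) : churchLang.BoundedFormula Empty n := predF 0 i

/-- `x i` represents the number `k`. -/
def numeralF (k : ℕ) (i : Fin n) : churchLang.BoundedFormula Empty n := predF (2 * k + 1) i

/-- The left component of `x i` is `x j`. -/
def leftF (i j : Fin n) : churchLang.BoundedFormula Empty n := leftSymb.boundedFormula₂ &i &j

/-- The right component of `x i` is `x j`. -/
def rightF (i j : Fin n) : churchLang.BoundedFormula Empty n := rightSymb.boundedFormula₂ &i &j

/-- `x i` is a node with components `x j` and `x k`. -/
def nodeF (i j k : Fin n) : churchLang.BoundedFormula Empty n :=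
  ∼(nilF i) ⊓ (leftF i j ⊓ rightF i k)

/-- The code `c` maps `x i` to `x j`. -/
def evalF (c : Code) (i j : Fin n) : churchLang.BoundedFormula Empty n :=
  ∃' (nodeF (Fin.last n) i.castSucc j.castSucc ⊓ predF (2 * codeIndex c + 2) (Fin.last n))

end Formulas

/-- There is an empty tree, both of whose components are itself; any two elements are the
components of some node; and the empty tree represents zero. -/
def treeAxioms : churchLang.Sentence :=
  (∃' (nilF (0 : Fin 1) ⊓ (leftF 0 0 ⊓ rightF 0 0))) ⊓
    ((∃' nodeF (2 : Fin 3) 0 1).alls ⊓ (nilF (0 : Fin 1) ⟹ numeralF 0 0).alls)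

/-- The recursion equations for the graph of `c`, as Horn clauses. -/
def evalAxioms : Code → churchLang.Sentence
  | .zero' => (nilF (2 : Fin 3) ⟹ nodeF 1 2 0 ⟹ evalF .zero' 0 1).alls
  | .succ => (leftF (0 : Fin 5) 1 ⟹ nilF 2 ⟹ nodeF 3 2 1 ⟹ nodeF 4 3 2 ⟹ evalF .succ 0 4).alls
  | .tail => (rightF (0 : Fin 2) 1 ⟹ evalF .tail 0 1).alls
  | .cons f g => evalAxioms f ⊓ (evalAxioms g ⊓
      (evalF f (0 : Fin 5) 1 ⟹ leftF 1 2 ⟹ evalF g 0 3 ⟹ nodeF 4 2 3 ⟹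
        evalF (.cons f g) 0 4).alls)
  | .comp f g => evalAxioms f ⊓ (evalAxioms g ⊓
      (evalF g (0 : Fin 3) 1 ⟹ evalF f 1 2 ⟹ evalF (.comp f g) 0 2).alls)
  | .case f g => evalAxioms f ⊓ (evalAxioms g ⊓
      ((leftF (0 : Fin 4) 1 ⟹ nilF 1 ⟹ rightF 0 2 ⟹ evalF f 2 3 ⟹
          evalF (.case f g) 0 3).alls ⊓
        (leftF (0 : Fin 6) 1 ⟹ ∼(nilF 1) ⟹ rightF 1 2 ⟹ rightF 0 3 ⟹ nodeF 4 2 3 ⟹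
          evalF g 4 5 ⟹ evalF (.case f g) 0 5).alls))
  | .fix f => evalAxioms f ⊓
      ((evalF f (0 : Fin 4) 1 ⟹ leftF 1 2 ⟹ nilF 2 ⟹ rightF 1 3 ⟹ evalF (.fix f) 0 3).alls ⊓
        (evalF f (0 : Fin 5) 1 ⟹ leftF 1 2 ⟹ ∼(nilF 2) ⟹ rightF 1 3 ⟹ evalF (.fix f) 3 4 ⟹
          evalF (.fix f) 0 4).alls)

/-- Successors of representatives of `k` represent `k + 1`. -/
def succAxiom (k : ℕ) : churchLang.Sentence :=
  (nilF (0 : Fin 3) ⟹ nodeF 1 0 2 ⟹ numeralF k 2 ⟹ numeralF (k + 1) 1).alls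

/-- The code `c` has no value at the singleton list `[k]`. -/
def divergenceAxiom (c : Code) (k : ℕ) : churchLang.Sentence :=
  (nilF (0 : Fin 4) ⟹ numeralF k 1 ⟹ nodeF 2 1 0 ⟹ ∼(evalF c 2 3)).alls

/-- The axioms for trees, for `c` and for the numerals below `k` are inconsistent. -/
def refutation (c : Code) : ℕ → churchLang.Sentence
  | 0 => ∼(treeAxioms ⊓ evalAxioms c)
  | k + 1 => succAxiom k ⟹ refutation c k

/-- A sentence that is satisfiable iff `c` has no value at `[k]`. -/
def divergenceSentence (c : Code) (k : ℕ) : churchLang.Sentence :=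
  ∼(divergenceAxiom c k ⟹ refutation c k)

/-! ### Semantics -/

section Semantics

variable {M : Type} [churchLang.Structure M]

/-- The interpretation of the `k`-th unary relation symbol. -/
def Pred (k : ℕ) (x : M) : Prop := Structure.RelMap (predSymb k) ![x]

/-- The interpretation of `H`. -/
def Left (x y : M) : Prop := Structure.RelMap leftSymb ![x, y]

/-- The interpretation of `V`. -/
def Right (x y : M) : Prop := Structure.RelMap rightSymb ![x, y]

/-- `p` is a node with components `x` and `y`. -/
def Node (p x y : M) : Prop := ¬Pred 0 p ∧ Left p x ∧ Right p y

/-- The interpretation of the graph of `c`. -/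
def Eval (c : Code) (x y : M) : Prop := ∃ p : M, Node p x y ∧ Pred (2 * codeIndex c + 2) p

variable {n : ℕ} {v : Empty → M} {xs : Fin n → M}

@[simp]
theorem realize_predF {k : ℕ} {i : Fin n} : (predF k i).Realize v xs ↔ Pred k (xs i) := by
  simp [predF, Pred]

@[simp]
theorem realize_nilF {i : Fin n} : (nilF i).Realize v xs ↔ Pred 0 (xs i) := realize_predF

@[simp]
theorem realize_numeralF {k : ℕ} {i : Fin n} :
    (numeralF k i).Realize v xs ↔ Pred (2 * k + 1) (xs i) := realize_predF

@[simp]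
theorem realize_leftF {i j : Fin n} : (leftF i j).Realize v xs ↔ Left (xs i) (xs j) := by
  simp [leftF, Left]

@[simp]
theorem realize_rightF {i j : Fin n} : (rightF i j).Realize v xs ↔ Right (xs i) (xs j) := by
  simp [rightF, Right]

@[simp]
theorem realize_nodeF {i j k : Fin n} :
    (nodeF i j k).Realize v xs ↔ Node (xs i) (xs j) (xs k) := by
  simp [nodeF, Node]

@[simp]
theorem realize_evalF {c : Code} {i j : Fin n} :
    (evalF c i j).Realize v xs ↔ Eval c (xs i) (xs j) := by
  simp [evalF, Eval]

theorem realize_treeAxioms : M ⊨ treeAxioms ↔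
    (∃ z : M, Pred 0 z ∧ Left z z ∧ Right z z) ∧ (∀ x y : M, ∃ p, Node p x y) ∧
      ∀ z : M, Pred 0 z → Pred 1 z := by
  simp only [treeAxioms, Sentence.Realize, Formula.realize_inf, BoundedFormula.realize_alls,
    BoundedFormula.realize_imp, BoundedFormula.realize_ex, realize_nodeF, realize_nilF,
    realize_numeralF]
  refine and_congr ?_ (and_congr ?_ ?_)
  · simp [Formula.Realize, Fin.snoc]
  · exact ⟨fun h x y => h ![x, y], fun h xs => h _ _⟩
  · exact ⟨fun h z => h ![z], fun h xs => h _⟩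

theorem realize_succAxiom {k : ℕ} : M ⊨ succAxiom k ↔
    ∀ z s x : M, Pred 0 z → Node s z x → Pred (2 * k + 1) x → Pred (2 * (k + 1) + 1) s := by
  simp only [Sentence.Realize, succAxiom, BoundedFormula.realize_alls,
    BoundedFormula.realize_imp, realize_nilF, realize_nodeF, realize_numeralF]
  exact ⟨fun h z s x => h ![z, s, x], fun h xs => h _ _ _⟩

theorem realize_divergenceAxiom {c : Code} {k : ℕ} : M ⊨ divergenceAxiom c k ↔
    ∀ z x l y : M, Pred 0 z → Pred (2 * k + 1) x → Node l x z → ¬Eval c l y := by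
  simp only [Sentence.Realize, divergenceAxiom, BoundedFormula.realize_alls,
    BoundedFormula.realize_imp, BoundedFormula.realize_not, realize_nilF, realize_nodeF,
    realize_numeralF, realize_evalF]
  exact ⟨fun h z x l y => h ![z, x, l, y], fun h xs => h _ _ _ _⟩

theorem realize_refutation {c : Code} {k : ℕ} : M ⊨ refutation c k ↔
    ((∀ i < k, M ⊨ succAxiom i) → M ⊨ treeAxioms → ¬M ⊨ evalAxioms c) := by
  induction k with
  | zero => simp [refutation, Sentence.Realize, Formula.Realize]
  | succ k ih =>
    rw [refutation, Sentence.Realize, Formula.Realize, BoundedFormula.realize_imp]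
    change (M ⊨ succAxiom k → M ⊨ refutation c k) ↔ _
    rw [ih]
    simp only [Nat.forall_lt_succ_right]
    tauto

theorem realize_divergenceSentence {c : Code} {k : ℕ} : M ⊨ divergenceSentence c k ↔
    M ⊨ divergenceAxiom c k ∧ (∀ i < k, M ⊨ succAxiom i) ∧ M ⊨ treeAxioms ∧ M ⊨ evalAxioms c := by
  rw [divergenceSentence, Sentence.Realize, Formula.Realize, BoundedFormula.realize_not,
    BoundedFormula.realize_imp]
  change ¬(M ⊨ divergenceAxiom c k → M ⊨ refutation c k) ↔ _
  simp only [realize_refutation, Classical.not_imp, not_not]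

/-- The semantic content of `evalAxioms`. -/
def EvalClauses (M : Type) [churchLang.Structure M] : Code → Prop
  | .zero' => ∀ x y z : M, Pred 0 z → Node y z x → Eval .zero' x y
  | .succ => ∀ x h z s y : M, Left x h → Pred 0 z → Node s z h → Node y s z → Eval .succ x y
  | .tail => ∀ x y : M, Right x y → Eval .tail x y
  | .cons f g => EvalClauses M f ∧ EvalClauses M g ∧
      ∀ x y h w u : M, Eval f x y → Left y h → Eval g x w → Node u h w → Eval (.cons f g) x u
  | .comp f g => EvalClauses M f ∧ EvalClauses M g ∧
      ∀ x y w : M, Eval g x y → Eval f y w → Eval (.comp f g) x w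
  | .case f g => EvalClauses M f ∧ EvalClauses M g ∧
      (∀ x h t w : M, Left x h → Pred 0 h → Right x t → Eval f t w → Eval (.case f g) x w) ∧
      ∀ x h k t u w : M, Left x h → ¬Pred 0 h → Right h k → Right x t → Node u k t →
        Eval g u w → Eval (.case f g) x w
  | .fix f => EvalClauses M f ∧
      (∀ x y h t : M, Eval f x y → Left y h → Pred 0 h → Right y t → Eval (.fix f) x t) ∧
      ∀ x y h t w : M, Eval f x y → Left y h → ¬Pred 0 h → Right y t → Eval (.fix f) t w →
        Eval (.fix f) x w

theorem realize_evalAxioms {c : Code} : M ⊨ evalAxioms c ↔ EvalClauses M c := by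
  induction c <;>
    simp only [Sentence.Realize, evalAxioms, EvalClauses, Formula.realize_inf,
      BoundedFormula.realize_alls, BoundedFormula.realize_imp, BoundedFormula.realize_not,
      realize_nilF, realize_nodeF, realize_leftF, realize_rightF, realize_evalF] at *
  case zero' => exact ⟨fun h x y z => h ![x, y, z], fun h xs => h _ _ _⟩
  case succ => exact ⟨fun h x k z s y => h ![x, k, z, s, y], fun h xs => h _ _ _ _ _⟩
  case tail => exact ⟨fun h x y => h ![x, y], fun h xs => h _ _⟩
  case cons hf hg =>
    refine and_congr hf (and_congr hg ?_)
    exact ⟨fun h x y k w u => h ![x, y, k, w, u], fun h xs => h _ _ _ _ _⟩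
  case comp hf hg =>
    refine and_congr hf (and_congr hg ?_)
    exact ⟨fun h x y w => h ![x, y, w], fun h xs => h _ _ _⟩
  case case hf hg =>
    refine and_congr hf (and_congr hg (and_congr ?_ ?_))
    · exact ⟨fun h x k t w => h ![x, k, t, w], fun h xs => h _ _ _ _⟩
    · exact ⟨fun h x k l t u w => h ![x, k, l, t, u, w], fun h xs => h _ _ _ _ _ _⟩
  case fix hf =>
    refine and_congr hf (and_congr ?_ ?_)
    · exact ⟨fun h x y k t => h ![x, y, k, t], fun h xs => h _ _ _ _⟩
    · exact ⟨fun h x y k t w => h ![x, y, k, t, w], fun h xs => h _ _ _ _ _⟩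

end Semantics

/-! ### The partial recursive functions in an arbitrary model -/

section Models

variable {M : Type} [churchLang.Structure M]

/-- The element of a model representing a number, built from a representative `z` of the empty
tree and a node constructor `p`. -/
def numRep (z : M) (p : M → M → M) : ℕ → M
  | 0 => z
  | k + 1 => p z (numRep z p k)

/-- The element of a model representing a list of numbers, built as in `numRep`. -/
def listRep (z : M) (p : M → M → M) : List ℕ → M
  | [] => z
  | k :: l => p (numRep z p k) (listRep z p l)

variable {z : M} {p : M → M → M}

theorem left_listRep (hl : Left z z) (hp : ∀ x y, Node (p x y) x y) (l : List ℕ) :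
    Left (listRep z p l) (numRep z p l.headI) := by
  cases l with
  | nil => exact hl
  | cons k l => exact (hp _ _).2.1

theorem right_listRep (hr : Right z z) (hp : ∀ x y, Node (p x y) x y) (l : List ℕ) :
    Right (listRep z p l) (listRep z p l.tail) := by
  cases l with
  | nil => exact hr
  | cons k l => exact (hp _ _).2.2

theorem pred_zero_numRep (hz : Pred 0 z) (hp : ∀ x y, Node (p x y) x y) (k : ℕ) :
    Pred 0 (numRep z p k) ↔ k = 0 := by
  cases k with
  | zero => simpa [numRep]
  | succ k => simpa [numRep] using (hp _ _).1

/-- In a model of the axioms, every value of `c` is recorded. -/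
theorem eval_listRep (hz : Pred 0 z) (hl : Left z z) (hr : Right z z)
    (hp : ∀ x y, Node (p x y) x y) {c : Code} (hc : EvalClauses M c) {v w : List ℕ}
    (h : w ∈ c.eval v) : Eval c (listRep z p v) (listRep z p w) := by
  have hL := left_listRep hl hp
  have hR := right_listRep hr hp
  have hZ := pred_zero_numRep hz hp
  induction c generalizing v w with
  | zero' =>
    obtain rfl : w = 0 :: v := by simpa using h
    exact hc _ _ _ hz (hp _ _)
  | succ =>
    obtain rfl : w = [v.headI.succ] := by simpa using h
    exact hc _ _ _ _ _ (hL v) hz (hp _ _) (hp _ _)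
  | tail =>
    obtain rfl : w = v.tail := by simpa using h
    exact hc _ _ (hR v)
  | cons f g hf hg =>
    obtain ⟨a, ha, b, hb, rfl⟩ : ∃ a ∈ f.eval v, ∃ b ∈ g.eval v, w = a.headI :: b := by
      simpa [Part.mem_bind_iff] using h
    exact hc.2.2 _ _ _ _ _ (hf hc.1 ha) (hL a) (hg hc.2.1 hb) (hp _ _)
  | comp f g hf hg =>
    rw [Code.comp_eval] at h
    obtain ⟨a, ha, hb⟩ := Part.mem_bind_iff.1 h
    exact hc.2.2 _ _ _ (hg hc.2.1 ha) (hf hc.1 hb)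
  | case f g hf hg =>
    rw [Code.case_eval] at h
    have hv := hL v
    cases hk : v.headI with
    | zero =>
      simp only [hk] at h hv
      exact hc.2.2.1 _ _ _ _ hv hz (hR v) (hf hc.1 h)
    | succ k =>
      simp only [hk] at h hv
      exact hc.2.2.2 _ _ _ _ _ _ hv (hp _ _).1 (hp _ _).2.2 (hR v) (hp _ _) (hg hc.2.1 h)
  | fix f hf =>
    rw [Code.fix_eval] at h
    refine PFun.fixInduction' (C := fun v => Eval (.fix f) (listRep z p v) (listRep z p w)) h ?_ ?_
    · intro v hv
      obtain ⟨a, ha, hb⟩ := (Part.mem_map_iff _).1 hv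
      split_ifs at hb with h0
      cases hb
      exact hc.2.1 _ _ _ _ (hf hc.1 ha) (hL a) ((hZ _).2 h0) (hR a)
    · intro v v' _ hv ih
      obtain ⟨a, ha, hb⟩ := (Part.mem_map_iff _).1 hv
      split_ifs at hb with h0
      cases hb
      exact hc.2.2 _ _ _ _ _ (hf hc.1 ha) (hL a) (fun h => h0 ((hZ _).1 h)) (hR a) ih

theorem not_dom_of_realize {c : Code} {k : ℕ} (h : M ⊨ divergenceSentence c k) :
    ¬(c.eval [k]).Dom := by
  obtain ⟨hd, hs, ht, hc⟩ := realize_divergenceSentence.1 h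
  obtain ⟨⟨z, hz, hl, hr⟩, hp, h0⟩ := realize_treeAxioms.1 ht
  choose p hp using hp
  have hnum : ∀ i ≤ k, Pred (2 * i + 1) (numRep z p i) := by
    intro i
    induction i with
    | zero => exact fun _ => h0 z hz
    | succ i ih =>
      exact fun hi => realize_succAxiom.1 (hs i hi) _ _ _ hz (hp _ _) (ih (by omega))
  intro hdom
  exact realize_divergenceAxiom.1 hd _ _ _ _ hz (hnum k le_rfl) (hp _ z)
    (eval_listRep hz hl hr hp (realize_evalAxioms.1 hc) (Part.get_mem hdom))

end Models

/-! ### The standard model of binary trees -/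

section Standard

/-- The number of nodes on the right spine. -/
def treeNum : BinaryTree Unit → ℕ
  | .nil => 0
  | .node _ _ t => treeNum t + 1

/-- The numbers represented by the left children of the nodes on the right spine. -/
def treeList : BinaryTree Unit → List ℕ
  | .nil => []
  | .node _ s t => treeNum s :: treeList t

theorem treeNum_left (t : BinaryTree Unit) : treeNum t.left = (treeList t).headI := by
  cases t <;> rfl

theorem treeList_right (t : BinaryTree Unit) : treeList t.right = (treeList t).tail := by
  cases t <;> rfl

theorem treeNum_right (t : BinaryTree Unit) : treeNum t.right = treeNum t - 1 := by
  cases t <;> rfl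

theorem treeNum_eq_zero {t : BinaryTree Unit} : treeNum t = 0 ↔ t = .nil := by
  cases t <;> simp [treeNum]

/-- The unary predicates of the standard model: emptiness, the numerals, and the graphs of the
codes. -/
def treePred (k : ℕ) (t : BinaryTree Unit) : Prop :=
  (k = 0 ∧ t = .nil) ∨ k = 2 * treeNum t + 1 ∨
    ∃ c : Code, k = 2 * codeIndex c + 2 ∧ treeList t.right ∈ c.eval (treeList t.left)

instance : churchLang.Structure (BinaryTree Unit) where
  funMap := fun f => nomatch (f : Empty)
  RelMap := fun {n} => match n with
    | 0 => fun r => nomatch (r : Empty)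
    | 1 => fun (r : ℕ) xs => treePred r (xs 0)
    | 2 => fun (r : Fin 2) xs => if r = 0 then (xs 0).left = xs 1 else (xs 0).right = xs 1
    | _ + 3 => fun r => nomatch (r : Empty)

variable {s t u : BinaryTree Unit}

theorem pred_iff {k : ℕ} : Pred k t ↔ treePred k t := Iff.rfl

theorem pred_zero_iff : Pred 0 t ↔ t = .nil := by
  simp [pred_iff, treePred]

theorem pred_numeral_iff {k : ℕ} : Pred (2 * k + 1) t ↔ treeNum t = k := by
  rw [pred_iff, treePred]
  constructor
  · rintro (⟨h, -⟩ | h | ⟨c, h, -⟩) <;> omega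
  · rintro rfl; simp

theorem left_iff : Left s t ↔ s.left = t := Iff.rfl

theorem right_iff : Right s t ↔ s.right = t := Iff.rfl

theorem node_iff : Node s t u ↔ s = .node () t u := by
  rw [Node, pred_zero_iff, left_iff, right_iff]
  cases s <;> simp [BinaryTree.left, BinaryTree.right]

theorem eval_iff {c : Code} : Eval c s t ↔ treeList t ∈ c.eval (treeList s) := by
  simp only [Eval, node_iff, exists_eq_left, pred_iff, treePred]
  constructor
  · rintro (⟨h, -⟩ | h | ⟨d, h, hd⟩)
    · omega
    · omega
    · rwa [codeIndex_injective (show codeIndex c = codeIndex d by omega)]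
  · exact fun h => .inr (.inr ⟨c, rfl, h⟩)

theorem evalClauses_tree (c : Code) : EvalClauses (BinaryTree Unit) c := by
  induction c <;>
    simp only [EvalClauses, eval_iff, node_iff, left_iff, right_iff, pred_zero_iff,
      ← treeNum_eq_zero] at *
  case zero' => rintro x _ z hz rfl; simp [treeList, hz]
  case succ =>
    rintro x _ z _ _ rfl hz rfl rfl
    simp only [treeNum_eq_zero] at hz
    subst hz
    rw [Code.succ_eval, treeList, treeNum, treeNum_left]
    exact Part.mem_some _
  case tail =>
    rintro x _ rfl
    rw [Code.tail_eval, treeList_right]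
    exact Part.mem_some _
  case cons f g hf hg =>
    refine ⟨hf, hg, ?_⟩
    rintro x y _ w _ hy rfl hw rfl
    simp only [Code.cons_eval, treeList, treeNum_left]
    exact Part.mem_bind hy (Part.mem_bind hw (Part.mem_some _))
  case comp f g hf hg =>
    refine ⟨hf, hg, fun x y w hy hw => ?_⟩
    rw [Code.comp_eval]
    exact Part.mem_bind hy hw
  case case f g hf hg =>
    refine ⟨hf, hg, ?_, ?_⟩
    · rintro x _ _ w rfl h0 rfl hw
      rw [treeNum_left] at h0
      simpa [Code.case_eval, h0, ← treeList_right] using hw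
    · rintro x _ _ _ _ w rfl h0 rfl rfl rfl hw
      rw [treeNum_left] at h0
      obtain ⟨k, hk⟩ := Nat.exists_eq_succ_of_ne_zero h0
      rw [treeList, treeNum_right, treeNum_left, treeList_right, hk] at hw
      simpa [Code.case_eval, hk] using hw
  case fix f hf =>
    refine ⟨hf, ?_, ?_⟩
    · rintro x y _ _ hy rfl h0 rfl
      rw [treeNum_left] at h0
      rw [Code.fix_eval, treeList_right]
      exact PFun.mem_fix_iff.2 (.inl <| (Part.mem_map_iff _).2 ⟨_, hy, by simp [h0]⟩)
    · rintro x y _ _ w hy rfl h0 rfl hw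
      rw [treeNum_left] at h0
      rw [treeList_right] at hw
      rw [Code.fix_eval] at hw ⊢
      exact PFun.mem_fix_iff.2
        (.inr ⟨_, (Part.mem_map_iff _).2 ⟨_, hy, by simp [h0]⟩, hw⟩)

theorem tree_realize {c : Code} {k : ℕ} (h : ¬(c.eval [k]).Dom) :
    BinaryTree Unit ⊨ divergenceSentence c k := by
  rw [realize_divergenceSentence, realize_divergenceAxiom, realize_treeAxioms,
    realize_evalAxioms]
  simp only [realize_succAxiom, pred_zero_iff, pred_numeral_iff, node_iff, eval_iff, left_iff,
    right_iff]
  refine ⟨?_, ?_, ⟨⟨.nil, rfl, rfl, rfl⟩, fun x y => ⟨_, rfl⟩, ?_⟩, evalClauses_tree c⟩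
  · rintro _ x _ y rfl rfl rfl hy
    exact h (Part.dom_iff_mem.2 ⟨_, hy⟩)
  · rintro i - _ _ x rfl rfl rfl
    rfl
  · rintro _ rfl
    exact pred_numeral_iff (k := 0).2 rfl

end Standard

theorem satSentence_divergenceSentence {c : Code} {k : ℕ} :
    SatSentence (divergenceSentence c k) ↔ ¬(c.eval [k]).Dom :=
  ⟨fun ⟨_, _, _, h⟩ => not_dom_of_realize h,
    fun h => ⟨BinaryTree Unit, inferInstance, inferInstance, tree_realize h⟩⟩

/-! ### Computability of the reduction -/

section Reduction

/-- The alphabet in which formulas are written. -/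
abbrev Token : Type :=
  (Σ k, churchLang.Term (Empty ⊕ Fin k)) ⊕ ((Σ m, churchLang.Relations m) ⊕ ℕ)

/-- A family of formulas whose code is a primitive recursive function of the parameter. -/
def PrimrecFormula {n : ℕ} (φ : ℕ → churchLang.BoundedFormula Empty n) : Prop :=
  Primrec fun k => (φ k).listEncode.map Encodable.encode

theorem PrimrecFormula.primrec_encode {φ : ℕ → churchLang.Sentence} (h : PrimrecFormula φ) :
    Primrec fun k => Encodable.encode (φ k) := by
  refine (Primrec.encode.comp h).of_eq fun k => ?_
  change _ = Encodable.encode (BoundedFormula.listEncode (φ k))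
  induction BoundedFormula.listEncode (φ k) with
  | nil => rfl
  | cons a l ih => simp_all

variable {n : ℕ} {φ ψ : ℕ → churchLang.BoundedFormula Empty n}

theorem PrimrecFormula.const (φ : churchLang.BoundedFormula Empty n) :
    PrimrecFormula fun _ => φ := Primrec.const _

theorem PrimrecFormula.imp (hφ : PrimrecFormula φ) (hψ : PrimrecFormula ψ) :
    PrimrecFormula fun k => φ k ⟹ ψ k :=
  (Primrec.list_append.comp (Primrec.list_cons.comp
    (Primrec.const (Encodable.encode (.inr (.inr 0) : Token))) hφ) hψ).of_eq
    fun k => by simp [BoundedFormula.listEncode]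

theorem PrimrecFormula.alls (hφ : PrimrecFormula φ) : PrimrecFormula fun k => (φ k).alls := by
  induction n with
  | zero => exact hφ
  | succ n ih =>
    exact ih (φ := fun k => (φ k).all) <| (Primrec.list_cons.comp
      (Primrec.const (Encodable.encode (.inr (.inr 1) : Token))) hφ).of_eq
      fun k => by simp [BoundedFormula.listEncode]

theorem primrec_encode_predSymb :
    Primrec fun k => Encodable.encode (.inr (.inl ⟨1, predSymb k⟩) : Token) := by
  have h : Primrec fun k : ℕ => 2 * (2 * Nat.pair 1 k) + 1 :=
    Primrec.nat_add.comp (Primrec.nat_mul.comp (.const 2) (Primrec.nat_mul.comp (.const 2)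
      (Primrec₂.natPair.comp (.const 1) .id))) (.const 1)
  exact h

theorem PrimrecFormula.numeralF {f : ℕ → ℕ} (hf : Primrec f) (i : Fin n) :
    PrimrecFormula fun k => numeralF (f k) i := by
  have h : Primrec fun k => 2 * f k + 1 :=
    Primrec.nat_add.comp (Primrec.nat_mul.comp (.const 2) hf) (.const 1)
  exact (Primrec.list_cons.comp (primrec_encode_predSymb.comp h) (Primrec.const
    [Encodable.encode (.inr (.inr n) : Token), Encodable.encode (.inl ⟨n, &i⟩ : Token)])).of_eq
    fun k => rfl

theorem primrecFormula_succAxiom : PrimrecFormula succAxiom :=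
  .alls (.imp (.const _) (.imp (.const _) (.imp (.numeralF .id _) (.numeralF .succ _))))

theorem primrecFormula_divergenceAxiom (c : Code) : PrimrecFormula (divergenceAxiom c) :=
  .alls (.imp (.const _) (.imp (.numeralF .id _) (.const _)))

theorem primrecFormula_refutation (c : Code) : PrimrecFormula (refutation c) := by
  have h : Primrec₂ fun (k : ℕ) (l : List ℕ) => Encodable.encode (.inr (.inr 0) : Token) ::
      (BoundedFormula.listEncode (succAxiom k)).map Encodable.encode ++ l :=
    Primrec.list_append.comp (Primrec.list_cons.comp (.const _)
      (Primrec.comp (f := fun k => (BoundedFormula.listEncode (succAxiom k)).map Encodable.encode)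
        primrecFormula_succAxiom .fst)) .snd
  refine (Primrec.nat_rec₁ ((refutation c 0).listEncode.map Encodable.encode) h).of_eq fun k => ?_
  induction k with
  | zero => rfl
  | succ k ih =>
    rw [show BoundedFormula.listEncode (refutation c (k + 1)) =
      (.inr (.inr 0) :: BoundedFormula.listEncode (succAxiom k)) ++
        BoundedFormula.listEncode (refutation c k) from rfl, List.map_append, ← ih]
    rfl

theorem primrecFormula_divergenceSentence (c : Code) : PrimrecFormula (divergenceSentence c) :=
  .imp (.imp (primrecFormula_divergenceAxiom c) (primrecFormula_refutation c)) (.const _)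

end Reduction

/-- There is a code whose domain of definition on singleton lists is not computable. -/
theorem exists_code_undecidable_domain :
    ∃ c : Code, ¬ComputablePred fun k : ℕ => (c.eval [k]).Dom := by
  let g : ℕ →. ℕ := fun k => (Denumerable.ofNat Nat.Partrec.Code k).eval 0
  have hg : Partrec g := Nat.Partrec.Code.eval_part.comp (Computable.ofNat _) (Computable.const 0)
  obtain ⟨c, hc⟩ := Code.exists_code (Nat.Partrec'.part_iff₁.2 hg)
  refine ⟨c, fun h => ComputablePred.halting_problem 0 ?_⟩
  obtain ⟨f, hf, hfc⟩ := ComputablePred.computable_iff.1 h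
  refine ComputablePred.computable_iff.2
    ⟨fun d => f (Encodable.encode d), hf.comp Computable.encode, funext fun d => ?_⟩
  rw [← congrFun hfc (Encodable.encode d), hc ⟨[Encodable.encode d], rfl⟩]
  change _ = (g (Encodable.encode d)).Dom
  simp [g]

end ChurchUndecidable

/-- Church's theorem (satisfiability form): no algorithm decides, given a sentence of the
language with countably many unary predicate symbols and two binary predicate symbols,
whether it has a model with nonempty domain. -/
theorem church_satisfiability_undecidable :
    ¬ ∃ f : ℕ → Bool, Computable f ∧
      ∀ φ : churchLang.Sentence, (f (Encodable.encode φ) = true ↔ SatSentence φ) := by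
  rintro ⟨f, hf, h⟩
  obtain ⟨c, hc⟩ := ChurchUndecidable.exists_code_undecidable_domain
  refine hc (ComputablePred.computable_iff.2 ⟨fun k =>
    !f (Encodable.encode (ChurchUndecidable.divergenceSentence c k)), ?_, ?_⟩)
  · exact Primrec.not.to_comp.comp
      (hf.comp (ChurchUndecidable.primrecFormula_divergenceSentence c).primrec_encode.to_comp)
  · funext k
    have := h (ChurchUndecidable.divergenceSentence c k)
    rw [ChurchUndecidable.satSentence_divergenceSentence] at this
    simp [← Bool.not_eq_true, this]
end

section
/- Trakhtenbrot's theorem: let L be the first-order language with countably many unary relation symbols P₀, P₁, P₂, … and two binary relation symbols H and V. The set of L-sentences that are satisfiable in some finite structure (i.e., have a model whose domain is a nonempty finite set) is not computable: there is no algorithm that, given an L-sentence, decides whether it has a finite model. -/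
open FirstOrder FirstOrder.Language

/-- A sentence is finitely satisfiable iff it is true in some structure whose domain is a
nonempty finite set. -/
def FinSatSentence (φ : churchLang.Sentence) : Prop :=
  ∃ (M : Type) (S : churchLang.Structure M), Nonempty M ∧ Finite M ∧
    @FirstOrder.Language.Sentence.Realize churchLang M S φ


open Turing.ToPartrec (Code)

namespace Trakhtenbrot

/-! ### Abstract interpretations

An element may be a number, a list of numbers, or a *fact* asserting that a code maps a list to
a list. `H` links a list to its head, a positive number to its predecessor and a fact to its
input; `V` links a list to its tail and a fact to its output. Between facts, `H` is a strict
order. -/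

/-- The relations used to describe computations inside a structure with domain `M`. -/
@[ext]
structure Interp (M : Type*) where
  /-- Head, predecessor or input; a strict order between facts. -/
  H : M → M → Prop
  /-- Tail or output. -/
  V : M → M → Prop
  /-- The element is the number `n`. -/
  Num : ℕ → M → Prop
  /-- The element is a number or a list. -/
  Data : M → Prop
  /-- The element is the empty list. -/
  Nil : M → Prop
  /-- The element is a fact about the code. -/
  Fact : Code → M → Prop

namespace Interp

variable {M : Type*} (W : Interp M)

/-- The relations behave as functions on data. -/
def Basic : Prop :=
  (∀ x y z, W.Data x → W.H x y → W.H x z → y = z) ∧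
  (∀ x y z, W.Data x → W.V x y → W.V x z → y = z) ∧
  (∀ x y, W.Data x → W.H x y → W.Data y) ∧
  (∀ x y, W.Data x → W.V x y → W.Data y) ∧
  (∀ x y, W.Nil x → W.H x y → W.Num 0 y) ∧
  (∀ x y, W.Nil x → W.V x y → W.Nil y)

/-- The fact `p` that the code maps `x` to `y` is justified by other facts. -/
def Justified : Code → M → M → M → Prop
  | .zero', _, x, y => W.Data y ∧ W.V y x ∧ ∃ a, W.H y a ∧ W.Num 0 a
  | .succ, _, x, y => W.Data y ∧ ∃ a b t, W.H x b ∧ W.H y a ∧ ¬ W.Num 0 a ∧ W.H a b ∧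
      W.V y t ∧ W.Nil t
  | .tail, _, x, y => W.V x y
  | .cons f g, _, x, y => W.Data y ∧ ∃ q r u s a, (W.Fact f q ∧ W.H q x ∧ W.V q u) ∧
      (W.Fact g r ∧ W.H r x ∧ W.V r s) ∧ W.H u a ∧ W.H y a ∧ W.V y s
  | .comp f g, _, x, y => ∃ q r u, (W.Fact g q ∧ W.H q x ∧ W.V q u) ∧
      (W.Fact f r ∧ W.H r u ∧ W.V r y)
  | .case f g, _, x, y => ∃ a t, (W.H x a ∧ W.V x t) ∧
      ((W.Num 0 a ∧ ∃ q, W.Fact f q ∧ W.H q t ∧ W.V q y) ∨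
        (¬ W.Num 0 a ∧ ∃ b s q, (W.Data s ∧ W.H a b ∧ W.H s b ∧ W.V s t) ∧
          W.Fact g q ∧ W.H q s ∧ W.V q y))
  | .fix f, p, x, y => ∃ q u a, (W.Fact f q ∧ W.H q x ∧ W.V q u) ∧ W.H u a ∧
      ((W.Num 0 a ∧ W.V u y) ∨
        (¬ W.Num 0 a ∧ ∃ t r, W.V u t ∧ W.Fact (.fix f) r ∧ W.H r t ∧ W.V r y ∧ W.H p r))

/-- Facts about the code `c` are strictly ordered and justified. -/
def Sound (c : Code) : Prop :=
  (∀ p, W.Fact c p → ¬ W.H p p) ∧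
  (∀ p q r, W.Fact c p → W.Fact c q → W.Fact c r → W.H p q → W.H q r → W.H p r) ∧
  (∀ p x y, W.Fact c p → W.H p x → W.Data x → W.V p y → W.Justified c p x y)

/-- Facts about all subcodes of a code are strictly ordered and justified. -/
def SoundBelow : Code → Prop
  | .zero' => W.Sound .zero'
  | .succ => W.Sound .succ
  | .tail => W.Sound .tail
  | .cons f g => W.Sound (.cons f g) ∧ SoundBelow f ∧ SoundBelow g
  | .comp f g => W.Sound (.comp f g) ∧ SoundBelow f ∧ SoundBelow g
  | .case f g => W.Sound (.case f g) ∧ SoundBelow f ∧ SoundBelow g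
  | .fix f => W.Sound (.fix f) ∧ SoundBelow f

/-- Elements marked as `n + 1` have a predecessor marked as `n`. -/
def Pred (n : ℕ) : Prop :=
  ∀ x, W.Num (n + 1) x → ¬ W.Num 0 x ∧ ∃ y, W.H x y ∧ W.Num n y

/-- There is a fact about the code `c` with input `[n]`. -/
def Start (c : Code) (n : ℕ) : Prop :=
  ∃ p x y a t, (W.Fact c p ∧ W.H p x ∧ W.V p y) ∧ W.Data x ∧ (W.H x a ∧ W.Num n a) ∧
    (W.V x t ∧ W.Nil t)

/-! ### Every fact in a finite interpretation is true -/

/-- The element `a` represents the number `n`. -/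
def RepNum : ℕ → M → Prop
  | 0, a => W.Data a ∧ W.Num 0 a
  | n + 1, a => W.Data a ∧ ¬ W.Num 0 a ∧ ∃ b, W.H a b ∧ RepNum n b

/-- The element `x` represents the list `v`. -/
def RepList : List ℕ → M → Prop
  | [], x => W.Data x ∧ W.Nil x
  | n :: v, x => W.Data x ∧ ∃ a y, W.H x a ∧ W.V x y ∧ W.RepNum n a ∧ RepList v y

variable {W}

theorem RepNum.eq_zero_iff {n : ℕ} {a : M} (h : W.RepNum n a) : n = 0 ↔ W.Num 0 a := by
  cases n with
  | zero => simpa using h.2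
  | succ n => simpa using h.2.1

theorem RepNum.pred (hW : W.Basic) {n : ℕ} {a b : M} (h : W.RepNum (n + 1) a) (hb : W.H a b) :
    W.RepNum n b := by
  obtain ⟨hd, -, b', hb', h⟩ := h
  rwa [hW.1 _ _ _ hd hb hb']

theorem RepList.data {v : List ℕ} {x : M} (h : W.RepList v x) : W.Data x := by
  cases v <;> exact h.1

theorem RepList.headI (hW : W.Basic) {v : List ℕ} {x a : M} (h : W.RepList v x) (ha : W.H x a) :
    W.RepNum v.headI a := by
  cases v with
  | nil => exact ⟨hW.2.2.1 _ _ h.1 ha, hW.2.2.2.2.1 _ _ h.2 ha⟩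
  | cons n v =>
    obtain ⟨hd, a', y, ha', -, h, -⟩ := h
    rwa [hW.1 _ _ _ hd ha ha']

theorem RepList.tail (hW : W.Basic) {v : List ℕ} {x y : M} (h : W.RepList v x) (hy : W.V x y) :
    W.RepList v.tail y := by
  cases v with
  | nil => exact ⟨hW.2.2.2.1 _ _ h.1 hy, hW.2.2.2.2.2 _ _ h.2 hy⟩
  | cons n v =>
    obtain ⟨hd, a, y', -, hy', -, h⟩ := h
    rwa [hW.2.1 _ _ _ hd hy hy']

theorem repNum_of_num (hW : W.Basic) {n : ℕ} (hP : ∀ i < n, W.Pred i) {a : M} (hd : W.Data a)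
    (ha : W.Num n a) : W.RepNum n a := by
  induction n generalizing a with
  | zero => exact ⟨hd, ha⟩
  | succ n ih =>
    obtain ⟨h0, b, hb, hn⟩ := hP n n.lt_succ_self a ha
    exact ⟨hd, h0, b, hb,
      ih (fun i hi => hP i (hi.trans n.lt_succ_self)) (hW.2.2.1 _ _ hd hb) hn⟩

theorem mem_eval_fix_iff {f : Code} {v w : List ℕ} :
    w ∈ (Code.fix f).eval v ↔ ∃ u ∈ f.eval v,
      (u.headI = 0 ∧ w = u.tail) ∨ (u.headI ≠ 0 ∧ w ∈ (Code.fix f).eval u.tail) := by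
  rw [Code.fix_eval]
  refine PFun.mem_fix_iff.trans ?_
  simp only [Part.mem_map_iff]
  constructor
  · rintro (⟨u, hu, h⟩ | ⟨a, ⟨u, hu, h⟩, ha⟩)
    · refine ⟨u, hu, ?_⟩
      split_ifs at h with h0
      exact .inl ⟨h0, (Sum.inl.inj h).symm⟩
    · refine ⟨u, hu, ?_⟩
      split_ifs at h with h0
      cases h
      exact .inr ⟨h0, ha⟩
  · rintro ⟨u, hu, ⟨h0, rfl⟩ | ⟨h0, hw⟩⟩
    · exact .inl ⟨u, hu, if_pos h0⟩
    · exact .inr ⟨_, ⟨u, hu, if_neg h0⟩, hw⟩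

theorem mem_eval_case_iff {f g : Code} {v w : List ℕ} :
    w ∈ (Code.case f g).eval v ↔ (v.headI = 0 ∧ w ∈ f.eval v.tail) ∨
      ∃ n, v.headI = n + 1 ∧ w ∈ g.eval (n :: v.tail) := by
  rw [Code.case_eval]
  cases h : v.headI <;> simp [h]

theorem mem_eval_cons_iff {f g : Code} {v w : List ℕ} :
    w ∈ (Code.cons f g).eval v ↔ ∃ u ∈ f.eval v, ∃ s ∈ g.eval v, w = u.headI :: s := by
  simp

theorem mem_eval_comp_iff {f g : Code} {v w : List ℕ} :
    w ∈ (Code.comp f g).eval v ↔ ∃ u ∈ g.eval v, w ∈ f.eval u := by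
  rw [Code.comp_eval]
  exact Part.mem_bind_iff

theorem exists_mem_eval_of_fact [Finite M] (hW : W.Basic) {c : Code} (hc : W.SoundBelow c)
    {p x y : M} {v : List ℕ} (hp : W.Fact c p) (hx : W.H p x) (hy : W.V p y)
    (hv : W.RepList v x) : ∃ w ∈ c.eval v, W.RepList w y := by
  have data_H {x y} := hW.2.2.1 x y
  have data_V {x y} := hW.2.2.2.1 x y
  induction c generalizing p x y v with
  | zero' =>
    obtain ⟨hd, hyx, a, ha, h0⟩ := hc.2.2 _ _ _ hp hx hv.data hy
    exact ⟨0 :: v, by simp, hd, a, x, ha, hyx, ⟨data_H hd ha, h0⟩, hv⟩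
  | succ =>
    obtain ⟨hd, a, b, t, hb, ha, h0, hab, ht, hn⟩ := hc.2.2 _ _ _ hp hx hv.data hy
    exact ⟨[v.headI + 1], by simp, hd, a, t, ha, ht,
      ⟨data_H hd ha, h0, b, hab, hv.headI hW hb⟩, data_V hd ht, hn⟩
  | tail => exact ⟨v.tail, by simp, hv.tail hW (hc.2.2 _ _ _ hp hx hv.data hy)⟩
  | cons f g ihf ihg =>
    obtain ⟨hd, q, r, u, s, a, ⟨hq, hqx, hqu⟩, ⟨hr, hrx, hrs⟩, hua, hya, hys⟩ :=
      hc.1.2.2 _ _ _ hp hx hv.data hy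
    obtain ⟨u', hu', hu⟩ := ihf hc.2.1 hq hqx hqu hv
    obtain ⟨s', hs', hs⟩ := ihg hc.2.2 hr hrx hrs hv
    exact ⟨_, mem_eval_cons_iff.2 ⟨u', hu', s', hs', rfl⟩, hd, a, s, hya, hys,
      hu.headI hW hua, hs⟩
  | comp f g ihf ihg =>
    obtain ⟨q, r, u, ⟨hq, hqx, hqu⟩, hr, hru, hry⟩ := hc.1.2.2 _ _ _ hp hx hv.data hy
    obtain ⟨u', hu', hu⟩ := ihg hc.2.2 hq hqx hqu hv
    obtain ⟨w, hw', hw⟩ := ihf hc.2.1 hr hru hry hu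
    exact ⟨w, mem_eval_comp_iff.2 ⟨u', hu', hw'⟩, hw⟩
  | case f g ihf ihg =>
    obtain ⟨a, t, ⟨ha, ht⟩, ⟨h0, q, hq, hqt, hqy⟩ |
      ⟨h0, b, s, q, ⟨hs, hab, hsb, hst⟩, hq, hqs, hqy⟩⟩ := hc.1.2.2 _ _ _ hp hx hv.data hy
    · obtain ⟨w, hw', hw⟩ := ihf hc.2.1 hq hqt hqy (hv.tail hW ht)
      exact ⟨w, mem_eval_case_iff.2 (.inl ⟨(hv.headI hW ha).eq_zero_iff.2 h0, hw'⟩), hw⟩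
    · have hva := hv.headI hW ha
      obtain ⟨n, hn⟩ := Nat.exists_eq_succ_of_ne_zero (mt hva.eq_zero_iff.1 h0)
      rw [hn] at hva
      obtain ⟨w, hw', hw⟩ := ihg hc.2.2 hq hqs hqy (v := n :: v.tail)
        ⟨hs, b, t, hsb, hst, hva.pred hW hab, hv.tail hW ht⟩
      exact ⟨w, mem_eval_case_iff.2 (.inr ⟨n, hn, hw'⟩), hw⟩
  | fix f ihf =>
    let lt (r p : M) : Prop := W.Fact (.fix f) p ∧ W.Fact (.fix f) r ∧ W.H p r
    have : IsTrans M lt := ⟨fun r q p hrq hqp =>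
      ⟨hqp.1, hrq.2.1, hc.1.2.1 _ _ _ hqp.1 hrq.1 hrq.2.1 hqp.2.2 hrq.2.2⟩⟩
    have : Std.Irrefl lt := ⟨fun p hp => hc.1.1 _ hp.1 hp.2.2⟩
    induction p using (Finite.wellFounded_of_trans_of_irrefl lt).induction generalizing x v with
    | _ p ih =>
      obtain ⟨q, u, a, ⟨hq, hqx, hqu⟩, hua, h⟩ := hc.1.2.2 _ _ _ hp hx hv.data hy
      obtain ⟨u', hu', hu⟩ := ihf hc.2 hq hqx hqu hv
      have h0 := (hu.headI hW hua).eq_zero_iff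
      obtain ⟨ha, huy⟩ | ⟨ha, t, r, hut, hr, hrt, hry, hpr⟩ := h
      · exact ⟨_, mem_eval_fix_iff.2 ⟨u', hu', .inl ⟨h0.2 ha, rfl⟩⟩, hu.tail hW huy⟩
      · obtain ⟨w, hw', hw⟩ := ih r ⟨hp, hr, hpr⟩ hr hrt hry (hu.tail hW hut)
        exact ⟨w, mem_eval_fix_iff.2 ⟨u', hu', .inr ⟨mt h0.1 ha, hw'⟩⟩, hw⟩

theorem dom_eval_of_start [Finite M] (hW : W.Basic) {c : Code} (hc : W.SoundBelow c) {n : ℕ}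
    (hP : ∀ i < n, W.Pred i) (h : W.Start c n) : (c.eval [n]).Dom := by
  obtain ⟨p, x, y, a, t, ⟨hp, hx, hy⟩, hd, ⟨ha, hn⟩, ht, hnil⟩ := h
  obtain ⟨w, hw, -⟩ := exists_mem_eval_of_fact hW hc hp hx hy (v := [n])
    ⟨hd, a, t, ha, ht, repNum_of_num hW hP (hW.2.2.1 _ _ hd ha) hn, hW.2.2.2.1 _ _ hd ht, hnil⟩
  exact Part.dom_iff_mem.2 ⟨w, hw⟩

end Interp

/-! ### Every true fact belongs to a finite interpretation -/

/-- The elements of the intended interpretations. The last argument of `fact` is its rank in the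
order between facts. -/
inductive Item
  | num (n : ℕ)
  | lst (v : List ℕ)
  | fact (c : Code) (v w : List ℕ) (k : ℕ)

namespace Item

/-- The intended meaning of `Interp.H`. -/
inductive HRel : Item → Item → Prop
  | pred (n : ℕ) : HRel (num (n + 1)) (num n)
  | head (v : List ℕ) : HRel (lst v) (num v.headI)
  | input (c : Code) (v w : List ℕ) (k : ℕ) : HRel (fact c v w k) (lst v)
  | lt (c d : Code) (v w v' w' : List ℕ) {k l : ℕ} (h : l < k) :
      HRel (fact c v w k) (fact d v' w' l)

/-- The intended meaning of `Interp.V`. -/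
inductive VRel : Item → Item → Prop
  | tail (v : List ℕ) : VRel (lst v) (lst v.tail)
  | output (c : Code) (v w : List ℕ) (k : ℕ) : VRel (fact c v w k) (lst w)

/-- The item is a number or a list. -/
inductive IsData : Item → Prop
  | num (n : ℕ) : IsData (num n)
  | lst (v : List ℕ) : IsData (lst v)

/-- The item is a fact about the code `c`. -/
inductive IsFact (c : Code) : Item → Prop
  | fact (v w : List ℕ) (k : ℕ) : IsFact c (fact c v w k)

/-- The intended interpretation on a set of items. -/
def interp (S : Set Item) : Interp S where
  H x y := HRel x y
  V x y := VRel x y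
  Num n x := x = num n
  Data x := IsData x
  Nil x := (x : Item) = lst []
  Fact c x := IsFact c x

/-- The fact that the code maps `v` to `w` is justified by facts in `S`. -/
def Justified (S : Set Item) : Code → List ℕ → List ℕ → ℕ → Prop
  | .zero', v, w, _ => w = 0 :: v
  | .succ, v, w, _ => w = [v.headI + 1]
  | .tail, v, w, _ => w = v.tail
  | .cons f g, v, w, _ => ∃ u s j l, fact f v u j ∈ S ∧ fact g v s l ∈ S ∧ w = u.headI :: s
  | .comp f g, v, w, _ => ∃ u j l, fact g v u j ∈ S ∧ fact f u w l ∈ S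
  | .case f g, v, w, _ => (v.headI = 0 ∧ ∃ j, fact f v.tail w j ∈ S) ∨
      ∃ n, v.headI = n + 1 ∧ ∃ j, fact g (n :: v.tail) w j ∈ S
  | .fix f, v, w, k => ∃ u j, fact f v u j ∈ S ∧ ((u.headI = 0 ∧ w = u.tail) ∨
      (u.headI ≠ 0 ∧ ∃ l < k, fact (.fix f) u.tail w l ∈ S))

/-- The components of an item, and a justification if it is a fact, belong to `S`. -/
def Supported (S : Set Item) : Item → Prop
  | num 0 => True
  | num (n + 1) => num n ∈ S
  | lst v => num v.headI ∈ S ∧ lst v.tail ∈ S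
  | fact c v w k => lst v ∈ S ∧ lst w ∈ S ∧ Justified S c v w k

/-- A set of items that supports all its elements. -/
def Closed (S : Set Item) : Prop := ∀ i ∈ S, Supported S i

variable {S T : Set Item}

theorem Justified.mono (h : S ⊆ T) {c : Code} {v w : List ℕ} {k : ℕ}
    (hS : Justified S c v w k) : Justified T c v w k := by
  cases c with
  | zero' | succ | tail => exact hS
  | cons f g =>
    obtain ⟨u, s, j, l, hf, hg, hw⟩ := hS
    exact ⟨u, s, j, l, h hf, h hg, hw⟩
  | comp f g =>
    obtain ⟨u, j, l, hg, hf⟩ := hS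
    exact ⟨u, j, l, h hg, h hf⟩
  | case f g =>
    exact hS.imp (fun ⟨h0, j, hj⟩ => ⟨h0, j, h hj⟩) fun ⟨n, hn, j, hj⟩ => ⟨n, hn, j, h hj⟩
  | fix f =>
    obtain ⟨u, j, hf, hS⟩ := hS
    exact ⟨u, j, h hf, hS.imp_right fun ⟨h0, l, hl, hS⟩ => ⟨h0, l, hl, h hS⟩⟩

theorem Supported.mono (h : S ⊆ T) {i : Item} (hS : Supported S i) : Supported T i := by
  match i, hS with
  | num 0, _ => trivial
  | num (n + 1), hS => exact h hS
  | lst v, hS => exact ⟨h hS.1, h hS.2⟩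
  | fact c v w k, hS => exact ⟨h hS.1, h hS.2.1, hS.2.2.mono h⟩

theorem Closed.union (hS : Closed S) (hT : Closed T) : Closed (S ∪ T) := by
  rintro i (hi | hi)
  · exact (hS i hi).mono Set.subset_union_left
  · exact (hT i hi).mono Set.subset_union_right

theorem Closed.insert (hS : Closed S) {i : Item} (hi : Supported (insert i S) i) :
    Closed (insert i S) := by
  rintro j (rfl | hj)
  · exact hi
  · exact (hS j hj).mono (Set.subset_insert _ _)

/-- The item belongs to a finite closed set. -/
def Reachable (i : Item) : Prop := ∃ S : Set Item, S.Finite ∧ Closed S ∧ i ∈ S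

theorem reachable_num (n : ℕ) : Reachable (num n) := by
  induction n with
  | zero => exact ⟨{num 0}, Set.finite_singleton _, by rintro _ rfl; trivial, rfl⟩
  | succ n ih =>
    obtain ⟨S, hf, hS, hn⟩ := ih
    exact ⟨_, hf.insert _, hS.insert (i := num (n + 1)) (.inr hn), .inl rfl⟩

theorem reachable_lst (v : List ℕ) : Reachable (lst v) := by
  induction v with
  | nil =>
    obtain ⟨S, hf, hS, hn⟩ := reachable_num 0
    exact ⟨_, hf.insert _, hS.insert (i := lst []) ⟨.inr hn, .inl rfl⟩, .inl rfl⟩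
  | cons n v ih =>
    obtain ⟨S, hSf, hS, hn⟩ := reachable_num n
    obtain ⟨T, hTf, hT, hv⟩ := ih
    exact ⟨_, (hSf.union hTf).insert _,
      (hS.union hT).insert (i := lst (n :: v)) ⟨.inr (.inl hn), .inr (.inr hv)⟩, .inl rfl⟩

/-- A fact is reachable if it is justified in a finite closed set. -/
theorem reachable_fact (hf : S.Finite) (hS : Closed S) {c : Code} {v w : List ℕ} {k : ℕ}
    (h : Justified S c v w k) : Reachable (fact c v w k) := by
  obtain ⟨A, hAf, hA, hv⟩ := reachable_lst v
  obtain ⟨B, hBf, hB, hw⟩ := reachable_lst w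
  refine ⟨_, ((hAf.union hBf).union hf).insert _,
    ((hA.union hB).union hS).insert (i := fact c v w k)
      ⟨.inr (.inl (.inl hv)), .inr (.inl (.inr hw)), ?_⟩, .inl rfl⟩
  exact h.mono (Set.subset_union_right.trans (Set.subset_insert _ _))

theorem exists_reachable_fact {c : Code} {v w : List ℕ} (h : w ∈ c.eval v) :
    ∃ k, Reachable (fact c v w k) := by
  induction c generalizing v w with
  | zero' =>
    exact ⟨0, reachable_fact (S := ∅) Set.finite_empty (fun _ => False.elim)
      (by simpa [Justified] using h)⟩
  | succ =>
    exact ⟨0, reachable_fact (S := ∅) Set.finite_empty (fun _ => False.elim)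
      (by simpa [Justified] using h)⟩
  | tail =>
    exact ⟨0, reachable_fact (S := ∅) Set.finite_empty (fun _ => False.elim)
      (by simpa [Justified] using h)⟩
  | cons f g ihf ihg =>
    obtain ⟨u, hu, s, hs, rfl⟩ := Interp.mem_eval_cons_iff.1 h
    obtain ⟨j, S, hSf, hS, hj⟩ := ihf hu
    obtain ⟨l, T, hTf, hT, hl⟩ := ihg hs
    exact ⟨0, reachable_fact (hSf.union hTf) (hS.union hT) ⟨u, s, j, l, .inl hj, .inr hl, rfl⟩⟩
  | comp f g ihf ihg =>
    obtain ⟨u, hu, hw⟩ := Interp.mem_eval_comp_iff.1 h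
    obtain ⟨j, S, hSf, hS, hj⟩ := ihg hu
    obtain ⟨l, T, hTf, hT, hl⟩ := ihf hw
    exact ⟨0, reachable_fact (hSf.union hTf) (hS.union hT) ⟨u, j, l, .inl hj, .inr hl⟩⟩
  | case f g ihf ihg =>
    obtain ⟨h0, hw⟩ | ⟨n, hn, hw⟩ := Interp.mem_eval_case_iff.1 h
    · obtain ⟨j, S, hSf, hS, hj⟩ := ihf hw
      exact ⟨0, reachable_fact hSf hS (.inl ⟨h0, j, hj⟩)⟩
    · obtain ⟨j, S, hSf, hS, hj⟩ := ihg hw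
      exact ⟨0, reachable_fact hSf hS (.inr ⟨n, hn, j, hj⟩)⟩
  | fix f ihf =>
    rw [Code.fix_eval] at h
    refine PFun.fixInduction h (C := fun v => ∃ k, Reachable (fact (.fix f) v w k))
      fun v hv ih => ?_
    rw [← Code.fix_eval] at hv
    obtain ⟨u, hu, hw⟩ := Interp.mem_eval_fix_iff.1 hv
    obtain ⟨j, S, hSf, hS, hj⟩ := ihf hu
    obtain ⟨h0, rfl⟩ | ⟨h0, hw⟩ := hw
    · exact ⟨0, reachable_fact hSf hS ⟨u, j, hj, .inl ⟨h0, rfl⟩⟩⟩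
    · obtain ⟨l, T, hTf, hT, hl⟩ := ih u.tail ((Part.mem_map_iff _).2 ⟨u, hu, if_neg h0⟩)
      exact ⟨l + 1, reachable_fact (hSf.union hTf) (hS.union hT)
        ⟨u, j, .inl hj, .inr ⟨h0, l, l.lt_succ_self, .inr hl⟩⟩⟩

theorem interp_basic (S : Set Item) : (interp S).Basic := by
  refine ⟨?_, ?_, ?_, ?_, ?_, ?_⟩
  · rintro ⟨x, hx⟩ ⟨y, hy⟩ ⟨z, hz⟩ hd hxy hxz
    simp only [interp] at hd hxy hxz
    cases hxy <;> cases hxz <;> first | rfl | cases hd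
  · rintro ⟨x, hx⟩ ⟨y, hy⟩ ⟨z, hz⟩ hd hxy hxz
    simp only [interp] at hd hxy hxz
    cases hxy <;> cases hxz <;> rfl
  · rintro ⟨x, hx⟩ ⟨y, hy⟩ hd hxy
    simp only [interp] at hd hxy ⊢
    cases hxy <;> first | cases hd; done | constructor
  · rintro ⟨x, hx⟩ ⟨y, hy⟩ hd hxy
    simp only [interp] at hd hxy ⊢
    cases hxy <;> constructor
  · rintro ⟨x, hx⟩ ⟨y, hy⟩ hd hxy
    simp only [interp] at hd hxy ⊢
    subst hd
    cases hxy
    rfl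
  · rintro ⟨x, hx⟩ ⟨y, hy⟩ hd hxy
    simp only [interp] at hd hxy ⊢
    subst hd
    cases hxy
    rfl

theorem Closed.interp_pred (hS : Closed S) (n : ℕ) : (interp S).Pred n := by
  rintro ⟨x, hx⟩ rfl
  exact ⟨by simp [interp], ⟨num n, hS _ hx⟩, .pred n, rfl⟩

theorem Closed.interp_justified (hS : Closed S) {c : Code} {v w : List ℕ} {k : ℕ}
    (hp : fact c v w k ∈ S) (hv : lst v ∈ S) (hw : lst w ∈ S) :
    (interp S).Justified c ⟨_, hp⟩ ⟨_, hv⟩ ⟨_, hw⟩ := by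
  have h := (hS _ hp).2.2
  cases c with
  | zero' =>
    cases h
    exact ⟨.lst _, .tail (0 :: v), ⟨_, (hS _ hw).1⟩, .head (0 :: v), rfl⟩
  | succ =>
    cases h
    exact ⟨.lst _, ⟨_, (hS _ hw).1⟩, ⟨_, (hS _ hv).1⟩, ⟨_, (hS _ hw).2⟩, .head v,
      .head [v.headI + 1], by simp [interp], .pred _, .tail [v.headI + 1], rfl⟩
  | tail =>
    cases h
    exact .tail v
  | cons f g =>
    obtain ⟨u, s, j, l, hf, hg, rfl⟩ := h
    exact ⟨.lst _, ⟨_, hf⟩, ⟨_, hg⟩, ⟨_, (hS _ hf).2.1⟩, ⟨_, (hS _ hg).2.1⟩,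
      ⟨_, (hS _ hw).1⟩, ⟨⟨_, _, _⟩, .input .., .output ..⟩, ⟨⟨_, _, _⟩, .input .., .output ..⟩,
      .head u, .head (u.headI :: s), .tail (u.headI :: s)⟩
  | comp f g =>
    obtain ⟨u, j, l, hg, hf⟩ := h
    exact ⟨⟨_, hg⟩, ⟨_, hf⟩, ⟨_, (hS _ hg).2.1⟩,
      ⟨⟨_, _, _⟩, .input .., .output ..⟩, ⟨_, _, _⟩, .input .., .output ..⟩
  | case f g =>
    refine ⟨⟨_, (hS _ hv).1⟩, ⟨_, (hS _ hv).2⟩, ⟨.head v, .tail v⟩, ?_⟩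
    obtain ⟨h0, j, hf⟩ | ⟨n, hn, j, hg⟩ := h
    · exact .inl ⟨congrArg num h0, ⟨_, hf⟩, ⟨_, _, _⟩, .input .., .output ..⟩
    · have hs := (hS _ hg).1
      refine .inr ⟨by simp [interp, hn], ⟨_, (hS _ hs).1⟩, ⟨_, hs⟩, ⟨_, hg⟩,
        ⟨.lst _, ?_, .head (n :: v.tail), .tail (n :: v.tail)⟩, ⟨_, _, _⟩, .input .., .output ..⟩
      simp only [interp, hn]
      exact .pred n
  | fix f =>
    obtain ⟨u, j, hf, h⟩ := h
    have hu := (hS _ hf).2.1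
    refine ⟨⟨_, hf⟩, ⟨_, hu⟩, ⟨_, (hS _ hu).1⟩, ⟨⟨_, _, _⟩, .input .., .output ..⟩, .head u, ?_⟩
    obtain ⟨h0, rfl⟩ | ⟨h0, l, hl, hr⟩ := h
    · exact .inl ⟨congrArg num h0, .tail u⟩
    · exact .inr ⟨by simpa [interp] using h0, ⟨_, (hS _ hu).2⟩, ⟨_, hr⟩, .tail u,
        ⟨_, _, _⟩, .input .., .output .., .lt _ _ _ _ _ _ hl⟩

theorem Closed.interp_sound (hS : Closed S) (c : Code) : (interp S).Sound c := by
  refine ⟨?_, ?_, ?_⟩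
  · rintro ⟨p, hp⟩ hc h
    simp only [interp] at hc h
    cases hc
    cases h with | lt _ _ _ _ _ _ h => exact h.false
  · rintro ⟨p, hp⟩ ⟨q, hq⟩ ⟨r, hr⟩ hcp hcq hcr hpq hqr
    simp only [interp] at *
    cases hcp
    cases hcq
    cases hcr
    cases hpq with | lt _ _ _ _ _ _ h =>
    cases hqr with | lt _ _ _ _ _ _ h' => exact .lt _ _ _ _ _ _ (h'.trans h)
  · rintro ⟨p, hp⟩ ⟨x, hx⟩ ⟨y, hy⟩ hc hpx hx hpy
    simp only [interp] at hc hpx hx hpy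
    cases hc
    cases hpy
    cases hx <;> cases hpx
    exact hS.interp_justified _ _ _

theorem Closed.interp_soundBelow (hS : Closed S) (c : Code) : (interp S).SoundBelow c := by
  induction c with
  | zero' | succ | tail => exact hS.interp_sound _
  | cons f g ihf ihg | comp f g ihf ihg | case f g ihf ihg =>
    exact ⟨hS.interp_sound _, ihf, ihg⟩
  | fix f ihf => exact ⟨hS.interp_sound _, ihf⟩

theorem Closed.interp_start (hS : Closed S) {c : Code} {n k : ℕ} {w : List ℕ}
    (h : fact c [n] w k ∈ S) : (interp S).Start c n := by
  obtain ⟨hn, hw, -⟩ := hS _ h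
  exact ⟨⟨_, h⟩, ⟨_, hn⟩, ⟨_, hw⟩, ⟨_, (hS _ hn).1⟩, ⟨_, (hS _ hn).2⟩,
    ⟨⟨_, _, _⟩, .input .., .output ..⟩, .lst _, ⟨.head [n], rfl⟩, .tail [n], rfl⟩

end Item

/-- A computation halts iff it is described by a finite interpretation. -/
theorem dom_eval_iff {c : Code} {n : ℕ} :
    (c.eval [n]).Dom ↔ ∃ (M : Type) (W : Interp M), Finite M ∧ W.Basic ∧ W.SoundBelow c ∧
      (∀ i < n, W.Pred i) ∧ W.Start c n := by
  constructor
  · intro h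
    obtain ⟨w, hw⟩ := Part.dom_iff_mem.1 h
    obtain ⟨k, S, hf, hS, hk⟩ := Item.exists_reachable_fact hw
    exact ⟨S, Item.interp S, hf, Item.interp_basic S, hS.interp_soundBelow c,
      fun i _ => hS.interp_pred i, hS.interp_start hk⟩
  · rintro ⟨M, W, hM, hW, hc, hP, h⟩
    exact Interp.dom_eval_of_start hW hc hP h

/-! ### Interpretations and structures -/

/-- An injective numbering of codes. -/
def codeNum : Code → ℕ
  | .zero' => Nat.pair 0 0
  | .succ => Nat.pair 1 0
  | .tail => Nat.pair 2 0
  | .cons f g => Nat.pair 3 (Nat.pair (codeNum f) (codeNum g))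
  | .comp f g => Nat.pair 4 (Nat.pair (codeNum f) (codeNum g))
  | .case f g => Nat.pair 5 (Nat.pair (codeNum f) (codeNum g))
  | .fix f => Nat.pair 6 (codeNum f)

theorem codeNum_injective : Function.Injective codeNum := by
  intro c
  induction c with
  | zero' | succ | tail => intro d h; cases d <;> simp [codeNum, Nat.pair_eq_pair] at h ⊢
  | cons f g ihf ihg | comp f g ihf ihg | case f g ihf ihg =>
    intro d h
    cases d <;> simp [codeNum, Nat.pair_eq_pair] at h ⊢
    exact ⟨ihf h.1, ihg h.2⟩
  | fix f ihf =>
    intro d h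
    cases d <;> simp [codeNum, Nat.pair_eq_pair] at h ⊢
    exact ihf h

/-- The symbol `Pᵢ`. -/
def symP (i : ℕ) : churchLang.Relations 1 := i

/-- The symbol `H`. -/
def symH : churchLang.Relations 2 := (0 : Fin 2)

/-- The symbol `V`. -/
def symV : churchLang.Relations 2 := (1 : Fin 2)

/-- The interpretation given by a structure. -/
def ofStructure (M : Type*) [churchLang.Structure M] : Interp M where
  H x y := Structure.RelMap symH ![x, y]
  V x y := Structure.RelMap symV ![x, y]
  Num n x := Structure.RelMap (symP (2 * n)) ![x]
  Data x := Structure.RelMap (symP 1) ![x]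
  Nil x := Structure.RelMap (symP 3) ![x]
  Fact c x := Structure.RelMap (symP (2 * codeNum c + 5)) ![x]

/-- The relations of the structure given by an interpretation. -/
def relMap {M : Type*} (W : Interp M) : ∀ n, churchLang.Relations n → (Fin n → M) → Prop
  | 0, r, _ => nomatch r
  | 1, (i : ℕ), x => (∃ n, i = 2 * n ∧ W.Num n (x 0)) ∨ (i = 1 ∧ W.Data (x 0)) ∨
      (i = 3 ∧ W.Nil (x 0)) ∨ ∃ c, i = 2 * codeNum c + 5 ∧ W.Fact c (x 0)
  | 2, (i : Fin 2), x => (i = 0 ∧ W.H (x 0) (x 1)) ∨ (i = 1 ∧ W.V (x 0) (x 1))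
  | _ + 3, r, _ => nomatch r

/-- The structure given by an interpretation. -/
abbrev toStructure {M : Type*} (W : Interp M) : churchLang.Structure M where
  funMap f := nomatch f
  RelMap {n} := relMap W n

theorem relMap_symP {M : Type*} (W : Interp M) (i : ℕ) (x : M) :
    relMap W 1 (symP i) ![x] ↔ (∃ n, i = 2 * n ∧ W.Num n x) ∨ (i = 1 ∧ W.Data x) ∨
      (i = 3 ∧ W.Nil x) ∨ ∃ c, i = 2 * codeNum c + 5 ∧ W.Fact c x :=
  Iff.rfl

theorem relMap_symH {M : Type*} (W : Interp M) (x y : M) :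
    relMap W 2 symH ![x, y] ↔ W.H x y := by
  change (0 = 0 ∧ W.H x y) ∨ ((0 : Fin 2) = 1 ∧ W.V x y) ↔ _
  simp

theorem relMap_symV {M : Type*} (W : Interp M) (x y : M) :
    relMap W 2 symV ![x, y] ↔ W.V x y := by
  change ((1 : Fin 2) = 0 ∧ W.H x y) ∨ (1 = 1 ∧ W.V x y) ↔ _
  simp

theorem ofStructure_toStructure {M : Type*} (W : Interp M) :
    @ofStructure M (toStructure W) = W := by
  apply Interp.ext
  · ext x y
    exact relMap_symH W x y
  · ext x y
    exact relMap_symV W x y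
  · ext n x
    refine (relMap_symP W _ x).trans ?_
    grind
  · ext x
    refine (relMap_symP W _ x).trans ?_
    grind
  · ext x
    refine (relMap_symP W _ x).trans ?_
    grind
  · ext c x
    refine (relMap_symP W _ x).trans ?_
    grind [codeNum_injective.eq_iff]

/-! ### Sentences describing computations -/

section Formulas

variable {k : ℕ}

/-- The formula `Pᵢ(x)`. -/
def fP (i : ℕ) (x : Fin k) : churchLang.BoundedFormula Empty k := (symP i).boundedFormula₁ (&x)

/-- The formula `H(x, y)`. -/
def fH (x y : Fin k) : churchLang.BoundedFormula Empty k := symH.boundedFormula₂ (&x) (&y)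

/-- The formula `V(x, y)`. -/
def fV (x y : Fin k) : churchLang.BoundedFormula Empty k := symV.boundedFormula₂ (&x) (&y)

/-- The formula expressing `Interp.Num`. -/
def fNum (n : ℕ) (x : Fin k) : churchLang.BoundedFormula Empty k := fP (2 * n) x

/-- The formula expressing `Interp.Data`. -/
def fData (x : Fin k) : churchLang.BoundedFormula Empty k := fP 1 x

/-- The formula expressing `Interp.Nil`. -/
def fNil (x : Fin k) : churchLang.BoundedFormula Empty k := fP 3 x

/-- The formula expressing `Interp.Fact`. -/
def fFact (c : Code) (x : Fin k) : churchLang.BoundedFormula Empty k := fP (2 * codeNum c + 5) x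

variable {M : Type*} [churchLang.Structure M] {v : Empty → M} {xs : Fin k → M}

@[simp]
theorem realize_fH {x y : Fin k} : (fH x y).Realize v xs ↔ (ofStructure M).H (xs x) (xs y) := by
  simp [fH, ofStructure, BoundedFormula.realize_rel₂]

@[simp]
theorem realize_fV {x y : Fin k} : (fV x y).Realize v xs ↔ (ofStructure M).V (xs x) (xs y) := by
  simp [fV, ofStructure, BoundedFormula.realize_rel₂]

@[simp]
theorem realize_fNum {n : ℕ} {x : Fin k} :
    (fNum n x).Realize v xs ↔ (ofStructure M).Num n (xs x) := by
  simp [fNum, fP, ofStructure, BoundedFormula.realize_rel₁]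

@[simp]
theorem realize_fData {x : Fin k} : (fData x).Realize v xs ↔ (ofStructure M).Data (xs x) := by
  simp [fData, fP, ofStructure, BoundedFormula.realize_rel₁]

@[simp]
theorem realize_fNil {x : Fin k} : (fNil x).Realize v xs ↔ (ofStructure M).Nil (xs x) := by
  simp [fNil, fP, ofStructure, BoundedFormula.realize_rel₁]

@[simp]
theorem realize_fFact {c : Code} {x : Fin k} :
    (fFact c x).Realize v xs ↔ (ofStructure M).Fact c (xs x) := by
  simp [fFact, fP, ofStructure, BoundedFormula.realize_rel₁]

end Formulas

/-- The sentence expressing `Interp.Basic`. -/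
def basicSentence : churchLang.Sentence :=
  (∀' ∀' ∀' (fData 0 ⟹ fH 0 1 ⟹ fH 0 2 ⟹ (&1 =' &2))) ⊓
  ((∀' ∀' ∀' (fData 0 ⟹ fV 0 1 ⟹ fV 0 2 ⟹ (&1 =' &2))) ⊓
  ((∀' ∀' (fData 0 ⟹ fH 0 1 ⟹ fData 1)) ⊓
  ((∀' ∀' (fData 0 ⟹ fV 0 1 ⟹ fData 1)) ⊓
  ((∀' ∀' (fNil 0 ⟹ fH 0 1 ⟹ fNum 0 1)) ⊓
  (∀' ∀' (fNil 0 ⟹ fV 0 1 ⟹ fNil 1))))))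

/-- The formula expressing `Interp.Justified`. -/
def justifiedFormula : Code → churchLang.BoundedFormula Empty 3
  | .zero' => fData 2 ⊓ (fV 2 1 ⊓ ∃' (fH 2 3 ⊓ fNum 0 3))
  | .succ => fData 2 ⊓ ∃' ∃' ∃' (fH 1 4 ⊓ (fH 2 3 ⊓ (∼(fNum 0 3) ⊓ (fH 3 4 ⊓
      (fV 2 5 ⊓ fNil 5)))))
  | .tail => fV 1 2
  | .cons f g => fData 2 ⊓ ∃' ∃' ∃' ∃' ∃' ((fFact f 3 ⊓ (fH 3 1 ⊓ fV 3 5)) ⊓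
      ((fFact g 4 ⊓ (fH 4 1 ⊓ fV 4 6)) ⊓ (fH 5 7 ⊓ (fH 2 7 ⊓ fV 2 6))))
  | .comp f g => ∃' ∃' ∃' ((fFact g 3 ⊓ (fH 3 1 ⊓ fV 3 5)) ⊓ (fFact f 4 ⊓ (fH 4 5 ⊓ fV 4 2)))
  | .case f g => ∃' ∃' ((fH 1 3 ⊓ fV 1 4) ⊓
      ((fNum 0 3 ⊓ ∃' (fFact f 5 ⊓ (fH 5 4 ⊓ fV 5 2))) ⊔
        (∼(fNum 0 3) ⊓ ∃' ∃' ∃' ((fData 6 ⊓ (fH 3 5 ⊓ (fH 6 5 ⊓ fV 6 4))) ⊓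
          (fFact g 7 ⊓ (fH 7 6 ⊓ fV 7 2))))))
  | .fix f => ∃' ∃' ∃' ((fFact f 3 ⊓ (fH 3 1 ⊓ fV 3 4)) ⊓ (fH 4 5 ⊓
      ((fNum 0 5 ⊓ fV 4 2) ⊔
        (∼(fNum 0 5) ⊓ ∃' ∃' (fV 4 6 ⊓ (fFact (.fix f) 7 ⊓ (fH 7 6 ⊓ (fV 7 2 ⊓ fH 0 7))))))))

/-- The sentence expressing `Interp.Sound`. -/
def soundSentence (c : Code) : churchLang.Sentence :=
  (∀' (fFact c 0 ⟹ ∼(fH 0 0))) ⊓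
  ((∀' ∀' ∀' (fFact c 0 ⟹ fFact c 1 ⟹ fFact c 2 ⟹ fH 0 1 ⟹ fH 1 2 ⟹ fH 0 2)) ⊓
  (∀' ∀' ∀' (fFact c 0 ⟹ fH 0 1 ⟹ fData 1 ⟹ fV 0 2 ⟹ justifiedFormula c)))

/-- The sentence expressing `Interp.SoundBelow`. -/
def soundBelowSentence : Code → churchLang.Sentence
  | .zero' => soundSentence .zero'
  | .succ => soundSentence .succ
  | .tail => soundSentence .tail
  | .cons f g => soundSentence (.cons f g) ⊓ (soundBelowSentence f ⊓ soundBelowSentence g)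
  | .comp f g => soundSentence (.comp f g) ⊓ (soundBelowSentence f ⊓ soundBelowSentence g)
  | .case f g => soundSentence (.case f g) ⊓ (soundBelowSentence f ⊓ soundBelowSentence g)
  | .fix f => soundSentence (.fix f) ⊓ soundBelowSentence f

/-- The sentence expressing `Interp.Pred`. -/
def predSentence (n : ℕ) : churchLang.Sentence :=
  ∀' (fNum (n + 1) 0 ⟹ ∼(fNum 0 0) ⊓ ∃' (fH 0 1 ⊓ fNum n 1))

/-- The sentence expressing `Interp.Start`. -/
def startSentence (c : Code) (n : ℕ) : churchLang.Sentence :=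
  ∃' ∃' ∃' ∃' ∃' ((fFact c 0 ⊓ (fH 0 1 ⊓ fV 0 2)) ⊓ (fData 1 ⊓ ((fH 1 3 ⊓ fNum n 3) ⊓
    (fV 1 4 ⊓ fNil 4))))

/-- The conjunction of `φ` with the sentences expressing `Interp.Pred` below `n`. -/
def withPred (φ : churchLang.Sentence) : ℕ → churchLang.Sentence
  | 0 => φ
  | n + 1 => predSentence n ⊓ withPred φ n

/-- The sentence stating that the code `c` halts on input `[n]`. -/
def haltSentence (c : Code) (n : ℕ) : churchLang.Sentence :=
  startSentence c n ⊓ withPred (basicSentence ⊓ soundBelowSentence c) n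

section Realize

variable {M : Type*} [churchLang.Structure M]

theorem realize_basicSentence : M ⊨ basicSentence ↔ (ofStructure M).Basic := by
  simp [basicSentence, Sentence.Realize, Formula.Realize, Interp.Basic, Fin.snoc]

theorem realize_justifiedFormula {c : Code} {xs : Fin 3 → M} {v : Empty → M} :
    (justifiedFormula c).Realize v xs ↔ (ofStructure M).Justified c (xs 0) (xs 1) (xs 2) := by
  cases c <;> simp [justifiedFormula, Interp.Justified, Fin.snoc] <;> (intros; rfl)

theorem realize_soundSentence {c : Code} : M ⊨ soundSentence c ↔ (ofStructure M).Sound c := by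
  simp [soundSentence, Sentence.Realize, Formula.Realize, Interp.Sound, Fin.snoc,
    realize_justifiedFormula]

theorem realize_soundBelowSentence {c : Code} :
    M ⊨ soundBelowSentence c ↔ (ofStructure M).SoundBelow c := by
  induction c with
  | zero' | succ | tail => exact realize_soundSentence
  | cons f g ihf ihg | comp f g ihf ihg | case f g ihf ihg =>
    rw [soundBelowSentence, Interp.SoundBelow, ← realize_soundSentence, ← ihf, ← ihg]
    simp [Sentence.Realize, Formula.Realize]
  | fix f ihf =>
    rw [soundBelowSentence, Interp.SoundBelow, ← realize_soundSentence, ← ihf]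
    simp [Sentence.Realize, Formula.Realize]

theorem realize_predSentence {n : ℕ} : M ⊨ predSentence n ↔ (ofStructure M).Pred n := by
  simp [predSentence, Sentence.Realize, Formula.Realize, Interp.Pred, Fin.snoc]

theorem realize_startSentence {c : Code} {n : ℕ} :
    M ⊨ startSentence c n ↔ (ofStructure M).Start c n := by
  simp [startSentence, Sentence.Realize, Formula.Realize, Interp.Start, Fin.snoc]

theorem realize_withPred {φ : churchLang.Sentence} {n : ℕ} :
    M ⊨ withPred φ n ↔ (∀ i < n, (ofStructure M).Pred i) ∧ M ⊨ φ := by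
  induction n with
  | zero => simp [withPred]
  | succ n ih =>
    rw [withPred, Nat.forall_lt_succ_right, and_assoc, and_left_comm, ← ih,
      ← realize_predSentence]
    simp [Sentence.Realize, Formula.Realize]

theorem realize_haltSentence {c : Code} {n : ℕ} :
    M ⊨ haltSentence c n ↔ (ofStructure M).Start c n ∧ (∀ i < n, (ofStructure M).Pred i) ∧
      (ofStructure M).Basic ∧ (ofStructure M).SoundBelow c := by
  rw [← realize_startSentence, ← realize_basicSentence, ← realize_soundBelowSentence]
  have h := realize_withPred (M := M) (φ := basicSentence ⊓ soundBelowSentence c) (n := n)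
  simp only [haltSentence, Sentence.Realize, Formula.Realize, BoundedFormula.realize_inf] at h ⊢
  rw [h]

end Realize

theorem finSatSentence_haltSentence {c : Code} {n : ℕ} :
    FinSatSentence (haltSentence c n) ↔ (c.eval [n]).Dom := by
  rw [dom_eval_iff]
  constructor
  · rintro ⟨M, S, -, hf, h⟩
    obtain ⟨hs, hP, hB, hc⟩ := realize_haltSentence.1 h
    exact ⟨M, ofStructure M, hf, hB, hc, hP, hs⟩
  · rintro ⟨M, W, hf, hB, hc, hP, hs⟩
    refine ⟨M, toStructure W, ⟨hs.choose⟩, hf, ?_⟩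
    refine (@realize_haltSentence M (toStructure W) c n).2 ?_
    rw [ofStructure_toStructure]
    exact ⟨hs, hP, hB, hc⟩

/-! ### The sentences are computable -/

/-- The codes of the symbols of a formula. -/
def symbols {k : ℕ} (φ : churchLang.BoundedFormula Empty k) : List ℕ :=
  φ.listEncode.map (@Encodable.encode _ churchGammaEncodable)

theorem encode_map_encode {α : Type*} [Encodable α] (l : List α) :
    Encodable.encode (l.map Encodable.encode) = Encodable.encode l := by
  induction l with
  | nil => rfl
  | cons a l ih => simp [ih]

theorem encode_symbols (φ : churchLang.Sentence) :
    Encodable.encode (symbols φ) = Encodable.encode φ :=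
  @encode_map_encode _ churchGammaEncodable _

/-- The code of the implication symbol. -/
def impNum : ℕ := @Encodable.encode _ churchGammaEncodable (.inr (.inr 0))

theorem symbols_imp {k : ℕ} (φ ψ : churchLang.BoundedFormula Empty k) :
    symbols (φ.imp ψ) = impNum :: (symbols φ ++ symbols ψ) := by
  simp [symbols, BoundedFormula.listEncode, impNum]

theorem symbols_inf {k : ℕ} (φ ψ : churchLang.BoundedFormula Empty k) :
    symbols (φ ⊓ ψ) = impNum :: (impNum :: (symbols φ ++ impNum :: (symbols ψ ++
      symbols (⊥ : churchLang.BoundedFormula Empty k))) ++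
        symbols (⊥ : churchLang.BoundedFormula Empty k)) := by
  rw [← symbols_imp, ← symbols_imp, ← symbols_imp]
  rfl

/-- A sequence of formulas with primitive recursive encodings. -/
def PrimrecFormula {k : ℕ} (φ : ℕ → churchLang.BoundedFormula Empty k) : Prop :=
  Primrec fun n => symbols (φ n)

namespace PrimrecFormula

variable {k : ℕ} {φ ψ : ℕ → churchLang.BoundedFormula Empty k}

theorem const (φ : churchLang.BoundedFormula Empty k) : PrimrecFormula fun _ => φ :=
  Primrec.const _

theorem imp (hφ : PrimrecFormula φ) (hψ : PrimrecFormula ψ) :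
    PrimrecFormula fun n => (φ n).imp (ψ n) := by
  simp only [PrimrecFormula, symbols_imp]
  exact Primrec.list_cons.comp (.const _) (Primrec.list_append.comp hφ hψ)

theorem all {φ : ℕ → churchLang.BoundedFormula Empty (k + 1)} (hφ : PrimrecFormula φ) :
    PrimrecFormula fun n => (φ n).all :=
  Primrec.list_cons.comp (.const _) hφ

theorem not (hφ : PrimrecFormula φ) : PrimrecFormula fun n => ∼(φ n) :=
  hφ.imp (const _)

theorem ex {φ : ℕ → churchLang.BoundedFormula Empty (k + 1)} (hφ : PrimrecFormula φ) :
    PrimrecFormula fun n => ∃' (φ n) :=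
  hφ.not.all.not

theorem inf (hφ : PrimrecFormula φ) (hψ : PrimrecFormula ψ) :
    PrimrecFormula fun n => φ n ⊓ ψ n :=
  (hφ.imp hψ.not).not

theorem fNum {e : ℕ → ℕ} (he : Primrec e) (x : Fin k) :
    PrimrecFormula fun n => fNum (e n) x := by
  have h n : symbols (Trakhtenbrot.fNum (e n) x) =
      (2 * (2 * Nat.pair 1 (2 * e n)) + 1) :: (symbols (Trakhtenbrot.fNum 0 x)).tail := rfl
  simp only [PrimrecFormula, h]
  refine Primrec.list_cons.comp (Primrec.succ.comp ?_) (.const _)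
  have double {e : ℕ → ℕ} (he : Primrec e) : Primrec fun n => 2 * e n :=
    Primrec.nat_mul.comp (.const 2) he
  exact double (double (Primrec₂.natPair.comp (.const 1) (double he)))

theorem withPred (φ : churchLang.Sentence) : PrimrecFormula (withPred φ) := by
  have hp : PrimrecFormula predSentence :=
    ((fNum .succ 0).imp ((const _).inf ((const _).inf (fNum .id 1)).ex)).all
  have hstep : Primrec₂ fun (n : ℕ) (l : List ℕ) =>
      impNum :: (impNum :: (symbols (predSentence n) ++ impNum :: (l ++
        symbols (⊥ : churchLang.Sentence))) ++ symbols (⊥ : churchLang.Sentence)) :=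
    Primrec.list_cons.comp (.const _) (Primrec.list_append.comp
      (Primrec.list_cons.comp (.const _) (Primrec.list_append.comp (hp.comp .fst)
        (Primrec.list_cons.comp (.const _) (Primrec.list_append.comp .snd (.const _)))))
      (.const _))
  refine (Primrec.nat_rec₁ (symbols φ) hstep).of_eq fun n => ?_
  induction n with
  | zero => rfl
  | succ n ih =>
    rw [Trakhtenbrot.withPred, symbols_inf, ← ih]

theorem haltSentence (c : Code) : PrimrecFormula (haltSentence c) :=
  ((const _).inf ((const _).inf (((const _).inf (fNum .id 3)).inf (const _)))).ex.ex.ex.ex.ex.inf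
    (withPred _)

end PrimrecFormula

theorem exists_code_dom_eval_iff :
    ∃ c : Code, ∀ e : Nat.Partrec.Code, (c.eval [Encodable.encode e]).Dom ↔ (e.eval 0).Dom := by
  have hg : Partrec fun n : ℕ => (Denumerable.ofNat Nat.Partrec.Code n).eval 0 :=
    Nat.Partrec.Code.eval_part.comp (Computable.ofNat _) (.const 0)
  obtain ⟨c, hc⟩ := Code.exists_code (Nat.Partrec'.part_iff₁.2 hg)
  refine ⟨c, fun e => ?_⟩
  have h := hc (Encodable.encode e ::ᵥ List.Vector.nil)
  rw [List.Vector.head_cons, Denumerable.ofNat_encode] at h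
  change c.eval [Encodable.encode e] = _ at h
  rw [h]
  rfl

end Trakhtenbrot

/-- Trakhtenbrot's theorem: no algorithm decides, given a sentence of the language with
countably many unary predicate symbols and two binary predicate symbols, whether it has a
finite model (a model with nonempty finite domain). -/
theorem trakhtenbrot_finite_satisfiability_undecidable :
    ¬ ∃ f : ℕ → Bool, Computable f ∧
      ∀ φ : churchLang.Sentence, (f (Encodable.encode φ) = true ↔ FinSatSentence φ) := by
  rintro ⟨f, hf, h⟩
  obtain ⟨c, hc⟩ := Trakhtenbrot.exists_code_dom_eval_iff
  refine ComputablePred.halting_problem 0 (ComputablePred.computable_iff.2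
    ⟨fun e => f (Encodable.encode (Trakhtenbrot.haltSentence c (Encodable.encode e))), ?_, ?_⟩)
  · refine hf.comp (Primrec.to_comp ?_)
    simp only [← Trakhtenbrot.encode_symbols]
    exact (Primrec.encode.comp (Trakhtenbrot.PrimrecFormula.haltSentence c)).comp Primrec.encode
  · funext e
    exact propext ((hc e).symm.trans (Trakhtenbrot.finSatSentence_haltSentence.symm.trans
      (h _).symm))
end
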